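/- Let B^n be the Löwner ellipsoid of a convex body K ⊆ B^n in ℝ^n, let c = n^{26n}, and let ε ∈ (0,1). If ℓ(K) ≥ (1−ε)ℓ(Δ_n), then there exists an orthogonal transformation T ∈ O(n) such that δ_vol(K, TΔ_n) ≤ c·ε^{1/4} and δ_H(K, TΔ_n) ≤ c·ε^{1/4}. -/

import Mathlib

open MeasureTheory Metric Set
open scoped RealInnerProductSpace ENNReal

noncomputable section

/-- The standard Gaussian measure `γ_n` on `ℝ^n`. -/
def gaussianM (n : ℕ) : Measure (EuclideanSpace ℝ (Fin n)) :=
  volume.withDensity fun x =>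
    ENNReal.ofReal ((2 * Real.pi) ^ (-(n : ℝ) / 2) * Real.exp (-‖x‖ ^ 2 / 2))

/-- The ℓ-norm of a convex body: `ℓ(K) = ∫ ‖x‖_K dγ_n(x)`, where `‖·‖_K` is the gauge of `K`. -/
def ellNorm (n : ℕ) (K : Set (EuclideanSpace ℝ (Fin n))) : ℝ :=
  ∫ x, gauge K x ∂(gaussianM n)

/-- The support function `h_K`. -/
def suppFn {n : ℕ} (K : Set (EuclideanSpace ℝ (Fin n))) (u : EuclideanSpace ℝ (Fin n)) : ℝ :=
  sSup ((fun y => ⟪u, y⟫) '' K)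

/-- The mean width `W(K) = (1/(n κ_n)) ∫_{S^{n-1}} (h_K(u) + h_K(-u)) du`, the integration over
the unit sphere being with respect to the (n-1)-dimensional Hausdorff measure. -/
def meanWidth (n : ℕ) (K : Set (EuclideanSpace ℝ (Fin n))) : ℝ :=
  (1 / (n * (volume (closedBall (0 : EuclideanSpace ℝ (Fin n)) 1)).toReal)) *
    ∫ u in sphere (0 : EuclideanSpace ℝ (Fin n)) 1,
      (suppFn K u + suppFn K (-u)) ∂(μH[(n : ℝ) - 1])

/-- The polar set `K° = {x : ⟨x,y⟩ ≤ 1 for all y ∈ K}`. -/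
def polarSet {n : ℕ} (K : Set (EuclideanSpace ℝ (Fin n))) : Set (EuclideanSpace ℝ (Fin n)) :=
  {x | ∀ y ∈ K, ⟪x, y⟫ ≤ 1}

/-- `w` lists the vertices of a regular simplex inscribed in the unit ball: `n+1` unit vectors
with pairwise inner products `-1/n`. -/
def IsRegVerts {n : ℕ} (w : Fin (n + 1) → EuclideanSpace ℝ (Fin n)) : Prop :=
  (∀ i, ‖w i‖ = 1) ∧ ∀ i j, i ≠ j → ⟪w i, w j⟫ = -1 / n

/-- An ellipsoid: an image of the closed Euclidean unit ball under an invertible affine map. -/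
def IsEllipsoid {n : ℕ} (D : Set (EuclideanSpace ℝ (Fin n))) : Prop :=
  ∃ f : EuclideanSpace ℝ (Fin n) ≃ᵃ[ℝ] EuclideanSpace ℝ (Fin n),
    D = f '' closedBall 0 1

/-- `D` is the Löwner ellipsoid (minimal volume ellipsoid containing) of `K`. -/
def IsLoewnerEllipsoid {n : ℕ} (D K : Set (EuclideanSpace ℝ (Fin n))) : Prop :=
  IsEllipsoid D ∧ K ⊆ D ∧ ∀ D', IsEllipsoid D' → K ⊆ D' → volume D ≤ volume D'

/-- `D` is the John ellipsoid (maximal volume ellipsoid contained in) of `K`. -/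
def IsJohnEllipsoid {n : ℕ} (D K : Set (EuclideanSpace ℝ (Fin n))) : Prop :=
  IsEllipsoid D ∧ D ⊆ K ∧ ∀ D', IsEllipsoid D' → D' ⊆ K → volume D' ≤ volume D

/-- The symmetric difference (volume) distance `δ_vol(K,C) = V(K∖C) + V(C∖K)`. -/
def volDist {n : ℕ} (K C : Set (EuclideanSpace ℝ (Fin n))) : ℝ :=
  (volume (K \ C)).toReal + (volume (C \ K)).toReal

section Part1

lemma isCompact_convexHull_aux {F : Type*} [NormedAddCommGroup F] [NormedSpace ℝ F]
    [FiniteDimensional ℝ F] {s : Set F} (hs : IsCompact s) : IsCompact (convexHull ℝ s) := by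
  rcases s.eq_empty_or_nonempty with rfl | ⟨s0, hs0⟩
  · simp
  set N := Module.finrank ℝ F + 1 with hN
  have hc : IsCompact ((stdSimplex ℝ (Fin N)) ×ˢ (Set.univ.pi fun _ : Fin N => s)) :=
    (isCompact_stdSimplex ℝ (Fin N)).prod (isCompact_univ_pi fun _ => hs)
  have hf : Continuous fun p : (Fin N → ℝ) × (Fin N → F) => ∑ i, p.1 i • p.2 i := by fun_prop
  have := hc.image hf
  convert this using 1
  ext x
  constructor
  · intro hx
    obtain ⟨ι, _, z, w, hz, hai, hw, hw1, hsum⟩ := eq_pos_convex_span_of_mem_convexHull hx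
    have hcard : Fintype.card ι ≤ N := by
      refine hai.card_le_finrank_succ.trans ?_
      rw [hN]; gcongr
      exact Submodule.finrank_le _
    obtain ⟨e⟩ : Nonempty (ι ↪ Fin N) :=
      Function.Embedding.nonempty_of_card_le (by simpa using hcard)
    refine ⟨⟨Function.extend e w 0, Function.extend e z (fun _ => s0)⟩, ⟨⟨?_, ?_⟩, ?_⟩, ?_⟩
    · intro i
      by_cases h : ∃ a, e a = i
      · obtain ⟨a, rfl⟩ := h
        simp [e.injective.extend_apply, (hw a).le]
      · simp [Function.extend_apply' _ _ _ h]
    · rw [← hw1]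
      symm
      apply Finset.sum_of_injOn e e.injective.injOn (by simp)
      · intro i _ hi
        have h : ¬ ∃ a, e a = i := by simpa using hi
        simp [Function.extend_apply' _ _ _ h]
      · intro a _; simp [e.injective.extend_apply]
    · intro i _
      by_cases h : ∃ a, e a = i
      · obtain ⟨a, rfl⟩ := h
        simp only [e.injective.extend_apply]
        exact hz ⟨a, rfl⟩
      · simp [Function.extend_apply' _ _ _ h, hs0]
    · rw [← hsum]
      symm
      apply Finset.sum_of_injOn e e.injective.injOn (by simp)
      · intro i _ hi
        have h : ¬ ∃ a, e a = i := by simpa using hi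
        simp [Function.extend_apply' _ _ _ h]
      · intro a _; simp [e.injective.extend_apply]
  · rintro ⟨⟨w, z⟩, ⟨⟨hw0, hw1⟩, hz⟩, rfl⟩
    exact (convex_convexHull ℝ s).sum_mem (fun i _ => hw0 i) hw1
      (fun i _ => subset_convexHull ℝ s (hz i trivial))

/-- moment map -/
def momMap {n : ℕ} (u : EuclideanSpace ℝ (Fin n)) : (Fin n × Fin n → ℝ) × (Fin n → ℝ) :=
  (fun p => u p.1 * u p.2, fun i => u i)

lemma john_pert {n : ℕ} (K : Set (EuclideanSpace ℝ (Fin n)))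
    (hKcomp : IsCompact K) (hKB : K ⊆ closedBall 0 1)
    (H : EuclideanSpace ℝ (Fin n) →ₗ[ℝ] EuclideanSpace ℝ (Fin n)) (h : EuclideanSpace ℝ (Fin n))
    (hq : ∀ u ∈ K, ‖u‖ = 1 → ⟪u, H u + h⟫ < 0) :
    ∃ δ₀ > (0:ℝ), ∀ δ : ℝ, 0 < δ → δ < δ₀ → ∀ x ∈ K, ‖x + δ • (H x + h)‖ ≤ 1 := by
  have hHc : Continuous H := H.continuous_of_finiteDimensional
  rcases K.eq_empty_or_nonempty with rfl | hne
  · exact ⟨1, one_pos, by simp⟩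
  have hG : ContinuousOn (fun x => max (1 - ‖x‖ ^ 2) (-⟪x, H x + h⟫)) K := by fun_prop
  obtain ⟨x₀, hx₀, hmin⟩ := hKcomp.exists_isMinOn hne hG
  have hM1 : ContinuousOn (fun x => max |⟪x, H x + h⟫| (‖H x + h‖ ^ 2)) K := by fun_prop
  obtain ⟨x₁, hx₁, hmax⟩ := hKcomp.exists_isMaxOn hne hM1
  set τ := max (1 - ‖x₀‖ ^ 2) (-⟪x₀, H x₀ + h⟫) with hτ
  have hτ0 : 0 < τ := by
    have h1 : ‖x₀‖ ≤ 1 := by simpa using hKB hx₀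
    rcases h1.lt_or_eq with h1 | h1
    · apply lt_max_of_lt_left; nlinarith [norm_nonneg x₀]
    · apply lt_max_of_lt_right; linarith [hq x₀ hx₀ h1]
  set M := max |⟪x₁, H x₁ + h⟫| (‖H x₁ + h‖ ^ 2) + 1 with hM
  have hM0 : 1 ≤ M := by
    have : 0 ≤ max |⟪x₁, H x₁ + h⟫| (‖H x₁ + h‖ ^ 2) := le_max_of_le_left (abs_nonneg _)
    linarith
  refine ⟨min 1 (τ / (4 * M)), by positivity, ?_⟩
  intro δ hδ hδ' x hx
  have hδ1 : δ < 1 := hδ'.trans_le (min_le_left _ _)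
  have hδM : δ * (4 * M) < τ := by
    have := hδ'.trans_le (min_le_right _ _)
    rwa [lt_div_iff₀ (by positivity)] at this
  have h2 : max |⟪x, H x + h⟫| (‖H x + h‖ ^ 2) ≤ M - 1 := by
    have := hmax hx; simp only [mem_ofPred_eq] at this; linarith
  have h3 : τ ≤ max (1 - ‖x‖ ^ 2) (-⟪x, H x + h⟫) := hmin hx
  have h4 : |⟪x, H x + h⟫| ≤ M - 1 := (le_max_left _ _).trans h2
  have h5 : ‖H x + h‖ ^ 2 ≤ M - 1 := (le_max_right _ _).trans h2
  have h6 : ‖x‖ ≤ 1 := by simpa using hKB hx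
  have h7 : ‖x + δ • (H x + h)‖ ^ 2 = ‖x‖ ^ 2 + 2 * δ * ⟪x, H x + h⟫ + δ ^ 2 * ‖H x + h‖ ^ 2 := by
    rw [norm_add_sq_real, inner_smul_right, norm_smul, mul_pow]
    simp; ring
  have h8 : ‖x + δ • (H x + h)‖ ^ 2 ≤ 1 := by
    rw [h7]
    have h9 : δ ^ 2 * ‖H x + h‖ ^ 2 ≤ δ * M := by
      have : δ ^ 2 * ‖H x + h‖ ^ 2 ≤ δ ^ 2 * M := by gcongr; linarith
      have h10 : δ * δ * M ≤ δ * 1 * M := by gcongr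
      nlinarith
    rcases le_max_iff.1 h3 with h3 | h3
    · have := (abs_le.1 h4).2
      nlinarith
    · nlinarith [norm_nonneg x]
  exact (sq_le_one_iff₀ (norm_nonneg _)).1 h8

lemma john_det {n : ℕ} (H : Matrix (Fin n) (Fin n) ℝ) (hH : 0 < H.trace) :
    ∃ δ₀ > (0:ℝ), ∀ δ : ℝ, 0 < δ → δ < δ₀ → 1 < (1 + δ • H).det := by
  set P : Polynomial ℝ := (1 + (Polynomial.X : Polynomial ℝ) • H.map ⇑(Polynomial.C (R := ℝ))).det.divX.divX with hP
  have hc : Continuous fun r : ℝ => H.trace + P.eval r * r := by fun_prop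
  have h0 : ∀ᶠ r in nhds (0:ℝ), 0 < H.trace + P.eval r * r := by
    apply hc.continuousAt.eventually_const_lt
    simpa using hH
  obtain ⟨δ₀, hδ₀, hb⟩ := Metric.eventually_nhds_iff.1 h0
  refine ⟨δ₀, hδ₀, fun δ hδ hδ' => ?_⟩
  have := hb (y := δ) (by simpa [abs_of_pos hδ] using hδ')
  rw [Matrix.det_one_add_smul]
  rw [← hP]
  nlinarith

lemma john_sep {n : ℕ} (K : Set (EuclideanSpace ℝ (Fin n)))
    (hKcomp : IsCompact K)
    (hL : IsLoewnerEllipsoid (closedBall (0 : EuclideanSpace ℝ (Fin n)) 1) K)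
    (H : Matrix (Fin n) (Fin n) ℝ) (hH : 0 < H.trace) (h : EuclideanSpace ℝ (Fin n))
    (hq : ∀ u ∈ K, ‖u‖ = 1 → ⟪u, Matrix.toEuclideanLin H u + h⟫ < 0) : False := by
  obtain ⟨δ₁, hδ₁, h1⟩ := john_pert K hKcomp hL.2.1 (Matrix.toEuclideanLin H) h hq
  obtain ⟨δ₂, hδ₂, h2⟩ := john_det H hH
  obtain ⟨δ, hδ, hδ'⟩ := exists_between (lt_min hδ₁ hδ₂)
  have h1 := h1 δ hδ (hδ'.trans_le (min_le_left _ _))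
  have h2 := h2 δ hδ (hδ'.trans_le (min_le_right _ _))
  set G : EuclideanSpace ℝ (Fin n) →ₗ[ℝ] EuclideanSpace ℝ (Fin n) :=
    Matrix.toEuclideanLin (1 + δ • H) with hG
  have hdet : LinearMap.det G = (1 + δ • H).det := by
    rw [hG, Matrix.toEuclideanLin_eq_toLin_orthonormal, LinearMap.det_toLin]
  have hGx : ∀ x, G x = x + δ • Matrix.toEuclideanLin H x := by
    intro x
    simp [hG, map_add, Matrix.toEuclideanLin_eq_toLin_orthonormal]
  have hdet0 : LinearMap.det G ≠ 0 := by rw [hdet]; linarith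
  let e := LinearMap.equivOfDetNeZero G hdet0
  let g : EuclideanSpace ℝ (Fin n) ≃ᵃ[ℝ] EuclideanSpace ℝ (Fin n) :=
    e.toAffineEquiv.trans (AffineEquiv.constVAdd ℝ _ (δ • h))
  have hg : ∀ x, g x = δ • h + G x := fun x => rfl
  set D' := g.symm '' closedBall 0 1 with hD'
  have hKD : K ⊆ D' := by
    intro x hx
    refine ⟨g x, ?_, by simp⟩
    have := h1 x hx
    rw [mem_closedBall_zero_iff, hg, hGx]
    have e9 : δ • h + (x + δ • Matrix.toEuclideanLin H x)
        = x + δ • (Matrix.toEuclideanLin H x + h) := by module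
    rw [e9]; exact this
  have hvol := hL.2.2 D' ⟨g.symm, rfl⟩ hKD
  have hB : closedBall (0 : EuclideanSpace ℝ (Fin n)) 1 = (fun x => δ • h + x) '' (G '' D') := by
    rw [image_image]
    have : (fun x => δ • h + G x) = g := by ext1 x; rw [hg]
    rw [this, hD', image_image]; simp
  have hv2 : volume (closedBall (0 : EuclideanSpace ℝ (Fin n)) 1)
      = ENNReal.ofReal |LinearMap.det G| * volume D' := by
    conv_lhs => rw [hB]
    rw [← Measure.addHaar_image_linearMap]
    simp
  have hfin : volume D' ≠ ⊤ := by
    intro htop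
    rw [htop, ENNReal.mul_top (by simp [hdet0])] at hv2
    exact (measure_closedBall_lt_top (μ := volume)).ne hv2
  have hpos : volume D' ≠ 0 := by
    intro h0
    rw [h0, mul_zero] at hv2
    exact (measure_closedBall_pos volume (0 : EuclideanSpace ℝ (Fin n)) one_pos).ne' hv2
  rw [hv2] at hvol
  have h3 : 1 < ENNReal.ofReal |LinearMap.det G| := by
    rw [hdet]; simpa using lt_of_lt_of_le h2 (le_abs_self _)
  have := ENNReal.mul_lt_mul_left hpos hfin h3
  rw [one_mul] at this
  exact absurd hvol (not_le.2 this)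

/-- John's theorem, necessity direction. -/
lemma john_loewner {n : ℕ} (hn : 1 ≤ n) (K : Set (EuclideanSpace ℝ (Fin n)))
    (hKcomp : IsCompact K)
    (hL : IsLoewnerEllipsoid (closedBall (0 : EuclideanSpace ℝ (Fin n)) 1) K) :
    ∃ (ι : Type) (_ : Fintype ι) (c : ι → ℝ) (u : ι → EuclideanSpace ℝ (Fin n)),
      (∀ i, 0 ≤ c i) ∧ ∑ i, c i = 1 ∧ (∀ i, u i ∈ K) ∧ (∀ i, ‖u i‖ = 1) ∧
      ∑ i, c i • u i = 0 ∧ ∀ x, ∑ i, (c i * ⟪u i, x⟫) • u i = (1 / (n:ℝ)) • x := by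
  set S : Set ((Fin n × Fin n → ℝ) × (Fin n → ℝ)) := momMap '' (K ∩ sphere 0 1) with hS
  have hmc : Continuous (momMap (n := n)) := by unfold momMap; fun_prop
  have hScomp : IsCompact S := (hKcomp.inter_right isClosed_sphere).image hmc
  set tgt : (Fin n × Fin n → ℝ) × (Fin n → ℝ) := (fun p => if p.1 = p.2 then 1 / (n:ℝ) else 0, 0)
    with htgt
  have hmem : tgt ∈ convexHull ℝ S := by
    by_contra hnot
    obtain ⟨φ, s, t, h1, hst, h2⟩ := geometric_hahn_banach_compact_closed (convex_convexHull ℝ S)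
      (isCompact_convexHull_aux hScomp) (convex_singleton tgt) isClosed_singleton
      (by simpa using hnot)
    have h2 := h2 tgt rfl
    set H : Matrix (Fin n) (Fin n) ℝ := Matrix.of fun i j => φ (Pi.single (i, j) 1, 0) with hH
    set h : EuclideanSpace ℝ (Fin n) := WithLp.toLp 2 fun i => φ (0, Pi.single i 1) with hh
    have hφ : ∀ a b, φ (a, b) = ∑ p, a p * H p.1 p.2 + ∑ i, b i * h i := by
      intro a b
      have e1 : (a, b) = ∑ p, a p • ((Pi.single p 1, 0) : (Fin n × Fin n → ℝ) × (Fin n → ℝ))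
          + ∑ i, b i • ((0, Pi.single i 1) : (Fin n × Fin n → ℝ) × (Fin n → ℝ)) := by
        ext p
        · simp [Prod.fst_sum, Finset.sum_apply, Pi.single_apply]
        · simp [Prod.snd_sum, Finset.sum_apply, Pi.single_apply]
      rw [e1, map_add, map_sum, map_sum]
      simp only [map_smul, smul_eq_mul]
      simp [hH, hh]
    have hn' : (n:ℝ) ≠ 0 := by positivity
    refine john_sep K hKcomp hL (H - s • (1 : Matrix (Fin n) (Fin n) ℝ)) ?_ h ?_
    · have : s < φ tgt := hst.trans h2
      rw [htgt, hφ] at this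
      have e2 : ∑ p : Fin n × Fin n, (if p.1 = p.2 then 1 / (n:ℝ) else 0) * H p.1 p.2
          = H.trace / n := by
        rw [Fintype.sum_prod_type]
        simp [Matrix.trace, Finset.sum_div]
        refine Finset.sum_congr rfl fun i _ => ?_
        field_simp
      simp only [e2] at this
      rw [Matrix.trace_sub, Matrix.trace_smul, Matrix.trace_one]
      have hn0 : (0:ℝ) < n := by positivity
      simp at this ⊢
      rw [lt_div_iff₀ hn0] at this
      exact this
    · intro u hu hu1
      have h3 := h1 (momMap u) (subset_convexHull ℝ S ⟨u, ⟨hu, by simpa using hu1⟩, rfl⟩)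
      rw [momMap, hφ] at h3
      have e3 : ⟪u, Matrix.toEuclideanLin (H - s • (1 : Matrix (Fin n) (Fin n) ℝ)) u + h⟫
          = ∑ p : Fin n × Fin n, u p.1 * u p.2 * H p.1 p.2 + ∑ i, u i * h i - s * ‖u‖ ^ 2 := by
        rw [inner_add_right, map_sub, LinearMap.sub_apply, inner_sub_right]
        have e4 : ⟪u, Matrix.toEuclideanLin (s • (1 : Matrix (Fin n) (Fin n) ℝ)) u⟫ = s * ‖u‖ ^ 2 := by
          simp [Matrix.toEuclideanLin_eq_toLin_orthonormal, inner_smul_right]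
        rw [e4, Fintype.sum_prod_type]
        simp [PiLp.inner_apply, Matrix.toLpLin_apply, Matrix.mulVec, dotProduct, Finset.mul_sum, Finset.sum_mul]
        have e5 : ∑ x, ∑ x_1, H x x_1 * u.ofLp x_1 * u.ofLp x = ∑ x, ∑ x_1, u.ofLp x * u.ofLp x_1 * H x x_1 := by
          refine Finset.sum_congr rfl fun i _ => Finset.sum_congr rfl fun j _ => by ring
        have e6 : ∑ x, h.ofLp x * u.ofLp x = ∑ i, u.ofLp i * h.ofLp i :=
          Finset.sum_congr rfl fun i _ => by ring
        linarith
      rw [e3, hu1]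
      linarith
  obtain ⟨ι, _, z, c, hz, -, hc, hc1, hsum⟩ := eq_pos_convex_span_of_mem_convexHull hmem
  have : ∀ i, ∃ u, u ∈ K ∧ ‖u‖ = 1 ∧ momMap u = z i := by
    intro i
    obtain ⟨u, ⟨hu, hu1⟩, hu2⟩ := hz ⟨i, rfl⟩
    exact ⟨u, hu, by simpa using hu1, hu2⟩
  choose u hu hu1 hu2 using this
  refine ⟨ι, inferInstance, c, u, fun i => (hc i).le, hc1, hu, hu1, ?_, ?_⟩
  · ext j
    have := congrFun (congrArg Prod.snd hsum) j
    simp only [← hu2, momMap, Prod.snd_sum, Finset.sum_apply] at this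
    simpa [htgt] using this
  · intro x
    ext j
    have key : ∀ k, ∑ i, c i * (u i j * u i k) = if j = k then 1 / (n:ℝ) else 0 := by
      intro k
      have := congrFun (congrArg Prod.fst hsum) (j, k)
      simp only [← hu2, momMap, Prod.fst_sum, Finset.sum_apply] at this
      simpa [htgt] using this
    have : (∑ i, (c i * ⟪u i, x⟫) • u i).ofLp j = ∑ k, x k * ∑ i, c i * (u i j * u i k) := by
      simp only [PiLp.inner_apply, Finset.mul_sum, WithLp.ofLp_sum, Finset.sum_apply, PiLp.smul_apply, smul_eq_mul, Finset.sum_mul]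
      rw [Finset.sum_comm]
      refine Finset.sum_congr rfl fun k _ => Finset.sum_congr rfl fun i _ => ?_
      simp; ring
    rw [this]
    simp [key]
    ring
end Part1

section Part2

section Frame
variable {V : Type*} [NormedAddCommGroup V] [InnerProductSpace ℝ V] [FiniteDimensional ℝ V]
  {ι : Type*} [Fintype ι]

lemma frame_inner {d : ι → ℝ} {v : ι → V} (hF : ∀ x, ∑ i, (d i * ⟪v i, x⟫) • v i = x) (x y : V) :
    ∑ i, d i * (⟪v i, x⟫ * ⟪v i, y⟫) = ⟪x, y⟫ := by
  conv_rhs => rw [← hF x]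
  rw [sum_inner]
  refine Finset.sum_congr rfl fun i _ => ?_
  rw [inner_smul_left]; simp; ring

lemma frame_norm {d : ι → ℝ} {v : ι → V} (hF : ∀ x, ∑ i, (d i * ⟪v i, x⟫) • v i = x) (x : V) :
    ∑ i, d i * ⟪v i, x⟫ ^ 2 = ‖x‖ ^ 2 := by
  rw [← real_inner_self_eq_norm_sq, ← frame_inner hF]
  refine Finset.sum_congr rfl fun i _ => by ring

lemma frame_le {d : ι → ℝ} {v : ι → V} (hd : ∀ i, 0 ≤ d i)
    (hF : ∀ x, ∑ i, (d i * ⟪v i, x⟫) • v i = x) (a : ι → ℝ) :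
    ‖∑ i, (d i * a i) • v i‖ ^ 2 ≤ ∑ i, d i * a i ^ 2 := by
  set z := ∑ i, (d i * a i) • v i with hz
  have h1 : ∑ i, d i * (a i * ⟪v i, z⟫) = ‖z‖ ^ 2 := by
    rw [← real_inner_self_eq_norm_sq]
    conv_rhs => rw [hz, sum_inner]
    refine Finset.sum_congr rfl fun i _ => ?_
    rw [← hz, inner_smul_left]; simp; ring
  have h2 : 0 ≤ ∑ i, d i * (a i - ⟪v i, z⟫) ^ 2 :=
    Finset.sum_nonneg fun i _ => mul_nonneg (hd i) (sq_nonneg _)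
  have h3 : ∑ i, d i * (a i - ⟪v i, z⟫) ^ 2
      = ∑ i, d i * a i ^ 2 - 2 * ∑ i, d i * (a i * ⟪v i, z⟫) + ∑ i, d i * ⟪v i, z⟫ ^ 2 := by
    rw [Finset.mul_sum, ← Finset.sum_sub_distrib, ← Finset.sum_add_distrib]
    refine Finset.sum_congr rfl fun i _ => by ring
  rw [h3, h1, frame_norm hF] at h2
  linarith

lemma frame_card {d : ι → ℝ} {v : ι → V} (hF : ∀ x, ∑ i, (d i * ⟪v i, x⟫) • v i = x)
    (hv : ∀ i, ‖v i‖ = 1) : ∑ i, d i = Module.finrank ℝ V := by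
  let e := stdOrthonormalBasis ℝ V
  have h1 : ∀ k, ∑ i, d i * ⟪v i, e k⟫ ^ 2 = 1 := fun k => by
    rw [frame_norm hF]; simp
  have h2 : ∑ k, ∑ i, d i * ⟪v i, e k⟫ ^ 2 = Module.finrank ℝ V := by simp [h1]
  rw [← h2, Finset.sum_comm]
  refine Finset.sum_congr rfl fun i _ => ?_
  rw [← Finset.mul_sum]
  have : ∑ k, ⟪v i, e k⟫ ^ 2 = 1 := by
    have := e.sum_sq_norm_inner_left (v i)
    simpa [hv i] using this
  rw [this, mul_one]

/-- The frame operator with weights `t`. -/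
def frOp (d : ι → ℝ) (v : ι → V) (t : ι → ℝ) : V →ₗ[ℝ] V :=
  ∑ i, (d i * t i) • (LinearMap.toSpanSingleton ℝ V (v i)).comp (innerₛₗ ℝ (v i))

lemma frOp_apply (d : ι → ℝ) (v : ι → V) (t : ι → ℝ) (x : V) :
    frOp d v t x = ∑ i, (d i * t i * ⟪v i, x⟫) • v i := by
  simp [frOp, LinearMap.sum_apply, smul_smul]

lemma frOp_inner (d : ι → ℝ) (v : ι → V) (t : ι → ℝ) (x y : V) :
    ⟪frOp d v t x, y⟫ = ∑ i, d i * t i * (⟪v i, x⟫ * ⟪v i, y⟫) := by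
  rw [frOp_apply, sum_inner]
  refine Finset.sum_congr rfl fun i _ => ?_
  rw [inner_smul_left]; simp; ring

lemma frOp_symm (d : ι → ℝ) (v : ι → V) (t : ι → ℝ) : (frOp d v t).IsSymmetric := by
  intro x y
  rw [frOp_inner, real_inner_comm, frOp_inner]
  refine Finset.sum_congr rfl fun i _ => by ring

lemma log_aux {t l M : ℝ} (ht : 0 < t) (hl : 0 < l) (htM : t ≤ M) (hlM : l ≤ M) :
    Real.log t ≤ Real.log l + (t / l - 1) - (t - l) ^ 2 / (4 * M ^ 2) := by
  have hM : 0 < M := ht.trans_le htM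
  have h1 : Real.log (t / l) = 2 * Real.log (√t / √l) := by
    rw [← Real.sqrt_div ht.le, Real.log_sqrt (by positivity)]; ring
  have h2 : Real.log (√t / √l) ≤ √t / √l - 1 := Real.log_le_sub_one_of_pos (by positivity)
  rw [Real.log_div ht.ne' hl.ne'] at h1
  have h3 : (t / l - 1) - 2 * (√t / √l - 1) = (√t - √l) ^ 2 / l := by
    have a := Real.sq_sqrt ht.le
    have b := Real.sq_sqrt hl.le
    have hb : 0 < √l := Real.sqrt_pos.2 hl
    generalize √t = p at *
    generalize √l = q at *
    subst a b
    field_simp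
    ring
  have h4 : (t - l) ^ 2 / (4 * M ^ 2) ≤ (√t - √l) ^ 2 / l := by
    have a := Real.sq_sqrt ht.le
    have b := Real.sq_sqrt hl.le
    rw [div_le_div_iff₀ (by positivity) hl]
    have : (t - l) ^ 2 = (√t - √l) ^ 2 * (√t + √l) ^ 2 := by
      rw [← mul_pow]; congr 1; linear_combination -a + b
    rw [this]
    have h5 : (√t + √l) ^ 2 ≤ 4 * M := by nlinarith [sq_nonneg (√t - √l)]
    have h6 : (√t + √l) ^ 2 * l ≤ 4 * M * M := by gcongr
    nlinarith [mul_le_mul_of_nonneg_left h6 (sq_nonneg (√t - √l))]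
  linarith

lemma frOp_det {d : ι → ℝ} {v : ι → V} (hd : ∀ i, 0 ≤ d i)
    (hF : ∀ x, ∑ i, (d i * ⟪v i, x⟫) • v i = x) (hv : ∀ i, ‖v i‖ = 1) (t : ι → ℝ)
    (ht : ∀ i, 0 < t i) (M : ℝ) (htM : ∀ i, t i ≤ M) :
    0 < LinearMap.det (frOp d v t) ∧
    ∑ i, d i * Real.log (t i) + (1 / (16 * M ^ 2)) *
      ∑ i, ∑ j, d i * d j * (⟪v i, v j⟫ ^ 2 * (t i - t j) ^ 2)
      ≤ Real.log (LinearMap.det (frOp d v t)) := by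
  have hs := frOp_symm d v t
  set A := frOp d v t with hA
  set e := hs.eigenvectorBasis rfl with he
  set l := hs.eigenvalues rfl with hl
  have hAe : ∀ k, A (e k) = l k • e k := fun k => by
    exact hs.apply_eigenvectorBasis rfl k
  have h1 : ∀ k, ∑ i, d i * ⟪v i, e k⟫ ^ 2 = 1 := fun k => by rw [frame_norm hF]; simp
  have h1' : ∀ i, ∑ k, ⟪v i, e k⟫ ^ 2 = 1 := fun i => by
    have := e.sum_sq_norm_inner_left (v i)
    simpa [hv i] using this
  have hlk : ∀ k, l k = ∑ i, d i * t i * ⟪v i, e k⟫ ^ 2 := fun k => by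
    have : ⟪A (e k), e k⟫ = l k := by rw [hAe, inner_smul_left]; simp
    rw [← this, frOp_inner]
    refine Finset.sum_congr rfl fun i _ => by ring
  have hlM : ∀ k, l k ≤ M := fun k => by
    have : ∑ i, d i * t i * ⟪v i, e k⟫ ^ 2 ≤ ∑ i, M * (d i * ⟪v i, e k⟫ ^ 2) := by
      refine Finset.sum_le_sum fun i _ => ?_
      have := mul_le_mul_of_nonneg_right (htM i) (mul_nonneg (hd i) (sq_nonneg ⟪v i, e k⟫))
      linarith
    rw [← Finset.mul_sum, h1] at this
    rw [hlk]; linarith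
  have hl0 : ∀ k, 0 < l k := fun k => by
    have h0 : 0 ≤ l k := by
      rw [hlk]
      exact Finset.sum_nonneg fun i _ => mul_nonneg (mul_nonneg (hd i) (ht i).le) (sq_nonneg _)
    rcases h0.lt_or_eq with h | h
    · exact h
    exfalso
    rw [hlk, eq_comm, Finset.sum_eq_zero_iff_of_nonneg
      (fun i _ => mul_nonneg (mul_nonneg (hd i) (ht i).le) (sq_nonneg _))] at h
    have : ∑ i, d i * ⟪v i, e k⟫ ^ 2 = 0 := Finset.sum_eq_zero fun i hi => by
      have := h i hi
      have ht' := (ht i).ne'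
      have h3 : t i * (d i * ⟪v i, e k⟫ ^ 2) = 0 := by linarith
      exact (mul_eq_zero.1 h3).resolve_left ht'
    linarith [h1 k]
  have hdet : LinearMap.det A = ∏ k, l k := by
    simpa using hs.det_eq_prod_eigenvalues rfl
  refine ⟨by rw [hdet]; exact Finset.prod_pos fun k _ => hl0 k, ?_⟩
  rw [hdet, Real.log_prod (fun k _ => (hl0 k).ne')]
  have h2 : ∑ i, ∑ k, d i * ⟪v i, e k⟫ ^ 2 * Real.log (t i)
      ≤ ∑ i, ∑ k, d i * ⟪v i, e k⟫ ^ 2 *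
        (Real.log (l k) + (t i / l k - 1) - (t i - l k) ^ 2 / (4 * M ^ 2)) := by
    refine Finset.sum_le_sum fun i _ => Finset.sum_le_sum fun k _ => ?_
    exact mul_le_mul_of_nonneg_left (log_aux (ht i) (hl0 k) (htM i) (hlM k))
      (mul_nonneg (hd i) (sq_nonneg _))
  have h3 : ∑ i, ∑ k, d i * ⟪v i, e k⟫ ^ 2 * Real.log (t i) = ∑ i, d i * Real.log (t i) := by
    refine Finset.sum_congr rfl fun i _ => ?_
    rw [← Finset.sum_mul, ← Finset.mul_sum, h1', mul_one]
  have h4 : ∑ i, ∑ k, d i * ⟪v i, e k⟫ ^ 2 *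
        (Real.log (l k) + (t i / l k - 1) - (t i - l k) ^ 2 / (4 * M ^ 2))
      = ∑ k, Real.log (l k) - (1 / (4 * M ^ 2)) *
        ∑ i, d i * ∑ k, ⟪v i, e k⟫ ^ 2 * (t i - l k) ^ 2 := by
    have e1 : ∀ k, ∑ i, d i * ⟪v i, e k⟫ ^ 2 * (Real.log (l k) + (t i / l k - 1))
        = Real.log (l k) := fun k => by
      have : ∀ i, d i * ⟪v i, e k⟫ ^ 2 * (Real.log (l k) + (t i / l k - 1))
        = (Real.log (l k) - 1) * (d i * ⟪v i, e k⟫ ^ 2)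
          + (d i * t i * ⟪v i, e k⟫ ^ 2) / l k := fun i => by ring
      simp_rw [this]
      rw [Finset.sum_add_distrib, ← Finset.mul_sum, h1, ← Finset.sum_div, ← hlk,
        div_self (hl0 k).ne']
      ring
    calc _ = ∑ i, ∑ k, (d i * ⟪v i, e k⟫ ^ 2 * (Real.log (l k) + (t i / l k - 1))
          - (1 / (4 * M ^ 2)) * (d i * (⟪v i, e k⟫ ^ 2 * (t i - l k) ^ 2))) := by
          refine Finset.sum_congr rfl fun i _ => Finset.sum_congr rfl fun k _ => by ring
      _ = _ := by
          simp_rw [Finset.sum_sub_distrib]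
          rw [Finset.sum_comm]
          simp_rw [e1, ← Finset.mul_sum]
  have h5 : ∀ i, ∑ k, ⟪v i, e k⟫ ^ 2 * (t i - l k) ^ 2
      = ∑ j, d j * (⟪A (v i), v j⟫ - t i * ⟪v i, v j⟫) ^ 2 := fun i => by
    have e1 : ∑ k, ⟪v i, e k⟫ ^ 2 * (t i - l k) ^ 2 = ‖A (v i) - t i • v i‖ ^ 2 := by
      have := e.sum_sq_norm_inner_left (A (v i) - t i • v i)
      rw [← this]
      refine Finset.sum_congr rfl fun k _ => ?_
      rw [inner_sub_left, hs, hAe, inner_smul_right, inner_smul_left, Real.norm_eq_abs, sq_abs]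
      simp; ring
    rw [e1, ← frame_norm hF]
    refine Finset.sum_congr rfl fun j _ => ?_
    rw [inner_sub_right, inner_smul_right, real_inner_comm (A (v i)) (v j), real_inner_comm (v i) (v j)]
  have h6 : (1 / 4 : ℝ) * ∑ i, ∑ j, d i * d j * (⟪v i, v j⟫ ^ 2 * (t i - t j) ^ 2)
      ≤ ∑ i, d i * ∑ j, d j * (⟪A (v i), v j⟫ - t i * ⟪v i, v j⟫) ^ 2 := by
    set X := ∑ i, d i * ∑ j, d j * (⟪A (v i), v j⟫ - t i * ⟪v i, v j⟫) ^ 2 with hX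
    have e1 : X = ∑ i, ∑ j, d i * d j * (⟪A (v i), v j⟫ - t i * ⟪v i, v j⟫) ^ 2 := by
      rw [hX]
      refine Finset.sum_congr rfl fun i _ => ?_
      rw [Finset.mul_sum]
      refine Finset.sum_congr rfl fun j _ => by ring
    have e2 : X = ∑ i, ∑ j, d i * d j * (⟪A (v i), v j⟫ - t j * ⟪v i, v j⟫) ^ 2 := by
      rw [e1, Finset.sum_comm]
      refine Finset.sum_congr rfl fun i _ => Finset.sum_congr rfl fun j _ => ?_
      rw [hs, real_inner_comm, real_inner_comm (v i)]
      ring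
    have e3 : (1 / 2 : ℝ) * ∑ i, ∑ j, d i * d j * (⟪v i, v j⟫ ^ 2 * (t i - t j) ^ 2) ≤ X + X := by
      conv_rhs => lhs; rw [e1]
      conv_rhs => rhs; rw [e2]
      rw [← Finset.sum_add_distrib, Finset.mul_sum]
      refine Finset.sum_le_sum fun i _ => ?_
      rw [← Finset.sum_add_distrib, Finset.mul_sum]
      refine Finset.sum_le_sum fun j _ => ?_
      have := mul_nonneg (mul_nonneg (hd i) (hd j)) (sq_nonneg
        ((⟪A (v i), v j⟫ - t i * ⟪v i, v j⟫) + (⟪A (v i), v j⟫ - t j * ⟪v i, v j⟫)))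
      nlinarith
    linarith
  rw [h3, h4] at h2
  simp_rw [h5] at h2
  have h7 := mul_le_mul_of_nonneg_left h6 (show 0 ≤ 1 / (4 * M ^ 2) by positivity)
  have h8 : 1 / (16 * M ^ 2) * ∑ i, ∑ j, d i * d j * (⟪v i, v j⟫ ^ 2 * (t i - t j) ^ 2)
      = 1 / (4 * M ^ 2) * ((1 / 4 : ℝ) * ∑ i, ∑ j, d i * d j * (⟪v i, v j⟫ ^ 2 * (t i - t j) ^ 2)) := by
    ring
  rw [h8]
  linarith

end Frame
end Part2

section Part3

section Sel
variable {V : Type*} [NormedAddCommGroup V] [InnerProductSpace ℝ V]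
  {ι : Type*} [Fintype ι]

lemma sum_pi_pair (m : ℕ) (d : ι → ℝ) (hd : ∀ i, 0 ≤ d i) (hm : 1 ≤ m) (hsum : ∑ i, d i = m)
    (h : ι → ι → ℝ) (hh : ∀ i j, 0 ≤ h i j) (a b : Fin m) (hab : a ≠ b) :
    ∑ f : Fin m → ι, (∏ k, d (f k)) * h (f a) (f b) ≤
      (m : ℝ) ^ m * ∑ i, ∑ j, d i * d j * h i j := by
  classical
  let G : ι → ι → Fin m → ι → ℝ := fun i j k l =>
    d l * ((if k = a then (if l = i then 1 else 0) else 1) *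
      (if k = b then (if l = j then 1 else 0) else 1))
  have h1 : ∀ f : Fin m → ι, (∏ k, d (f k)) * h (f a) (f b)
      = ∑ i, ∑ j, h i j * ∏ k, G i j k (f k) := by
    intro f
    have e1 : ∀ i j, ∏ k, G i j k (f k) = (∏ k, d (f k)) *
        ((if f a = i then 1 else 0) * (if f b = j then 1 else 0)) := by
      intro i j
      simp only [G, Finset.prod_mul_distrib]
      congr 2
      · rw [Finset.prod_eq_single a]
        · simp
        · intro k _ hk; simp [hk]
        · simp
      · rw [Finset.prod_eq_single b]
        · simp
        · intro k _ hk; simp [hk]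
        · simp
    simp_rw [e1]
    rw [Finset.sum_eq_single (f a), Finset.sum_eq_single (f b)]
    · simp; ring
    · intro j _ hj; simp [hj.symm]
    · simp
    · intro i _ hi; simp [hi.symm]
    · simp
  simp_rw [h1]
  rw [Finset.sum_comm, Finset.mul_sum]
  refine Finset.sum_le_sum fun i _ => ?_
  rw [Finset.sum_comm, Finset.mul_sum]
  refine Finset.sum_le_sum fun j _ => ?_
  rw [← Finset.mul_sum, ← Fintype.piFinset_univ, ← Finset.prod_univ_sum]
  have hm1 : (1 : ℝ) ≤ m := by exact_mod_cast hm
  have h2 : ∏ k, ∑ l, G i j k l ≤ d i * (d j * (m:ℝ) ^ m) := by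
    have ha : ∑ l, G i j a l = d i := by
      simp [G, hab]
    have hb : ∑ l, G i j b l = d j := by
      simp [G, hab.symm]
    rw [← Finset.mul_prod_erase _ _ (Finset.mem_univ a), ha]
    refine mul_le_mul_of_nonneg_left ?_ (hd i)
    rw [← Finset.mul_prod_erase _ _ (Finset.mem_erase.2 ⟨hab.symm, Finset.mem_univ b⟩), hb]
    refine mul_le_mul_of_nonneg_left ?_ (hd j)
    have : ∀ k ∈ (Finset.univ.erase a).erase b, ∑ l, G i j k l = m := by
      intro k hk
      simp only [Finset.mem_erase, Finset.mem_univ, and_true] at hk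
      simp [G, hk.1, hk.2, hsum]
    rw [Finset.prod_congr rfl this, Finset.prod_const]
    refine pow_le_pow_right₀ hm1 ?_
    refine (Finset.card_le_univ _).trans (by simp)
  calc _ ≤ h i j * (d i * (d j * (m:ℝ) ^ m)) := mul_le_mul_of_nonneg_left h2 (hh i j)
    _ = _ := by ring

lemma select {m : ℕ} (hm : 1 ≤ m) [Fact (Module.finrank ℝ V = m)] [FiniteDimensional ℝ V]
    {d : ι → ℝ} {v : ι → V} (hd : ∀ i, 0 ≤ d i)
    (hF : ∀ x, ∑ i, (d i * ⟪v i, x⟫) • v i = x) (hv : ∀ i, ‖v i‖ = 1) :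
    ∃ f : Fin m → ι, ∑ a, ∑ b, (if a = b then 0 else ⟪v (f a), v (f b)⟫ ^ 2) ≤
      2 * (m : ℝ) ^ (2 * m + 2) * ∑ i, ∑ j, d i * d j * (⟪v i, v j⟫ ^ 2 * (1 - ⟪v i, v j⟫)) := by
  classical
  set η := ∑ i, ∑ j, d i * d j * (⟪v i, v j⟫ ^ 2 * (1 - ⟪v i, v j⟫)) with hη
  have hfr : Module.finrank ℝ V = m := Fact.out
  have hsum : ∑ i, d i = m := by rw [frame_card hF hv, hfr]
  let e : OrthonormalBasis (Fin m) ℝ V := (stdOrthonormalBasis ℝ V).reindex (finCongr hfr)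
  let o : Orientation ℝ V (Fin m) := e.toBasis.orientation
  let ω := o.volumeForm
  have hx1 : ∀ i j, |⟪v i, v j⟫| ≤ 1 := fun i j => by
    have := abs_real_inner_le_norm (v i) (v j); simpa [hv] using this
  have he : |ω e| = 1 := by
    have := o.abs_volumeForm_apply_of_orthonormal e
    simpa using this
  have hexp : ω e = ∑ f : Fin m → ι, (∏ k, (d (f k) * ⟪v (f k), e k⟫)) * ω (fun k => v (f k)) := by
    have : (e : Fin m → V) = fun k => ∑ i, (d i * ⟪v i, e k⟫) • v i := by
      funext k; rw [hF]
    conv_lhs => rw [this]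
    have := ω.toMultilinearMap.map_sum (fun k i => (d i * ⟪v i, e k⟫) • v i)
    refine this.trans ?_
    refine Finset.sum_congr rfl fun f _ => ?_
    have := ω.toMultilinearMap.map_smul_univ (fun k => d (f k) * ⟪v (f k), e k⟫) (fun k => v (f k))
    simpa using this
  set D : (Fin m → ι) → ℝ := fun f => ∏ k, d (f k) with hD
  set W : (Fin m → ι) → ℝ := fun f => ω (fun k => v (f k)) with hW
  have hD0 : ∀ f, 0 ≤ D f := fun f => Finset.prod_nonneg fun k _ => hd _
  have hDs : ∑ f, D f = (m:ℝ) ^ m := by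
    have := Finset.prod_univ_sum (fun _ : Fin m => (Finset.univ : Finset ι)) (fun _ i => d i)
    rw [Fintype.piFinset_univ] at this
    rw [hD, ← this]
    simp [hsum]
  have h1 : 1 ≤ ∑ f, D f * |W f| := by
    rw [← he, hexp]
    refine (Finset.abs_sum_le_sum_abs _ _).trans (Finset.sum_le_sum fun f _ => ?_)
    rw [abs_mul]
    refine mul_le_mul_of_nonneg_right ?_ (abs_nonneg _)
    rw [Finset.abs_prod]
    refine Finset.prod_le_prod (fun _ _ => abs_nonneg _) fun k _ => ?_
    rw [abs_mul, abs_of_nonneg (hd _)]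
    have := abs_real_inner_le_norm (v (f k)) (e k)
    simp only [hv, OrthonormalBasis.norm_eq_one, mul_one] at this
    exact mul_le_of_le_one_right (hd _) this
  have h2 : 1 ≤ (m:ℝ) ^ m * ∑ f, D f * W f ^ 2 := by
    have hcs := Finset.sum_mul_sq_le_sq_mul_sq Finset.univ (fun f => √(D f))
      (fun f => √(D f) * |W f|)
    have e1 : ∀ f, √(D f) * (√(D f) * |W f|) = D f * |W f| := fun f => by
      rw [← mul_assoc, Real.mul_self_sqrt (hD0 f)]
    have e2 : ∀ f, (√(D f) * |W f|) ^ 2 = D f * W f ^ 2 := fun f => by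
      rw [mul_pow, Real.sq_sqrt (hD0 f), sq_abs]
    have e3 : ∀ f, √(D f) ^ 2 = D f := fun f => Real.sq_sqrt (hD0 f)
    simp_rw [e1, e2, e3, hDs] at hcs
    exact le_trans (by nlinarith) hcs
  have hHad : ∀ f : Fin m → ι, ∀ a b, a ≠ b → W f ^ 2 ≤ 1 - ⟪v (f a), v (f b)⟫ ^ 2 := by
    intro f a b hab
    set x := ⟪v (f a), v (f b)⟫ with hx
    let g : Fin m → V := fun k => v (f k)
    have e1 : ω (Function.update g b (g b - x • g a)) = ω g := by
      rw [AlternatingMap.map_update_sub, AlternatingMap.map_update_smul,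
        AlternatingMap.map_update_self _ _ hab.symm, Function.update_eq_self]
      simp
    have e2 := o.abs_volumeForm_apply_le (Function.update g b (g b - x • g a))
    have e3 : ∏ k, ‖Function.update g b (g b - x • g a) k‖ = ‖g b - x • g a‖ := by
      rw [Finset.prod_eq_single b]
      · simp
      · intro k _ hk; simp [hk, g, hv]
      · simp
    have e4 : ‖g b - x • g a‖ ^ 2 = 1 - x ^ 2 := by
      rw [norm_sub_sq_real, inner_smul_right, real_inner_comm, norm_smul]
      simp only [g, hv, ← hx, Real.norm_eq_abs, mul_one, sq_abs]
      ring
    rw [e3] at e2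
    have e5 : |W f| ≤ ‖g b - x • g a‖ := by
      rw [hW]; simp only []; rw [← e1]; exact e2
    rw [← e4, ← sq_abs]
    gcongr
  have hη0 : ∀ i j, 0 ≤ ⟪v i, v j⟫ ^ 2 * (1 - ⟪v i, v j⟫) := fun i j =>
    mul_nonneg (sq_nonneg _) (by linarith [(abs_le.1 (hx1 i j)).2])
  have h3 : ∑ f, D f * W f ^ 2 * (∑ a, ∑ b, (if a = b then 0 else ⟪v (f a), v (f b)⟫ ^ 2))
      ≤ (m:ℝ) ^ m * m ^ 2 * (2 * η) := by
    have e0 : ∀ a b : Fin m, ∑ f, (D f * W f ^ 2 * (if a = b then 0 else ⟪v (f a), v (f b)⟫ ^ 2))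
        ≤ (m:ℝ) ^ m * (2 * η) := by
      intro a b
      by_cases hab : a = b
      · simp only [hab, if_true, mul_zero, Finset.sum_const_zero]
        have : 0 ≤ η := Finset.sum_nonneg fun i _ => Finset.sum_nonneg fun j _ =>
          mul_nonneg (mul_nonneg (hd i) (hd j)) (hη0 i j)
        positivity
      · simp only [hab, if_false]
        have := sum_pi_pair m d hd hm hsum (fun i j => ⟪v i, v j⟫ ^ 2 * (1 - ⟪v i, v j⟫)) hη0 a b hab
        rw [← hη] at this
        have e2 : ∑ f, D f * W f ^ 2 * ⟪v (f a), v (f b)⟫ ^ 2 ≤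
          2 * ∑ f, D f * (⟪v (f a), v (f b)⟫ ^ 2 * (1 - ⟪v (f a), v (f b)⟫)) := by
          rw [Finset.mul_sum]
          refine Finset.sum_le_sum fun f _ => ?_
          have q1 := hHad f a b hab
          have q2 := (abs_le.1 (hx1 (f a) (f b)))
          set x := ⟪v (f a), v (f b)⟫
          have q3 : W f ^ 2 * x ^ 2 ≤ 2 * (x ^ 2 * (1 - x)) := by
            have : W f ^ 2 ≤ 2 * (1 - x) := by nlinarith
            nlinarith [mul_le_mul_of_nonneg_right this (sq_nonneg x)]
          nlinarith [mul_le_mul_of_nonneg_left q3 (hD0 f)]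
        linarith
    calc _ = ∑ a, ∑ b, ∑ f, (D f * W f ^ 2 * (if a = b then 0 else ⟪v (f a), v (f b)⟫ ^ 2)) := by
          simp_rw [Finset.mul_sum]
          rw [Finset.sum_comm]
          refine Finset.sum_congr rfl fun a _ => ?_
          rw [Finset.sum_comm]
      _ ≤ ∑ a : Fin m, ∑ b : Fin m, (m:ℝ) ^ m * (2 * η) :=
          Finset.sum_le_sum fun a _ => Finset.sum_le_sum fun b _ => e0 a b
      _ = _ := by simp; ring
  by_contra hcon
  push Not at hcon
  set C := 2 * (m : ℝ) ^ (2 * m + 2) * η with hC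
  have hpos : ∃ f ∈ (Finset.univ : Finset (Fin m → ι)), 0 < D f * W f ^ 2 := by
    by_contra hh
    push Not at hh
    have := Finset.sum_nonpos hh
    have : (m:ℝ) ^ m * ∑ f, D f * W f ^ 2 ≤ 0 := mul_nonpos_of_nonneg_of_nonpos (by positivity) this
    linarith
  have h4 : ∑ f, D f * W f ^ 2 * C <
      ∑ f, D f * W f ^ 2 * (∑ a, ∑ b, (if a = b then 0 else ⟪v (f a), v (f b)⟫ ^ 2)) := by
    obtain ⟨f0, hf0, hp⟩ := hpos
    refine Finset.sum_lt_sum (fun f _ => ?_) ⟨f0, hf0, ?_⟩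
    · exact mul_le_mul_of_nonneg_left (hcon f).le (mul_nonneg (hD0 f) (sq_nonneg _))
    · exact mul_lt_mul_of_pos_left (hcon f0) hp
  rw [← Finset.sum_mul] at h4
  have hη00 : 0 ≤ η := Finset.sum_nonneg fun i _ => Finset.sum_nonneg fun j _ =>
          mul_nonneg (mul_nonneg (hd i) (hd j)) (hη0 i j)
  have h5 : (m:ℝ) ^ m * m ^ 2 * (2 * η) * 1 ≤ (m:ℝ) ^ m * m ^ 2 * (2 * η) * ((m:ℝ) ^ m * ∑ f, D f * W f ^ 2) :=
    mul_le_mul_of_nonneg_left h2 (by positivity)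
  have h6 : (m:ℝ) ^ m * m ^ 2 * (2 * η) * ((m:ℝ) ^ m * ∑ f, D f * W f ^ 2) = (∑ f, D f * W f ^ 2) * C := by
    rw [hC]; ring
  linarith

/-- Polar decomposition: a near isometry is close to an isometry. -/
lemma polar_near [FiniteDimensional ℝ V] (L : V →ₗ[ℝ] V) (δ : ℝ) (hδ1 : δ < 1)
    (hL : ∀ x, |‖L x‖ ^ 2 - ‖x‖ ^ 2| ≤ δ * ‖x‖ ^ 2) :
    ∃ T : V ≃ₗᵢ[ℝ] V, ∀ x, ‖L x - T x‖ ≤ δ * ‖x‖ := by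
  classical
  set A : V →ₗ[ℝ] V := L.adjoint ∘ₗ L with hA
  have hs : A.IsSymmetric := by
    intro x y
    simp [hA, LinearMap.adjoint_inner_left, LinearMap.adjoint_inner_right]
  set e := hs.eigenvectorBasis rfl with he
  set l := hs.eigenvalues rfl with hl
  have hAe : ∀ k, A (e k) = l k • e k := fun k => hs.apply_eigenvectorBasis rfl k
  have hin : ∀ i j, ⟪L (e i), L (e j)⟫ = if i = j then l i else 0 := by
    intro i j
    have : ⟪L (e i), L (e j)⟫ = ⟪A (e i), e j⟫ := by
      simp [hA, LinearMap.adjoint_inner_left]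
    rw [this, hAe, inner_smul_left, orthonormal_iff_ite.1 e.orthonormal i j]
    simp
  have hlk : ∀ k, |l k - 1| ≤ δ := fun k => by
    have := hL (e k)
    rw [← real_inner_self_eq_norm_sq (L (e k)), hin] at this
    simpa using this
  have hl0 : ∀ k, 0 < l k := fun k => by have := (abs_le.1 (hlk k)).1; linarith
  have hon : Orthonormal ℝ (fun k => (√(l k))⁻¹ • L (e k)) := by
    rw [orthonormal_iff_ite]
    intro i j
    rw [inner_smul_left, inner_smul_right, hin]
    split_ifs with h
    · subst h
      have := Real.mul_self_sqrt (hl0 i).le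
      have h2 : √(l i) ≠ 0 := (Real.sqrt_pos.2 (hl0 i)).ne'
      simp
      field_simp
      nlinarith
    · simp
  let b : OrthonormalBasis (Fin (Module.finrank ℝ V)) ℝ V :=
    OrthonormalBasis.mk hon (by
      have := hon.linearIndependent.span_eq_top_of_card_eq_finrank' (by simp)
      exact this.ge)
  have hb : ∀ k, b k = (√(l k))⁻¹ • L (e k) := fun k => by simp [b]
  refine ⟨e.equiv b (Equiv.refl _), fun x => ?_⟩
  have hTe : ∀ k, e.equiv b (Equiv.refl _) (e k) = (√(l k))⁻¹ • L (e k) := fun k => by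
    rw [OrthonormalBasis.equiv_apply_basis]; simp [hb]
  set T := e.equiv b (Equiv.refl _) with hT
  have hexp : L x - T x = ∑ k, (⟪e k, x⟫ * (√(l k) - 1)) • b k := by
    conv_lhs => rw [← e.sum_repr' x]
    rw [map_sum, map_sum, ← Finset.sum_sub_distrib]
    refine Finset.sum_congr rfl fun k _ => ?_
    rw [map_smul, map_smul, hTe, hb]
    rw [← smul_sub, mul_smul]
    congr 1
    have h2 : √(l k) ≠ 0 := (Real.sqrt_pos.2 (hl0 k)).ne'
    rw [smul_smul, sub_mul, mul_inv_cancel₀ h2, one_mul, sub_smul, one_smul]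
  have hδ0 : 0 ≤ δ ∨ IsEmpty (Fin (Module.finrank ℝ V)) := by
    by_cases h : IsEmpty (Fin (Module.finrank ℝ V))
    · right; exact h
    · left
      rw [not_isEmpty_iff] at h
      exact (abs_nonneg _).trans (hlk h.some)
  have hsq : ‖L x - T x‖ ^ 2 ≤ δ ^ 2 * ‖x‖ ^ 2 := by
    rw [← b.sum_sq_norm_inner_right, ← e.sum_sq_norm_inner_right x, Finset.mul_sum]
    refine Finset.sum_le_sum fun k _ => ?_
    have : ⟪b k, L x - T x⟫ = ⟪e k, x⟫ * (√(l k) - 1) := by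
      rw [hexp]
      exact b.orthonormal.inner_right_fintype (fun k => ⟪e k, x⟫ * (√(l k) - 1)) k
    rw [this, Real.norm_eq_abs, Real.norm_eq_abs, sq_abs, sq_abs, mul_pow]
    have h3 : (√(l k) - 1) ^ 2 ≤ (l k - 1) ^ 2 := by
      have e1 := Real.sq_sqrt (hl0 k).le
      have e2 := Real.sqrt_nonneg (l k)
      have : (l k - 1) ^ 2 = (√(l k) - 1) ^ 2 * (√(l k) + 1) ^ 2 := by
        rw [← mul_pow]; congr 1; linear_combination -e1
      rw [this]
      exact le_mul_of_one_le_right (sq_nonneg _) (by nlinarith)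
    have h4 : (l k - 1) ^ 2 ≤ δ ^ 2 := by
      rw [← sq_abs]; exact pow_le_pow_left₀ (abs_nonneg _) (hlk k) 2
    nlinarith [mul_le_mul_of_nonneg_left (h3.trans h4) (sq_nonneg ⟪e k, x⟫)]
  rcases hδ0 with h | h
  · rw [← mul_pow] at hsq
    exact abs_le_of_sq_le_sq' hsq (by positivity) |>.2
  · have hx : x = 0 := by
      have : Module.finrank ℝ V = 0 := by
        rcases Nat.eq_zero_or_pos (Module.finrank ℝ V) with h' | h'
        · exact h'
        · exact (h.false ⟨0, h'⟩).elim
      have := Module.finrank_zero_iff.1 this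
      exact Subsingleton.elim _ _
    simp [hx]
end Sel
end Part3

section Part4

/-- standard Gaussian density on the line -/
def gp (t : ℝ) : ℝ := (√(2 * Real.pi))⁻¹ * Real.exp (-t ^ 2 / 2)

/-- standard Gaussian distribution function -/
def Ph (x : ℝ) : ℝ := ∫ t in Iic x, gp t

lemma gp_eq : gp = ProbabilityTheory.gaussianPDFReal 0 1 := by
  ext t; simp [gp, ProbabilityTheory.gaussianPDFReal]

lemma gp_pos (t : ℝ) : 0 < gp t := by unfold gp; positivity

lemma gp_cont : Continuous gp := by unfold gp; fun_prop

lemma gp_int : Integrable gp := by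
  rw [gp_eq]; exact ProbabilityTheory.integrable_gaussianPDFReal 0 1

lemma gp_integral : ∫ t, gp t = 1 := by
  rw [gp_eq]; exact ProbabilityTheory.integral_gaussianPDFReal_eq_one 0 one_ne_zero

lemma Ph_eq (x : ℝ) : Ph x = ProbabilityTheory.cdf (ProbabilityTheory.gaussianReal 0 1) x := by
  rw [ProbabilityTheory.cdf_eq_real, Measure.real,
    ProbabilityTheory.gaussianReal_apply_eq_integral 0 one_ne_zero, ENNReal.toReal_ofReal, ← gp_eq]
  · rfl
  · rw [← gp_eq]; exact integral_nonneg fun t => (gp_pos t).le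

lemma Ph_sub (x y : ℝ) : Ph y - Ph x = ∫ t in x..y, gp t :=
  intervalIntegral.integral_Iic_sub_Iic gp_int.integrableOn gp_int.integrableOn

lemma Ph_deriv (x : ℝ) : HasDerivAt Ph (gp x) x := by
  have h : Ph = fun u => (∫ t in (0:ℝ)..u, gp t) + Ph 0 := by
    ext u; rw [← Ph_sub]; ring
  rw [h]
  exact ((gp_cont.integral_hasStrictDerivAt 0 x).hasDerivAt).add_const _

lemma Ph_diff : Differentiable ℝ Ph := fun x => (Ph_deriv x).differentiableAt

lemma Ph_cont : Continuous Ph := Ph_diff.continuous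

lemma Ph_mono : StrictMono Ph := by
  refine strictMono_of_deriv_pos fun x => ?_
  rw [(Ph_deriv x).deriv]; exact gp_pos x

lemma Ph_bot : Filter.Tendsto Ph Filter.atBot (nhds 0) := by
  rw [funext Ph_eq]; exact ProbabilityTheory.tendsto_cdf_atBot _

lemma Ph_top : Filter.Tendsto Ph Filter.atTop (nhds 1) := by
  rw [funext Ph_eq]; exact ProbabilityTheory.tendsto_cdf_atTop _

lemma Ph_pos (x : ℝ) : 0 < Ph x := by
  have h : 0 ≤ Ph (x - 1) := by rw [Ph_eq]; exact ProbabilityTheory.cdf_nonneg _ _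
  exact h.trans_lt (Ph_mono (by linarith))

lemma Ph_lt_one (x : ℝ) : Ph x < 1 := by
  have h : Ph (x + 1) ≤ 1 := by rw [Ph_eq]; exact ProbabilityTheory.cdf_le_one _ _
  exact (Ph_mono (by linarith)).trans_le h

lemma Ph_surj {y : ℝ} (h0 : 0 < y) (h1 : y < 1) : ∃ x, Ph x = y := by
  obtain ⟨a, ha⟩ := (Ph_bot.eventually (gt_mem_nhds h0)).exists
  obtain ⟨b, hb⟩ := (Ph_top.eventually (lt_mem_nhds h1)).exists
  have hab : a ≤ b := (Ph_mono.lt_iff_lt.1 (ha.trans hb)).le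
  obtain ⟨x, -, hx⟩ := intermediate_value_Icc hab Ph_cont.continuousOn ⟨ha.le, hb.le⟩
  exact ⟨x, hx⟩

/-- inverse of the distribution function -/
def PhInv (y : ℝ) : ℝ := Function.invFun Ph y

lemma PhInv_Ph (x : ℝ) : PhInv (Ph x) = x := Function.leftInverse_invFun Ph_mono.injective x

lemma Ph_PhInv {y : ℝ} (h0 : 0 < y) (h1 : y < 1) : Ph (PhInv y) = y :=
  Function.invFun_eq (Ph_surj h0 h1)

lemma PhInv_deriv {y : ℝ} (h0 : 0 < y) (h1 : y < 1) :
    HasDerivAt PhInv (gp (PhInv y))⁻¹ y := by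
  have hnh : Ioo (0:ℝ) 1 ∈ nhds y := Ioo_mem_nhds h0 h1
  refine HasDerivAt.of_local_left_inverse ?_ (Ph_deriv _) (gp_pos _).ne' ?_
  · refine StrictMonoOn.continuousAt_of_image_mem_nhds (s := Ioo 0 1) ?_ hnh ?_
    · intro a ha b hb hab
      rw [← Ph_mono.lt_iff_lt, Ph_PhInv ha.1 ha.2, Ph_PhInv hb.1 hb.2]; exact hab
    · have : PhInv '' Ioo 0 1 = univ := by
        ext x; simp only [mem_image, mem_univ, iff_true]
        exact ⟨Ph x, ⟨Ph_pos x, Ph_lt_one x⟩, PhInv_Ph x⟩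
      rw [this]; exact Filter.univ_mem
  · filter_upwards [hnh] with z hz using Ph_PhInv hz.1 hz.2

/-- transport function -/
def pf (b s : ℝ) : ℝ := PhInv (Ph b * Ph s)
/-- its derivative -/
def qf (b s : ℝ) : ℝ := Ph b * Real.exp ((pf b s ^ 2 - s ^ 2) / 2)

lemma Ph_pf (b s : ℝ) : Ph (pf b s) = Ph b * Ph s :=
  Ph_PhInv (mul_pos (Ph_pos b) (Ph_pos s))
    (mul_lt_one_of_nonneg_of_lt_one_left (Ph_pos b).le (Ph_lt_one b) (Ph_lt_one s).le)

lemma pf_lt (b s : ℝ) : pf b s < b := by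
  rw [← Ph_mono.lt_iff_lt, Ph_pf]
  exact mul_lt_of_lt_one_right (Ph_pos b) (Ph_lt_one s)

lemma qf_pos (b s : ℝ) : 0 < qf b s := mul_pos (Ph_pos b) (Real.exp_pos _)

lemma qf_log (b s : ℝ) : Real.log (qf b s) = Real.log (Ph b) + (pf b s ^ 2 - s ^ 2) / 2 := by
  rw [qf, Real.log_mul (Ph_pos b).ne' (Real.exp_pos _).ne', Real.log_exp]

lemma pf_deriv (b s : ℝ) : HasDerivAt (pf b) (qf b s) s := by
  have h1 := PhInv_deriv (mul_pos (Ph_pos b) (Ph_pos s))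
    (mul_lt_one_of_nonneg_of_lt_one_left (Ph_pos b).le (Ph_lt_one b) (Ph_lt_one s).le)
  have h2 : HasDerivAt (fun s => Ph b * Ph s) (Ph b * gp s) s := (Ph_deriv s).const_mul _
  have h3 := h1.comp s h2
  have h4 : (gp (PhInv (Ph b * Ph s)))⁻¹ * (Ph b * gp s) = qf b s := by
    change (gp (pf b s))⁻¹ * (Ph b * gp s) = _
    have e : (pf b s ^ 2 - s ^ 2) / 2 = - s ^ 2 / 2 - (- pf b s ^ 2 / 2) := by ring
    unfold qf gp
    rw [e, Real.exp_sub]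
    have : √(2 * Real.pi) ≠ 0 := by positivity
    field_simp
  rw [h4] at h3
  exact h3

lemma pf_cont (b : ℝ) : Continuous (pf b) :=
  continuous_iff_continuousAt.2 fun s => (pf_deriv b s).continuousAt

lemma qf_cont (b : ℝ) : Continuous (qf b) := by
  unfold qf
  have := pf_cont b
  fun_prop

lemma pf_mono (b : ℝ) : StrictMono (pf b) := by
  refine strictMono_of_deriv_pos fun x => ?_
  rw [(pf_deriv b x).deriv]; exact qf_pos b x

lemma qf_deriv (b s : ℝ) : HasDerivAt (qf b) (qf b s * (pf b s * qf b s - s)) s := by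
  have h := pf_deriv b s
  have h1 : HasDerivAt (fun s => (pf b s ^ 2 - s ^ 2) / 2) (pf b s * qf b s - s) s := by
    have := ((h.pow 2).sub ((hasDerivAt_id s).pow 2)).div_const 2
    exact this.congr_deriv (by simp; ring)
  have := (h1.exp).const_mul (Ph b)
  exact this.congr_deriv (by unfold qf; ring)

lemma gp_anti {x y : ℝ} (hx : x ≤ y) (hy : y ≤ 0) : gp x ≤ gp y := by
  unfold gp; gcongr 2; nlinarith

lemma gp_le (x : ℝ) : gp x ≤ 0.4 := by
  have h1 : gp x ≤ (√(2 * Real.pi))⁻¹ := by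
    unfold gp
    refine mul_le_of_le_one_right (by positivity) ?_
    rw [Real.exp_le_one_iff]; nlinarith [sq_nonneg x]
  refine h1.trans ?_
  rw [inv_le_comm₀ (by positivity) (by norm_num)]
  refine Real.le_sqrt_of_sq_le ?_
  have := Real.pi_gt_d2
  norm_num; linarith

lemma gp_le' (x : ℝ) : gp x ≤ 0.39902 := by
  have h1 : gp x ≤ (√(2 * Real.pi))⁻¹ := by
    unfold gp
    refine mul_le_of_le_one_right (by positivity) ?_
    rw [Real.exp_le_one_iff]; nlinarith [sq_nonneg x]
  refine h1.trans ?_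
  rw [inv_le_comm₀ (by positivity) (by norm_num)]
  refine Real.le_sqrt_of_sq_le ?_
  have := Real.pi_gt_d4
  norm_num; linarith

lemma Ph_zero : Ph 0 = 1 / 2 := by
  have h1 : ∫ t in Iic (0:ℝ), gp t = ∫ t in Ioi (0:ℝ), gp t := by
    have := integral_comp_neg_Iic (0:ℝ) gp
    simp only [neg_zero] at this
    rw [← this]
    congr 1; ext t; simp [gp]
  have h2 : (∫ t in Iic (0:ℝ), gp t) + ∫ t in Ioi (0:ℝ), gp t = 1 := by
    rw [← gp_integral]
    exact intervalIntegral.integral_Iic_add_Ioi gp_int.integrableOn gp_int.integrableOn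
  unfold Ph; linarith

lemma Ph_sub_le {x y : ℝ} (h : x ≤ y) : Ph y - Ph x ≤ 0.39902 * (y - x) := by
  refine convex_univ.image_sub_le_mul_sub_of_deriv_le Ph_cont.continuousOn
    Ph_diff.differentiableOn (fun z _ => ?_) x (mem_univ _) y (mem_univ _) h
  rw [(Ph_deriv z).deriv]; exact gp_le' z

lemma Ph_le_sub {x y : ℝ} (h : x ≤ y) (hy : y ≤ 0) : gp x * (y - x) ≤ Ph y - Ph x := by
  refine (convex_Icc x y).mul_sub_le_image_sub_of_le_deriv Ph_cont.continuousOn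
    Ph_diff.differentiableOn (fun z hz => ?_) x ⟨le_rfl, h⟩ y ⟨h, le_rfl⟩ h
  rw [(Ph_deriv z).deriv]
  have := interior_subset hz
  exact gp_anti this.1 (this.2.trans hy)

lemma gp_ge (k : ℕ) (x : ℝ) (hx : x ^ 2 / 2 = k / 16) : 0.398 * 0.9375 ^ k ≤ gp x := by
  unfold gp
  have h1 : (0.398 : ℝ) ≤ (√(2 * Real.pi))⁻¹ := by
    rw [le_inv_comm₀ (by norm_num) (by positivity)]
    refine Real.sqrt_le_iff.2 ⟨by norm_num, ?_⟩
    have := Real.pi_lt_d4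
    norm_num; linarith
  have h2 : (0.9375 : ℝ) ^ k ≤ Real.exp (-x ^ 2 / 2) := by
    have e : -x ^ 2 / 2 = k * (-1 / 16) := by linarith
    rw [e, Real.exp_nat_mul]
    have := Real.add_one_le_exp (-1 / 16 : ℝ)
    gcongr
    refine le_trans (by norm_num) this
  gcongr

lemma Ph_neg_two : Ph (-2) ≤ 0.12 := by
  have a1 := Ph_le_sub (x := -1/2) (y := 0) (by norm_num) (by norm_num)
  have a2 := Ph_le_sub (x := -1) (y := -1/2) (by norm_num) (by norm_num)
  have a3 := Ph_le_sub (x := -3/2) (y := -1) (by norm_num) (by norm_num)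
  have a4 := Ph_le_sub (x := -2) (y := -3/2) (by norm_num) (by norm_num)
  have b1 := gp_ge 2 (-1/2) (by norm_num)
  have b2 := gp_ge 8 (-1) (by norm_num)
  have b3 := gp_ge 18 (-3/2) (by norm_num)
  have b4 := gp_ge 32 (-2) (by norm_num)
  rw [Ph_zero] at a1
  norm_num at *
  linarith


lemma loc_bounds {b s : ℝ} (hb : -1/2 ≤ b) (hb0 : b ≤ 0) (hs : |s| ≤ 1/20) :
    0.3 ≤ Ph b ∧ Ph b ≤ 0.5 ∧ 0.48 ≤ Ph s ∧ Ph s ≤ 0.52 := by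
  have h0 := Ph_zero
  refine ⟨?_, ?_, ?_, ?_⟩
  · have := Ph_sub_le hb0; norm_num at *; linarith
  · rw [show (0.5:ℝ) = Ph 0 by rw [h0]; norm_num]; exact Ph_mono.monotone hb0
  · have := Ph_sub_le (x := -1/20) (y := 0) (by norm_num)
    have h2 : Ph (-1/20) ≤ Ph s := Ph_mono.monotone (by linarith [(abs_le.1 hs).1])
    norm_num at *; linarith
  · have := Ph_sub_le (x := 0) (y := 1/20) (by norm_num)
    have h2 : Ph s ≤ Ph (1/20) := Ph_mono.monotone (by linarith [(abs_le.1 hs).2])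
    norm_num at *; linarith

lemma pf_loc {b s : ℝ} (hb : -1/2 ≤ b) (hb0 : b ≤ 0) (hs : |s| ≤ 1/20) :
    -2 ≤ pf b s ∧ pf b s ≤ -1/2 := by
  obtain ⟨h1, h2, h3, h4⟩ := loc_bounds hb hb0 hs
  constructor
  · rw [← Ph_mono.le_iff_le, Ph_pf]
    refine Ph_neg_two.trans ?_
    nlinarith
  · rw [← Ph_mono.le_iff_le, Ph_pf]
    have := Ph_sub_le (x := -1/2) (y := 0) (by norm_num)
    rw [Ph_zero] at this
    have h5 : Ph b * Ph s ≤ 0.5 * 0.52 := by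
      have := Ph_pos s
      gcongr
    norm_num at *; linarith

lemma qf_loc {b s : ℝ} (hb : -1/2 ≤ b) (hb0 : b ≤ 0) (hs : |s| ≤ 1/20) :
    0.29 ≤ qf b s ∧ qf b s ≤ 4 := by
  obtain ⟨h1, h2, h3, h4⟩ := loc_bounds hb hb0 hs
  obtain ⟨h5, h6⟩ := pf_loc hb hb0 hs
  have hs2 : s ^ 2 ≤ (1/20) ^ 2 := by rw [← sq_abs]; gcongr
  unfold qf
  constructor
  · have : (1 : ℝ) ≤ Real.exp ((pf b s ^ 2 - s ^ 2) / 2) := by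
      rw [Real.one_le_exp_iff]; nlinarith
    nlinarith
  · have e1 : Real.exp ((pf b s ^ 2 - s ^ 2) / 2) ≤ Real.exp 2 := by
      rw [Real.exp_le_exp]; nlinarith [sq_nonneg s]
    have e2 : Real.exp 2 ≤ 8 := by
      have : Real.exp 2 = Real.exp 1 ^ 2 := by rw [← Real.exp_nat_mul]; norm_num
      rw [this]
      have := Real.exp_one_lt_d9
      have h := Real.exp_pos 1
      nlinarith
    have := e1.trans e2
    have := Real.exp_pos ((pf b s ^ 2 - s ^ 2) / 2)
    nlinarith

lemma qf_deriv_loc {b s : ℝ} (hb : -1/2 ≤ b) (hb0 : b ≤ 0) (hs : |s| ≤ 1/20) :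
    qf b s * (pf b s * qf b s - s) ≤ -1/50 := by
  obtain ⟨h1, h2⟩ := qf_loc hb hb0 hs
  obtain ⟨h5, h6⟩ := pf_loc hb hb0 hs
  have hs1 := (abs_le.1 hs).1
  have h7 : pf b s * qf b s ≤ -0.145 := by nlinarith
  have h8 : pf b s * qf b s - s ≤ -0.095 := by linarith
  nlinarith

lemma qf_gap {b s1 s2 : ℝ} (hb : -1/2 ≤ b) (hb0 : b ≤ 0) (h1 : |s1| ≤ 1/20) (h2 : |s2| ≤ 1/20) :
    (s1 - s2) ^ 2 / 2500 ≤ (qf b s1 - qf b s2) ^ 2 := by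
  have key : ∀ x y : ℝ, |x| ≤ 1/20 → |y| ≤ 1/20 → x ≤ y → qf b y - qf b x ≤ (-1/50) * (y - x) := by
    intro x y hx hy hxy
    refine (convex_Icc x y).image_sub_le_mul_sub_of_deriv_le (qf_cont b).continuousOn
      (fun z _ => (qf_deriv b z).differentiableAt.differentiableWithinAt) (fun z hz => ?_) x
      ⟨le_rfl, hxy⟩ y ⟨hxy, le_rfl⟩ hxy
    rw [(qf_deriv b z).deriv]
    have := interior_subset hz
    refine qf_deriv_loc hb hb0 (abs_le.2 ⟨?_, ?_⟩)
    · exact (abs_le.1 hx).1.trans this.1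
    · exact this.2.trans (abs_le.1 hy).2
  rcases le_total s1 s2 with h | h
  · have := key _ _ h1 h2 h; nlinarith
  · have := key _ _ h2 h1 h; nlinarith
end Part4

section Part5

section Gauss
variable {V : Type*} [NormedAddCommGroup V] [InnerProductSpace ℝ V] [FiniteDimensional ℝ V]
  [MeasurableSpace V] [BorelSpace V]

/-- Gaussian density on `V`. -/
def gd (y : V) : ℝ := ((√(2 * Real.pi))⁻¹) ^ (Module.finrank ℝ V) * Real.exp (-‖y‖ ^ 2 / 2)

lemma gd_pos (y : V) : 0 < gd y := by unfold gd; positivity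

lemma gd_cont : Continuous (gd : V → ℝ) := by unfold gd; fun_prop

lemma gd_int : Integrable (gd : V → ℝ) := by
  unfold gd
  have := (GaussianFourier.integrable_cexp_neg_mul_sq_norm_add (V := V) (b := 1/2) (by norm_num) 0 0).norm
  refine Integrable.const_mul ?_ _
  refine this.congr (Filter.Eventually.of_forall fun y => ?_)
  simp only [Complex.norm_exp]
  congr 1
  simp
  rw [← Complex.ofReal_pow, Complex.ofReal_re]
  ring

lemma gd_integral : ∫ y : V, gd y = 1 := by
  unfold gd
  rw [integral_const_mul]
  have := GaussianFourier.integral_rexp_neg_mul_sq_norm (V := V) (b := 1/2) (by norm_num)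
  have e : ∀ y : V, Real.exp (-‖y‖ ^ 2 / 2) = Real.exp (-(1/2) * ‖y‖ ^ 2) := fun y => by
    congr 1; ring
  simp_rw [e]
  rw [this, show Real.pi / (1/2) = 2 * Real.pi by ring, Real.sqrt_eq_rpow, inv_pow,
    ← Real.rpow_natCast, ← Real.rpow_mul (by positivity)]
  rw [show (1 / 2 * (Module.finrank ℝ V : ℝ)) = (Module.finrank ℝ V : ℝ) / 2 by ring]
  exact inv_mul_cancel₀ (by positivity)

/-- The standard Gaussian measure on `V`. -/
def gam (V : Type*) [NormedAddCommGroup V] [InnerProductSpace ℝ V] [FiniteDimensional ℝ V]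
    [MeasurableSpace V] [BorelSpace V] : Measure V :=
  volume.withDensity fun y => ENNReal.ofReal (gd y)

instance gam_prob : IsProbabilityMeasure (gam V) := by
  constructor
  rw [gam, withDensity_apply _ MeasurableSet.univ, Measure.restrict_univ,
    ← ofReal_integral_eq_lintegral_ofReal gd_int
      (Filter.Eventually.of_forall fun y => (gd_pos y).le), gd_integral, ENNReal.ofReal_one]

lemma gam_integral (f : V → ℝ) : ∫ y, f y ∂(gam V) = ∫ y, gd y * f y := by
  have := integral_withDensity_eq_integral_toReal_smul (μ := (volume : Measure V))
    (f := fun y => ENNReal.ofReal (gd y)) (by have := (gd_cont (V := V)).measurable; fun_prop)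
    (Filter.Eventually.of_forall fun y => ENNReal.ofReal_lt_top) f
  rw [gam, this]
  refine integral_congr_ae (Filter.Eventually.of_forall fun y => ?_)
  simp [ENNReal.toReal_ofReal (gd_pos y).le]

lemma gam_lintegral (f : V → ℝ≥0∞) : ∫⁻ y, f y ∂(gam V) = ∫⁻ y, ENNReal.ofReal (gd y) * f y := by
  rw [gam, lintegral_withDensity_eq_lintegral_mul_non_measurable]
  · rfl
  · have := (gd_cont (V := V)).measurable; fun_prop
  · exact Filter.Eventually.of_forall fun y => ENNReal.ofReal_lt_top

lemma gaussianM_eq (n : ℕ) : gaussianM n = gam (EuclideanSpace ℝ (Fin n)) := by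
  unfold gaussianM gam gd
  congr 1
  ext x
  congr 2
  rw [finrank_euclideanSpace_fin, Real.sqrt_eq_rpow, inv_pow, ← Real.rpow_natCast, ← Real.rpow_mul (by positivity),
    ← Real.rpow_neg (by positivity)]
  congr 1; ring

variable {ι : Type*} [Fintype ι]

/-- transport map -/
def tmap (d : ι → ℝ) (v : ι → V) (b : ℝ) (y : V) : V := ∑ i, (d i * pf b ⟪v i, y⟫) • v i

lemma tmap_deriv (d : ι → ℝ) (v : ι → V) (b : ℝ) (y : V) :
    HasFDerivAt (tmap d v b) (LinearMap.toContinuousLinearMap (frOp d v fun i => qf b ⟪v i, y⟫)) y := by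
  have h1 : ∀ i, HasFDerivAt (fun y => (d i * pf b ⟪v i, y⟫) • v i)
      ((d i • (qf b ⟪v i, y⟫) • (innerSL ℝ (v i))).smulRight (v i)) y := fun i => by
    have h2 : HasFDerivAt (fun y => ⟪v i, y⟫) (innerSL ℝ (v i)) y := (innerSL ℝ (v i)).hasFDerivAt
    have h3 := (pf_deriv b ⟪v i, y⟫).comp_hasFDerivAt y h2
    exact (h3.const_mul (d i)).smul_const (v i)
  have h4 := HasFDerivAt.fun_sum (u := Finset.univ) fun i _ => h1 i
  refine h4.congr_fderiv ?_
  ext x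
  rw [LinearMap.coe_toContinuousLinearMap', frOp_apply]
  simp [mul_assoc]

lemma tmap_inj {d : ι → ℝ} {v : ι → V} (hd : ∀ i, 0 ≤ d i)
    (hF : ∀ x, ∑ i, (d i * ⟪v i, x⟫) • v i = x) (b : ℝ) : Function.Injective (tmap d v b) := by
  intro y z hyz
  have h1 : ∑ i, d i * ((pf b ⟪v i, y⟫ - pf b ⟪v i, z⟫) * ⟪v i, y - z⟫) = 0 := by
    have : ⟪tmap d v b y - tmap d v b z, y - z⟫ = 0 := by rw [hyz]; simp
    rw [← this, tmap, tmap, ← Finset.sum_sub_distrib, sum_inner]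
    refine Finset.sum_congr rfl fun i _ => ?_
    rw [← sub_smul, inner_smul_left]; simp; ring
  have h0 : ∀ i, 0 ≤ (pf b ⟪v i, y⟫ - pf b ⟪v i, z⟫) * ⟪v i, y - z⟫ := fun i => by
    rw [inner_sub_right]
    rcases le_total ⟪v i, y⟫ ⟪v i, z⟫ with h | h
    · exact mul_nonneg_of_nonpos_of_nonpos (sub_nonpos.2 ((pf_mono b).monotone h)) (sub_nonpos.2 h)
    · exact mul_nonneg (sub_nonneg.2 ((pf_mono b).monotone h)) (sub_nonneg.2 h)
  rw [Finset.sum_eq_zero_iff_of_nonneg (fun i _ => mul_nonneg (hd i) (h0 i))] at h1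
  have h2 : ∀ i, d i * ⟪v i, y - z⟫ = 0 := fun i => by
    rcases mul_eq_zero.1 (h1 i (Finset.mem_univ i)) with h | h
    · simp [h]
    rcases mul_eq_zero.1 h with h | h
    · have := (pf_mono b).injective (sub_eq_zero.1 h)
      rw [inner_sub_right, this]; simp
    · simp [h]
  have := hF (y - z)
  simp only [h2, zero_smul, Finset.sum_const_zero] at this
  exact sub_eq_zero.1 this.symm

/-- The gain function. -/
def Sgain (d : ι → ℝ) (v : ι → V) (y : V) : ℝ :=
  ∑ i, ∑ j, d i * d j * (⟪v i, v j⟫ ^ 2 * (⟪v i, y⟫ - ⟪v j, y⟫) ^ 2)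

lemma transport_point {d : ι → ℝ} {v : ι → V} (hd : ∀ i, 0 ≤ d i)
    (hF : ∀ x, ∑ i, (d i * ⟪v i, x⟫) • v i = x) (hv : ∀ i, ‖v i‖ = 1) (b : ℝ) (y : V) (R : ℝ)
    (hR : ∃ M, (∀ i, qf b ⟪v i, y⟫ ≤ M) ∧ R ≤ (1 / (16 * M ^ 2)) *
      ∑ i, ∑ j, d i * d j * (⟪v i, v j⟫ ^ 2 * (qf b ⟪v i, y⟫ - qf b ⟪v j, y⟫) ^ 2)) :
    Ph b ^ (Module.finrank ℝ V) * (1 + R) * gd y ≤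
      |LinearMap.det (frOp d v fun i => qf b ⟪v i, y⟫)| * gd (tmap d v b y) := by
  obtain ⟨M, hM, hR⟩ := hR
  set m := Module.finrank ℝ V with hm
  obtain ⟨h1, h2⟩ := frOp_det hd hF hv (fun i => qf b ⟪v i, y⟫) (fun i => qf_pos b _) M hM
  set D := LinearMap.det (frOp d v fun i => qf b ⟪v i, y⟫) with hD
  rw [abs_of_pos h1]
  have h3 : ‖tmap d v b y‖ ^ 2 ≤ ∑ i, d i * pf b ⟪v i, y⟫ ^ 2 := frame_le hd hF _
  have h4 : ∑ i, d i * Real.log (qf b ⟪v i, y⟫) = m * Real.log (Ph b)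
      + (∑ i, d i * pf b ⟪v i, y⟫ ^ 2 - ‖y‖ ^ 2) / 2 := by
    rw [← frame_norm hF y, hm, ← frame_card hF hv, Finset.sum_mul, ← Finset.sum_sub_distrib,
      Finset.sum_div, ← Finset.sum_add_distrib]
    refine Finset.sum_congr rfl fun i _ => ?_
    rw [qf_log]; ring
  have h5 : m * Real.log (Ph b) + R + -‖y‖ ^ 2 / 2 ≤ Real.log D + -‖tmap d v b y‖ ^ 2 / 2 := by
    linarith
  have h6 := Real.exp_le_exp.2 h5
  rw [Real.exp_add, Real.exp_add, Real.exp_add, Real.exp_log h1, Real.exp_nat_mul,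
    Real.exp_log (Ph_pos b)] at h6
  have h7 : Ph b ^ m * (1 + R) * Real.exp (-‖y‖ ^ 2 / 2) ≤ D * Real.exp (-‖tmap d v b y‖ ^ 2 / 2) := by
    refine le_trans ?_ h6
    have := Real.add_one_le_exp R
    have h8 := pow_pos (Ph_pos b) m
    gcongr; linarith
  unfold gd
  have h9 : 0 ≤ ((√(2 * Real.pi))⁻¹) ^ m := by positivity
  have := mul_le_mul_of_nonneg_left h7 h9
  linarith

lemma transport {d : ι → ℝ} {v : ι → V} (hd : ∀ i, 0 ≤ d i)
    (hF : ∀ x, ∑ i, (d i * ⟪v i, x⟫) • v i = x) (hv : ∀ i, ‖v i‖ = 1) (b : ℝ) (R : V → ℝ)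
    (hR : ∀ y, ∃ M, (∀ i, qf b ⟪v i, y⟫ ≤ M) ∧ R y ≤ (1 / (16 * M ^ 2)) *
      ∑ i, ∑ j, d i * d j * (⟪v i, v j⟫ ^ 2 * (qf b ⟪v i, y⟫ - qf b ⟪v j, y⟫) ^ 2))
    (hR0 : ∀ y, 0 ≤ R y) (hRi : Integrable R (gam V)) (A : Set V)
    (hA : ∀ y, tmap d v b y ∈ A) :
    Ph b ^ (Module.finrank ℝ V) * (1 + ∫ y, R y ∂(gam V)) ≤ (gam V).real A := by
  have h1 := lintegral_image_eq_lintegral_abs_det_fderiv_mul (volume : Measure V) MeasurableSet.univ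
    (fun y _ => (tmap_deriv d v b y).hasFDerivWithinAt) (tmap_inj hd hF b).injOn
    (fun z => ENNReal.ofReal (gd z))
  have h2 : ∫⁻ y, ENNReal.ofReal (Ph b ^ (Module.finrank ℝ V) * (1 + R y)) ∂(gam V) ≤ gam V A := by
    calc _ = ∫⁻ y in univ, ENNReal.ofReal (gd y) * ENNReal.ofReal (Ph b ^ (Module.finrank ℝ V) * (1 + R y)) := by
          rw [gam_lintegral, Measure.restrict_univ]
      _ ≤ ∫⁻ z in tmap d v b '' univ, ENNReal.ofReal (gd z) := by
          rw [h1]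
          refine lintegral_mono fun y => ?_
          rw [← ENNReal.ofReal_mul (gd_pos y).le, ← ENNReal.ofReal_mul (abs_nonneg _)]
          refine ENNReal.ofReal_le_ofReal ?_
          have := transport_point hd hF hv b y (R y) (hR y)
          simp only [ContinuousLinearMap.det, LinearMap.coe_toContinuousLinearMap]
          linarith
      _ = gam V (tmap d v b '' univ) := by
          rw [gam, withDensity_apply']
      _ ≤ gam V A := by
          refine measure_mono ?_
          rintro _ ⟨y, -, rfl⟩
          exact hA y
  have hi : Integrable (fun y => Ph b ^ (Module.finrank ℝ V) * (1 + R y)) (gam V) :=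
    (((integrable_const 1).add hRi).const_mul _)
  rw [← ofReal_integral_eq_lintegral_ofReal hi (Filter.Eventually.of_forall fun y =>
    mul_nonneg (pow_nonneg (Ph_pos b).le _) (by linarith [hR0 y]))] at h2
  have h3 := (ENNReal.ofReal_le_iff_le_toReal (measure_ne_top _ _)).1 h2
  rw [integral_const_mul, integral_add (integrable_const 1) hRi] at h3
  simpa [Measure.real] using h3

end Gauss
end Part5

section Part6

section Gain
variable {V : Type*} [NormedAddCommGroup V] [InnerProductSpace ℝ V] [FiniteDimensional ℝ V]
  [MeasurableSpace V] [BorelSpace V]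

lemma Gamma_half_le (m : ℕ) : Real.Gamma ((m:ℝ) / 2 + 1) ≤ (m:ℝ) ^ m := by
  have h1 := Real.Gamma_mul_add_mul_le_rpow_Gamma_mul_rpow_Gamma (s := (m:ℝ) + 1) (t := 1)
    (a := 1/2) (b := 1/2) (by positivity) (by norm_num) (by norm_num) (by norm_num) (by norm_num)
  rw [show (1/2 : ℝ) * ((m:ℝ) + 1) + 1/2 * 1 = (m:ℝ)/2 + 1 by ring, Real.Gamma_nat_eq_factorial,
    Real.Gamma_one, Real.one_rpow, mul_one] at h1
  refine h1.trans ?_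
  have h2 : (1:ℝ) ≤ m.factorial := by exact_mod_cast Nat.factorial_pos m
  calc (m.factorial : ℝ) ^ (1/2 : ℝ) ≤ (m.factorial : ℝ) ^ (1:ℝ) :=
        Real.rpow_le_rpow_of_exponent_le h2 (by norm_num)
    _ = m.factorial := Real.rpow_one _
    _ ≤ (m:ℝ) ^ m := by exact_mod_cast Nat.factorial_le_pow m

lemma gam_ball {m : ℕ} (hm : Module.finrank ℝ V = m) (hm1 : 1 ≤ m) (x : V) (r : ℝ) (hr : 0 < r)
    (hx : ‖x‖ + r ≤ 1) : 1 / 2 * (r / (2 * m)) ^ m ≤ (gam V).real (ball x r) := by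
  have : Nontrivial V := Module.nontrivial_of_finrank_pos (R := ℝ) (by omega)
  have hvol : (volume : Measure V).real (ball x r) = r ^ m * (√Real.pi ^ m / Real.Gamma (m / 2 + 1)) := by
    rw [Measure.real, InnerProductSpace.volume_ball, hm, ENNReal.toReal_mul, ENNReal.toReal_pow,
      ENNReal.toReal_ofReal hr.le, ENNReal.toReal_ofReal]
    have := Real.Gamma_pos_of_pos (s := (m:ℝ)/2 + 1) (by positivity)
    positivity
  have h1 : (gam V).real (ball x r) = ∫ y in ball x r, gd y := by
    rw [Measure.real, gam, withDensity_apply _ measurableSet_ball,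
      ← ofReal_integral_eq_lintegral_ofReal gd_int.integrableOn
      (Filter.Eventually.of_forall fun y => (gd_pos y).le), ENNReal.toReal_ofReal]
    exact integral_nonneg fun y => (gd_pos y).le
  have h2 : ∫ y in ball x r, ((√(2 * Real.pi))⁻¹ ^ m * (1/2)) ≤ ∫ y in ball x r, gd y := by
    refine setIntegral_mono_on (integrableOn_const measure_ball_lt_top.ne) gd_int.integrableOn measurableSet_ball fun y hy => ?_
    unfold gd
    rw [hm]
    refine mul_le_mul_of_nonneg_left ?_ (by positivity)
    have hy1 : ‖y‖ ≤ 1 := by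
      have := norm_le_norm_add_norm_sub' y x
      have h3 : ‖y - x‖ < r := by rwa [mem_ball, dist_eq_norm] at hy
      linarith [norm_sub_rev x y]
    have : (1:ℝ)/2 ≤ Real.exp (-1/2) := by
      have := Real.add_one_le_exp (-1/2 : ℝ); linarith
    refine this.trans (Real.exp_le_exp.2 ?_)
    nlinarith [norm_nonneg y]
  rw [h1]
  refine le_trans ?_ h2
  rw [setIntegral_const, hvol, smul_eq_mul]
  have hG := Gamma_half_le m
  have hG0 := Real.Gamma_pos_of_pos (s := (m:ℝ)/2 + 1) (by positivity)
  have hm0 : (0:ℝ) < m := by exact_mod_cast hm1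
  have e1 : (√(2 * Real.pi))⁻¹ ^ m * √Real.pi ^ m = (√2)⁻¹ ^ m := by
    rw [← mul_pow]; congr 1
    rw [Real.sqrt_mul (by norm_num)]
    have : √Real.pi ≠ 0 := by positivity
    field_simp
  have e2 : (1/2 : ℝ) ^ m ≤ (√2)⁻¹ ^ m := by
    refine pow_le_pow_left₀ (by norm_num) ?_ m
    rw [one_div]
    refine inv_anti₀ (by positivity) (Real.sqrt_le_iff.2 ⟨by norm_num, by norm_num⟩)
  calc 1 / 2 * (r / (2 * m)) ^ m = 1/2 * (r ^ m * ((1/2 : ℝ) ^ m / (m:ℝ)^m)) := by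
        rw [div_pow, mul_pow, div_pow, one_pow]; field_simp
    _ ≤ 1/2 * (r ^ m * ((√2)⁻¹ ^ m / Real.Gamma (m / 2 + 1))) := by gcongr
    _ = _ := by rw [← e1]; ring

lemma sq_gain {m : ℕ} (hm : Module.finrank ℝ V = m) (hm1 : 1 ≤ m) (u : V) :
    ‖u‖ ^ 2 * (1 / 6400 * (1 / 2 * ((1/80) / (2 * m)) ^ m)) ≤
      ∫ y in closedBall (0:V) (1/20), ⟪u, y⟫ ^ 2 ∂(gam V) := by
  have hcont : Continuous fun y : V => ⟪u, y⟫ ^ 2 := by fun_prop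
  have hIntg : IntegrableOn (fun y : V => ⟪u, y⟫ ^ 2) (closedBall 0 (1/20)) (gam V) :=
    hcont.continuousOn.integrableOn_compact (isCompact_closedBall _ _)
  by_cases hu : u = 0
  · simp [hu]
  have hu0 : 0 < ‖u‖ := norm_pos_iff.2 hu
  set x : V := (1 / (40 * ‖u‖)) • u with hx
  have hxn : ‖x‖ = 1/40 := by
    rw [hx, norm_smul, Real.norm_eq_abs, abs_of_pos (by positivity)]; field_simp
  have hsub : ball x (1/80) ⊆ closedBall 0 (1/20) := by
    intro y hy
    rw [mem_closedBall_zero_iff]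
    have h3 : ‖y - x‖ < 1/80 := by rwa [mem_ball, dist_eq_norm] at hy
    have : ‖y‖ ≤ ‖x‖ + ‖y - x‖ := by
      calc ‖y‖ = ‖x + (y - x)‖ := by congr 1; abel
        _ ≤ _ := norm_add_le _ _
    linarith
  have h1 := gam_ball hm hm1 x (1/80) (by norm_num) (by rw [hxn]; norm_num)
  calc _ ≤ ‖u‖ ^ 2 * (1 / 6400) * (gam V).real (ball x (1/80)) := by
        rw [mul_assoc]; gcongr
    _ = ∫ y in ball x (1/80), ‖u‖ ^ 2 * (1 / 6400) ∂(gam V) := by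
        rw [setIntegral_const, smul_eq_mul]; ring
    _ ≤ ∫ y in ball x (1/80), ⟪u, y⟫ ^ 2 ∂(gam V) := by
        refine setIntegral_mono_on (integrableOn_const (measure_ne_top _ _)) (hIntg.mono_set hsub) measurableSet_ball fun y hy => ?_
        have h3 : ‖y - x‖ < 1/80 := by rwa [mem_ball, dist_eq_norm] at hy
        have h4 : ⟪u, y⟫ = ‖u‖ / 40 + ⟪u, y - x⟫ := by
          rw [inner_sub_right, hx, inner_smul_right, real_inner_self_eq_norm_sq]
          field_simp; ring
        have h5 := abs_real_inner_le_norm u (y - x)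
        have h6 : ‖u‖ * ‖y - x‖ ≤ ‖u‖ * (1/80) := by gcongr
        have h7 : ‖u‖ / 80 ≤ ⟪u, y⟫ := by
          rw [h4]; have := (abs_le.1 h5).1; linarith
        nlinarith
    _ ≤ _ := setIntegral_mono_set hIntg (Filter.Eventually.of_forall fun y => sq_nonneg _)
        (Filter.Eventually.of_forall hsub)

variable {ι : Type*} [Fintype ι]

lemma Sgain_int {m : ℕ} (hm : Module.finrank ℝ V = m) (hm1 : 1 ≤ m) {d : ι → ℝ} {v : ι → V}
    (hd : ∀ i, 0 ≤ d i) (hv : ∀ i, ‖v i‖ = 1) :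
    (∑ i, ∑ j, d i * d j * (⟪v i, v j⟫ ^ 2 * (1 - ⟪v i, v j⟫))) *
      (1 / 6400 * ((1/160) / m) ^ m) ≤
      ∫ y in closedBall (0:V) (1/20), Sgain d v y ∂(gam V) := by
  have hIntg : ∀ i j, IntegrableOn (fun y => d i * d j * (⟪v i, v j⟫ ^ 2 * (⟪v i, y⟫ - ⟪v j, y⟫) ^ 2))
      (closedBall 0 (1/20)) (gam V) := fun i j =>
    (Continuous.continuousOn (by fun_prop)).integrableOn_compact (isCompact_closedBall _ _)
  unfold Sgain
  rw [integral_finsetSum _ (fun i _ => integrable_finsetSum _ fun j _ => hIntg i j), Finset.sum_mul]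
  refine Finset.sum_le_sum fun i _ => ?_
  rw [integral_finsetSum _ (fun j _ => hIntg i j), Finset.sum_mul]
  refine Finset.sum_le_sum fun j _ => ?_
  rw [integral_const_mul, integral_const_mul]
  have h1 := sq_gain hm hm1 (v i - v j)
  simp_rw [inner_sub_left] at h1
  have h2 : ‖v i - v j‖ ^ 2 = 2 * (1 - ⟪v i, v j⟫) := by
    rw [norm_sub_sq_real, hv, hv]; ring
  rw [h2, show (1/80 : ℝ) / (2 * m) = (1/160) / m by ring] at h1
  have h3 := mul_le_mul_of_nonneg_left h1
    (mul_nonneg (mul_nonneg (hd i) (hd j)) (sq_nonneg ⟪v i, v j⟫))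
  refine le_trans (le_of_eq ?_) (h3.trans (le_of_eq ?_)) <;> ring

lemma transport_gain {m : ℕ} (hm : Module.finrank ℝ V = m) (hm1 : 1 ≤ m)
    {d : ι → ℝ} {v : ι → V} (hd : ∀ i, 0 ≤ d i)
    (hF : ∀ x, ∑ i, (d i * ⟪v i, x⟫) • v i = x) (hv : ∀ i, ‖v i‖ = 1) (b : ℝ)
    (hb : -1/2 ≤ b) (hb0 : b ≤ 0) (A : Set V) (hA : ∀ y, tmap d v b y ∈ A) :
    Ph b ^ m * (1 + 1/640000 * ((∑ i, ∑ j, d i * d j * (⟪v i, v j⟫ ^ 2 * (1 - ⟪v i, v j⟫))) *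
      (1 / 6400 * ((1/160) / m) ^ m))) ≤ (gam V).real A := by
  have hSc : Continuous (Sgain d v) := by unfold Sgain; fun_prop
  have hS0 : ∀ y, 0 ≤ Sgain d v y := fun y => Finset.sum_nonneg fun i _ =>
    Finset.sum_nonneg fun j _ => mul_nonneg (mul_nonneg (hd i) (hd j)) (by positivity)
  set R : V → ℝ := indicator (closedBall 0 (1/20)) (fun y => 1/640000 * Sgain d v y) with hRdef
  have hRi : Integrable R (gam V) := by
    rw [hRdef, integrable_indicator_iff measurableSet_closedBall]
    exact (Continuous.continuousOn (by fun_prop)).integrableOn_compact (isCompact_closedBall _ _)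
  have h := transport hd hF hv b R ?_ ?_ hRi A hA
  · rw [hm, hRdef, integral_indicator measurableSet_closedBall, integral_const_mul] at h
    refine le_trans ?_ h
    have := Sgain_int hm hm1 hd hv
    have h8 := pow_pos (Ph_pos b) m
    gcongr
  · intro y
    by_cases hy : y ∈ closedBall (0:V) (1/20)
    · have hs : ∀ i, |⟪v i, y⟫| ≤ 1/20 := fun i => by
        have := abs_real_inner_le_norm (v i) y
        rw [hv, one_mul] at this
        exact this.trans (mem_closedBall_zero_iff.1 hy)
      refine ⟨4, fun i => (qf_loc hb hb0 (hs i)).2, ?_⟩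
      rw [hRdef, indicator_of_mem hy, Sgain, Finset.mul_sum, Finset.mul_sum]
      refine Finset.sum_le_sum fun i _ => ?_
      rw [Finset.mul_sum, Finset.mul_sum]
      refine Finset.sum_le_sum fun j _ => ?_
      have h1 := qf_gap hb hb0 (hs i) (hs j)
      have h2 := mul_le_mul_of_nonneg_left h1
        (mul_nonneg (mul_nonneg (hd i) (hd j)) (sq_nonneg ⟪v i, v j⟫))
      nlinarith
    · refine ⟨∑ i, qf b ⟪v i, y⟫, fun i =>
        Finset.single_le_sum (f := fun i => qf b ⟪v i, y⟫) (fun i _ => (qf_pos b _).le)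
          (Finset.mem_univ i), ?_⟩
      rw [hRdef, indicator_of_notMem hy]
      exact mul_nonneg (by positivity) (Finset.sum_nonneg fun i _ =>
        Finset.sum_nonneg fun j _ => mul_nonneg (mul_nonneg (hd i) (hd j)) (by positivity))
  · intro y
    exact indicator_nonneg (fun y _ => by have := hS0 y; positivity) y

lemma transport_zero {m : ℕ} (hm : Module.finrank ℝ V = m)
    {d : ι → ℝ} {v : ι → V} (hd : ∀ i, 0 ≤ d i)
    (hF : ∀ x, ∑ i, (d i * ⟪v i, x⟫) • v i = x) (hv : ∀ i, ‖v i‖ = 1) (b : ℝ)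
    (A : Set V) (hA : ∀ y, tmap d v b y ∈ A) :
    Ph b ^ m ≤ (gam V).real A := by
  have h := transport hd hF hv b (fun _ => 0) (fun y => ⟨∑ i, qf b ⟪v i, y⟫, fun i =>
        Finset.single_le_sum (f := fun i => qf b ⟪v i, y⟫) (fun i _ => (qf_pos b _).le)
          (Finset.mem_univ i), mul_nonneg (by positivity) (Finset.sum_nonneg fun i _ =>
        Finset.sum_nonneg fun j _ => mul_nonneg (mul_nonneg (hd i) (hd j)) (by positivity))⟩)
    (fun _ => le_rfl) (integrable_zero _ _ _) A hA
  simpa [hm] using h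
end Gain
end Part6

section Part7

/-- shorthand -/
abbrev EE (n : ℕ) := EuclideanSpace ℝ (Fin n)
/-- lifted space -/
abbrev WW (n : ℕ) := WithLp 2 (EuclideanSpace ℝ (Fin n) × ℝ)

/-- lift of a unit vector -/
def lft {n : ℕ} (u : EE n) : WW n := √((n:ℝ) / (n + 1)) • WithLp.toLp 2 (u, (√(n:ℝ))⁻¹)

lemma lft_inner {n : ℕ} (u : EE n) (z : WW n) :
    ⟪lft u, z⟫ = √((n:ℝ) / (n + 1)) * (⟪u, z.fst⟫ + (√(n:ℝ))⁻¹ * z.snd) := by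
  rw [lft, inner_smul_left, WithLp.prod_inner_apply]
  simp [mul_comm]

lemma lft_inner' {n : ℕ} (hn : 1 ≤ n) (u : EE n) (z : WW n) :
    ⟪lft u, z⟫ = (√(n:ℝ) * ⟪u, z.fst⟫ + z.snd) / √((n:ℝ) + 1) := by
  have : (0:ℝ) < √(n:ℝ) := Real.sqrt_pos.2 (by exact_mod_cast hn)
  rw [lft_inner, Real.sqrt_div (by positivity)]
  field_simp

lemma lft_fst {n : ℕ} (u : EE n) : (lft u).fst = √((n:ℝ) / (n + 1)) • u := rfl
lemma lft_snd {n : ℕ} (u : EE n) : (lft u).snd = √((n:ℝ) / (n + 1)) * (√(n:ℝ))⁻¹ := rfl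

lemma lft_lft {n : ℕ} (hn : 1 ≤ n) (u u' : EE n) :
    ⟪lft u, lft u'⟫ = (n:ℝ) / (n + 1) * (⟪u, u'⟫ + 1 / n) := by
  have hn0 : (0:ℝ) < n := by exact_mod_cast hn
  rw [lft_inner, lft_fst, lft_snd, inner_smul_right]
  have e1 : √((n:ℝ) / (n + 1)) * √((n:ℝ) / (n + 1)) = (n:ℝ) / (n + 1) := Real.mul_self_sqrt (by positivity)
  have e2 : (√(n:ℝ))⁻¹ * (√(n:ℝ))⁻¹ = 1 / n := by
    rw [← mul_inv, Real.mul_self_sqrt hn0.le, one_div]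
  linear_combination (⟪u, u'⟫ + (√(n:ℝ))⁻¹ * (√(n:ℝ))⁻¹) * e1 + (n:ℝ) / (n + 1) * e2

lemma lft_norm {n : ℕ} (hn : 1 ≤ n) (u : EE n) (hu : ‖u‖ = 1) : ‖lft u‖ = 1 := by
  have hn0 : (0:ℝ) < n := by exact_mod_cast hn
  have : ‖lft u‖ ^ 2 = 1 := by
    rw [← real_inner_self_eq_norm_sq, lft_lft hn, real_inner_self_eq_norm_sq, hu]; field_simp
  have := norm_nonneg (lft u); nlinarith

lemma WW_ext {n : ℕ} {z z' : WW n} (h1 : z.fst = z'.fst) (h2 : z.snd = z'.snd) : z = z' := by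
  exact (WithLp.equiv 2 _).injective (Prod.ext h1 h2)

lemma WW_fst_sum {n : ℕ} {ι : Type*} (s : Finset ι) (f : ι → WW n) :
    (∑ i ∈ s, f i).fst = ∑ i ∈ s, (f i).fst := by
  classical
  induction s using Finset.induction_on with
  | empty => simp
  | insert a s ha ih => rw [Finset.sum_insert ha, Finset.sum_insert ha, WithLp.add_fst, ih]

lemma WW_snd_sum {n : ℕ} {ι : Type*} (s : Finset ι) (f : ι → WW n) :
    (∑ i ∈ s, f i).snd = ∑ i ∈ s, (f i).snd := by
  classical
  induction s using Finset.induction_on with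
  | empty => simp
  | insert a s ha ih => rw [Finset.sum_insert ha, Finset.sum_insert ha, WithLp.add_snd, ih]

section John
variable {n : ℕ} (hn : 1 ≤ n) {ι : Type*} [Fintype ι] {c : ι → ℝ} {u : ι → EE n}

lemma lft_frame (hn : 1 ≤ n) {c : ι → ℝ} {u : ι → EE n} (hc1 : ∑ i, c i = 1) (hcu : ∑ i, c i • u i = 0)
    (hF : ∀ x, ∑ i, (c i * ⟪u i, x⟫) • u i = (1 / (n:ℝ)) • x) (z : WW n) :
    ∑ i, (((n:ℝ) + 1) * c i * ⟪lft (u i), z⟫) • lft (u i) = z := by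
  have hn0 : (0:ℝ) < n := by exact_mod_cast hn
  have e1 : √((n:ℝ) / (n + 1)) * √((n:ℝ) / (n + 1)) = (n:ℝ) / (n + 1) := Real.mul_self_sqrt (by positivity)
  have e2 : (√(n:ℝ))⁻¹ * (√(n:ℝ))⁻¹ = 1 / n := by
    rw [← mul_inv, Real.mul_self_sqrt hn0.le, one_div]
  have e3 : ((n:ℝ) + 1) * (√((n:ℝ) / (n + 1)) * √((n:ℝ) / (n + 1))) = n := by
    rw [e1]; field_simp
  apply WW_ext
  · rw [WW_fst_sum]
    have : ∀ i, ((((n:ℝ) + 1) * c i * ⟪lft (u i), z⟫) • lft (u i)).fst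
        = (n:ℝ) • ((c i * ⟪u i, z.fst⟫) • u i) + ((n:ℝ) * ((√(n:ℝ))⁻¹ * z.snd)) • (c i • u i) := by
      intro i
      rw [WithLp.smul_fst, lft_fst, lft_inner, smul_smul, smul_smul, smul_smul, ← add_smul]
      congr 1
      linear_combination (c i * (⟪u i, z.fst⟫ + (√(n:ℝ))⁻¹ * z.snd)) * e3
    simp_rw [this]
    rw [Finset.sum_add_distrib, ← Finset.smul_sum, ← Finset.smul_sum, hcu, hF, smul_zero, add_zero,
      smul_smul]
    rw [mul_one_div_cancel hn0.ne', one_smul]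
  · rw [WW_snd_sum]
    have : ∀ i, ((((n:ℝ) + 1) * c i * ⟪lft (u i), z⟫) • lft (u i)).snd
        = (n:ℝ) * (√(n:ℝ))⁻¹ * ⟪c i • u i, z.fst⟫ + z.snd * c i := by
      intro i
      rw [WithLp.smul_snd, lft_snd, lft_inner, smul_eq_mul, inner_smul_left]
      simp only [RCLike.conj_to_real]
      have e4 : (n:ℝ) * ((√(n:ℝ))⁻¹ * (√(n:ℝ))⁻¹) = 1 := by rw [e2]; field_simp
      linear_combination (c i * (⟪u i, z.fst⟫ + (√(n:ℝ))⁻¹ * z.snd) * (√(n:ℝ))⁻¹) * e3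
        + c i * z.snd * e4
    simp_rw [this]
    rw [Finset.sum_add_distrib, ← Finset.mul_sum, ← sum_inner, hcu, ← Finset.mul_sum, hc1]
    simp

lemma john_gauge_le (hn : 1 ≤ n) {K : Set (EE n)} (hK : Convex ℝ K) (hc0 : ∀ i, 0 ≤ c i)
    (hc1 : ∑ i, c i = 1) (hcu : ∑ i, c i • u i = 0) (hu : ∀ i, ‖u i‖ = 1) (huK : ∀ i, u i ∈ K)
    (hF : ∀ x, ∑ i, (c i * ⟪u i, x⟫) • u i = (1 / (n:ℝ)) • x) :
    closedBall 0 (1 / (n:ℝ)) ⊆ K := by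
  have hn0 : (0:ℝ) < n := by exact_mod_cast hn
  have h0 : (0 : EE n) ∈ K := by
    rw [← hcu]; exact hK.sum_mem (fun i _ => hc0 i) hc1 fun i _ => huK i
  intro x hx
  rw [mem_closedBall_zero_iff] at hx
  -- x = sum of n c_i (⟪u_i,x⟫ + 1/n) u_i
  have h1 : x = ∑ i, ((n:ℝ) * (c i * (⟪u i, x⟫ + 1 / n))) • u i := by
    have : ∀ i, ((n:ℝ) * (c i * (⟪u i, x⟫ + 1 / n))) • u i
        = (n:ℝ) • ((c i * ⟪u i, x⟫) • u i) + c i • u i := fun i => by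
      rw [smul_smul, ← add_smul]; congr 1; field_simp
    simp_rw [this]
    rw [Finset.sum_add_distrib, ← Finset.smul_sum, hF, hcu, add_zero, smul_smul,
      mul_one_div_cancel hn0.ne', one_smul]
  rw [h1]
  refine hK.sum_mem (fun i _ => ?_) ?_ fun i _ => huK i
  · have := abs_real_inner_le_norm (u i) x
    rw [hu, one_mul] at this
    have := (abs_le.1 this).1
    exact mul_nonneg hn0.le (mul_nonneg (hc0 i) (by linarith))
  · have : ∀ i, (n:ℝ) * (c i * (⟪u i, x⟫ + 1 / n)) = n * ⟪c i • u i, x⟫ + c i := fun i => by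
      rw [inner_smul_left]; simp only [RCLike.conj_to_real]; field_simp
    simp_rw [this]
    rw [Finset.sum_add_distrib, ← Finset.mul_sum, ← sum_inner, hcu, hc1]; simp

lemma tmap_mem (hn : 1 ≤ n) {K : Set (EE n)} (hK : Convex ℝ K) (hKa : Absorbent ℝ K)
    {c : ι → ℝ} {u : ι → EE n} (hc0 : ∀ i, 0 ≤ c i)
    (hc1 : ∑ i, c i = 1) (hcu : ∑ i, c i • u i = 0) (huK : ∀ i, u i ∈ K)
    (hF : ∀ x, ∑ i, (c i * ⟪u i, x⟫) • u i = (1 / (n:ℝ)) • x) (b : ℝ) (y : WW n) :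
    gauge K (-(tmap (fun i => ((n:ℝ) + 1) * c i) (fun i => lft (u i)) b y).fst) / √(n:ℝ) +
      (tmap (fun i => ((n:ℝ) + 1) * c i) (fun i => lft (u i)) b y).snd ≤ √((n:ℝ) + 1) * b := by
  have hn0 : (0:ℝ) < n := by exact_mod_cast hn
  have hs0 : (0:ℝ) < √(n:ℝ) := Real.sqrt_pos.2 hn0
  set z := tmap (fun i => ((n:ℝ) + 1) * c i) (fun i => lft (u i)) b y with hz
  set a : ι → ℝ := fun i => ((n:ℝ) + 1) * c i * (b - pf b ⟪lft (u i), y⟫) with ha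
  have ha0 : ∀ i, 0 ≤ a i := fun i => mul_nonneg (mul_nonneg (by positivity) (hc0 i))
    (sub_nonneg.2 (pf_lt b _).le)
  set τ := √((n:ℝ) / (n + 1)) with hτ
  have hτ0 : 0 ≤ τ := Real.sqrt_nonneg _
  have e0 : τ * (√(n:ℝ))⁻¹ = (√((n:ℝ) + 1))⁻¹ := by
    rw [hτ, Real.sqrt_div hn0.le]; field_simp
  have h1 : -z.fst = ∑ i, (τ * a i) • u i := by
    rw [hz, tmap, WW_fst_sum]
    simp only [WithLp.smul_fst, lft_fst]
    have : ∀ i, (τ * a i) • u i = (τ * ((n:ℝ) + 1) * b) • (c i • u i)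
      - (((n:ℝ) + 1) * c i * pf b ⟪lft (u i), y⟫) • (τ • u i) := fun i => by
      rw [smul_smul, smul_smul, ← sub_smul]; congr 1; simp only [ha]; ring
    simp_rw [this]
    rw [Finset.sum_sub_distrib, ← Finset.smul_sum, hcu]
    simp [hτ]
  have h2 : √((n:ℝ) + 1) * b - z.snd = (∑ i, τ * a i) / √(n:ℝ) := by
    rw [hz, tmap, WW_snd_sum]
    simp only [WithLp.smul_snd, lft_snd, smul_eq_mul]
    have : ∀ i, τ * a i = (τ * ((n:ℝ) + 1) * b) * c i
      - (((n:ℝ) + 1) * c i * pf b ⟪lft (u i), y⟫) * τ := fun i => by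
      simp only [ha]; ring
    simp_rw [this]
    rw [Finset.sum_sub_distrib, ← Finset.mul_sum, hc1, sub_div, Finset.sum_div]
    congr 1
    · rw [mul_one, show τ * ((n:ℝ) + 1) * b / √(n:ℝ) = (τ * (√(n:ℝ))⁻¹) * ((n:ℝ) + 1) * b by
        rw [div_eq_mul_inv]; ring, e0]
      have : (n:ℝ) + 1 = √((n:ℝ) + 1) * √((n:ℝ) + 1) := (Real.mul_self_sqrt (by positivity)).symm
      have h3 : 0 < √((n:ℝ) + 1) := by positivity
      congr 1
      rw [eq_inv_mul_iff_mul_eq₀ h3.ne']; linarith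
    · refine Finset.sum_congr rfl fun i _ => ?_
      rw [← hτ, div_eq_mul_inv]; ring
  have h3 : gauge K (-z.fst) ≤ ∑ i, τ * a i := by
    rw [h1]
    refine (gauge_sum_le hK hKa _ _).trans (Finset.sum_le_sum fun i _ => ?_)
    rw [gauge_smul_of_nonneg (mul_nonneg hτ0 (ha0 i)), smul_eq_mul]
    exact mul_le_of_le_one_right (mul_nonneg hτ0 (ha0 i)) (gauge_le_one_of_mem (huK i))
  have h4 : gauge K (-z.fst) / √(n:ℝ) ≤ (∑ i, τ * a i) / √(n:ℝ) := by gcongr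
  linarith

end John

section Simplex
variable {n : ℕ} {w : Fin (n + 1) → EE n}

lemma WW_finrank (n : ℕ) : Module.finrank ℝ (WW n) = n + 1 := by
  rw [(WithLp.linearEquiv 2 ℝ (EE n × ℝ)).finrank_eq, Module.finrank_prod]
  simp

lemma reg_ortho (hn : 1 ≤ n) (hw : IsRegVerts w) : Orthonormal ℝ (fun a => lft (w a)) := by
  have hn0 : (0:ℝ) < n := by exact_mod_cast hn
  refine ⟨fun a => lft_norm hn _ (hw.1 a), fun a b hab => ?_⟩
  simp only []
  rw [lft_lft hn, hw.2 a b hab]; ring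

/-- orthonormal basis of the lifted simplex -/
def regBasis (hn : 1 ≤ n) (hw : IsRegVerts w) : OrthonormalBasis (Fin (n+1)) ℝ (WW n) :=
  OrthonormalBasis.mk (reg_ortho hn hw) (by
    have := (reg_ortho hn hw).linearIndependent.span_eq_top_of_card_eq_finrank' (by
      rw [WW_finrank]; simp)
    exact this.ge)

lemma regBasis_apply (hn : 1 ≤ n) (hw : IsRegVerts w) (a : Fin (n+1)) :
    regBasis hn hw a = lft (w a) := by simp [regBasis]

lemma reg_sum (hn : 1 ≤ n) (hw : IsRegVerts w) : ∑ a, w a = 0 := by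
  have hn0 : (0:ℝ) < n := by exact_mod_cast hn
  have h1 : ‖∑ a, w a‖ ^ 2 = 0 := by
    rw [← real_inner_self_eq_norm_sq, sum_inner]
    have : ∀ a, ⟪w a, ∑ b, w b⟫ = 0 := fun a => by
      rw [inner_sum, ← Finset.add_sum_erase _ _ (Finset.mem_univ a),
        Finset.sum_congr rfl (fun b hb => hw.2 a b (Finset.ne_of_mem_erase hb).symm),
        real_inner_self_eq_norm_sq, hw.1 a, Finset.sum_const, Finset.card_erase_of_mem (Finset.mem_univ a)]
      simp
      field_simp
      ring
    simp [this]
  simpa using h1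

lemma reg_frame (hn : 1 ≤ n) (hw : IsRegVerts w) (x : EE n) :
    ∑ a, ⟪w a, x⟫ • w a = (((n:ℝ) + 1) / n) • x := by
  have hn0 : (0:ℝ) < n := by exact_mod_cast hn
  have h := congrArg WithLp.fst ((regBasis hn hw).sum_repr' (WithLp.toLp 2 (x, (0:ℝ))))
  rw [WW_fst_sum] at h
  simp only [regBasis_apply, lft_inner, WithLp.smul_fst, lft_fst, mul_zero, add_zero, smul_smul] at h
  have hf : (WithLp.toLp 2 (x, (0:ℝ)) : WW n).fst = x := rfl
  have hs : (WithLp.toLp 2 (x, (0:ℝ)) : WW n).snd = 0 := rfl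
  simp only [hf, hs, mul_zero, add_zero] at h
  change ∑ a, (√((n:ℝ) / (n + 1)) * ⟪w a, x⟫ * √((n:ℝ) / (n + 1))) • w a = x at h
  have e1 : √((n:ℝ) / (n + 1)) * √((n:ℝ) / (n + 1)) = (n:ℝ) / (n + 1) := Real.mul_self_sqrt (by positivity)
  conv_rhs => rw [← h]
  rw [Finset.smul_sum]
  refine Finset.sum_congr rfl fun a _ => ?_
  rw [smul_smul]
  congr 1
  rw [show √((n:ℝ) / (n + 1)) * ⟪w a, x⟫ * √((n:ℝ) / (n + 1)) =
    (√((n:ℝ) / (n + 1)) * √((n:ℝ) / (n + 1))) * ⟪w a, x⟫ by ring, e1]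
  field_simp

lemma reg_norm (hn : 1 ≤ n) (hw : IsRegVerts w) (x : EE n) :
    ∑ a, ⟪w a, x⟫ ^ 2 = (((n:ℝ) + 1) / n) * ‖x‖ ^ 2 := by
  have := congrArg (fun y => ⟪y, x⟫) (reg_frame hn hw x)
  simp only [sum_inner, inner_smul_left, real_inner_self_eq_norm_sq, RCLike.conj_to_real] at this
  rw [← this]
  refine Finset.sum_congr rfl fun a _ => by ring

lemma reg_mem (hn : 1 ≤ n) (hw : IsRegVerts w) (x : EE n) :
    x ∈ convexHull ℝ (range w) ↔ ∀ a, n * ⟪w a, -x⟫ ≤ 1 := by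
  have hn0 : (0:ℝ) < n := by exact_mod_cast hn
  constructor
  · intro hx a
    have hconv : Convex ℝ {x : EE n | n * ⟪w a, -x⟫ ≤ 1} := by
      intro x hx y hy s t hs ht hst
      simp only [mem_ofPred_eq, inner_neg_right, inner_add_right, inner_smul_right] at *
      nlinarith
    refine convexHull_min ?_ hconv hx
    rintro _ ⟨b, rfl⟩
    simp only [mem_ofPred_eq, inner_neg_right]
    by_cases hab : a = b
    · subst hab; rw [real_inner_self_eq_norm_sq, hw.1]; nlinarith
    · rw [hw.2 a b hab]; field_simp; norm_num
  · intro h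
    have h1 : x = ∑ a, ((n * ⟪w a, x⟫ + 1) / (n + 1)) • w a := by
      have : ∀ a, ((n * ⟪w a, x⟫ + 1) / (n + 1)) • w a
        = ((n:ℝ) / (n + 1)) • (⟪w a, x⟫ • w a) + ((1:ℝ) / (n + 1)) • w a := fun a => by
        rw [smul_smul, ← add_smul]; congr 1; ring
      simp_rw [this]
      rw [Finset.sum_add_distrib, ← Finset.smul_sum, ← Finset.smul_sum, reg_frame hn hw, reg_sum hn hw,
        smul_smul, smul_zero, add_zero]
      rw [div_mul_div_cancel₀ (by positivity), div_self hn0.ne', one_smul]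
    rw [h1]
    refine (convex_convexHull ℝ _).sum_mem (fun a _ => ?_) ?_ fun a _ => subset_convexHull _ _ ⟨a, rfl⟩
    · have := h a
      rw [inner_neg_right] at this
      exact div_nonneg (by linarith) (by positivity)
    · rw [← Finset.sum_div, Finset.sum_add_distrib, ← Finset.mul_sum, ← sum_inner, reg_sum hn hw]
      simp
      field_simp
      positivity

lemma reg_ball (hn : 1 ≤ n) (hw : IsRegVerts w) : closedBall 0 (1 / (n:ℝ)) ⊆ convexHull ℝ (range w) := by
  have hn0 : (0:ℝ) < n := by exact_mod_cast hn
  intro x hx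
  rw [mem_closedBall_zero_iff] at hx
  rw [reg_mem hn hw]
  intro a
  have := (abs_le.1 (abs_real_inner_le_norm (w a) (-x))).2
  rw [hw.1, one_mul, norm_neg] at this
  calc (n:ℝ) * ⟪w a, -x⟫ ≤ n * (1 / n) := by gcongr; linarith
    _ = 1 := by field_simp

open Pointwise in
lemma reg_gauge_le (hn : 1 ≤ n) (hw : IsRegVerts w) (x : EE n) (t : ℝ) :
    gauge (convexHull ℝ (range w)) x ≤ t ↔ ∀ a, n * ⟪w a, -x⟫ ≤ t := by
  have hn0 : (0:ℝ) < n := by exact_mod_cast hn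
  have hab : Absorbent ℝ (convexHull ℝ (range w)) :=
    absorbent_nhds_zero (Filter.mem_of_superset (closedBall_mem_nhds 0 (by positivity)) (reg_ball hn hw))
  have key : ∀ s : ℝ, 0 < s → (x ∈ s • convexHull ℝ (range w) ↔ ∀ a, n * ⟪w a, -x⟫ ≤ s) := by
    intro s hs
    rw [mem_smul_set_iff_inv_smul_mem₀ hs.ne', reg_mem hn hw]
    refine forall_congr' fun a => ?_
    rw [← smul_neg, inner_smul_right, ← mul_assoc, mul_comm (n:ℝ), mul_assoc, inv_mul_le_iff₀ hs, mul_one]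
  constructor
  · intro h a
    refine le_of_forall_gt fun t' ht' => ?_
    obtain ⟨s, hs0, hst, hx⟩ := exists_lt_of_gauge_lt hab (h.trans_lt ht')
    exact ((key s hs0).1 hx a).trans_lt hst
  · intro h
    have hsum : ∑ a, ⟪w a, x⟫ = 0 := by rw [← sum_inner, reg_sum hn hw]; simp
    have ht0 : 0 ≤ t := by
      have h1 : ∑ a : Fin (n+1), n * ⟪w a, -x⟫ ≤ ∑ a : Fin (n+1), t := Finset.sum_le_sum fun a _ => h a
      simp only [inner_neg_right, mul_neg, Finset.sum_neg_distrib, ← Finset.mul_sum, hsum] at h1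
      simp at h1
      by_contra hc
      push Not at hc
      nlinarith
    rcases ht0.lt_or_eq with ht | ht
    · exact gauge_le_of_mem ht.le ((key t ht).2 h)
    · subst ht
      have h1 : ∀ a, 0 ≤ ⟪w a, x⟫ := fun a => by
        have := h a
        rw [inner_neg_right] at this
        nlinarith
      have h2 := (Finset.sum_eq_zero_iff_of_nonneg (fun a _ => h1 a)).1 hsum
      have h3 := reg_norm hn hw x
      have h4 : ∑ a, ⟪w a, x⟫ ^ 2 = 0 := Finset.sum_eq_zero fun a ha => by rw [h2 a ha]; ring
      rw [h4] at h3
      have h5 : x = 0 := by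
        have : ‖x‖ ^ 2 = 0 := by
          rcases mul_eq_zero.1 h3.symm with h | h
          · have : 0 < ((n:ℝ) + 1) / n := by positivity
            linarith
          · exact h
        simpa using this
      simp [h5]
end Simplex
end Part7

section Part8

/-- difference of step functions -/
def stp (x y β : ℝ) : ℝ := (if x ≤ β then 1 else 0) - (if y ≤ β then 1 else 0)

lemma stp_le {x y : ℝ} (h : x ≤ y) : stp x y = (Ico x y).indicator (fun _ => (1:ℝ)) := by
  ext β
  simp only [stp, indicator, mem_Ico]
  split_ifs <;> grind

lemma stp_anti (x y : ℝ) : stp y x = fun β => - stp x y β := by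
  ext β; simp [stp]

lemma stp_int (x y : ℝ) : Integrable (stp x y) volume ∧ ∫ β, stp x y β = y - x ∧
    ∫ β, ‖stp x y β‖ = |y - x| := by
  have key : ∀ x y : ℝ, x ≤ y → Integrable (stp x y) volume ∧ ∫ β, stp x y β = y - x ∧
    ∫ β, ‖stp x y β‖ = |y - x| := by
    intro x y h
    rw [stp_le h]
    refine ⟨?_, ?_, ?_⟩
    · rw [integrable_indicator_iff measurableSet_Ico]
      exact integrableOn_const (by simp)
    · rw [integral_indicator measurableSet_Ico]; simp [h]
    · have : (fun β => ‖(Ico x y).indicator (fun _ => (1:ℝ)) β‖) = (Ico x y).indicator (fun _ => (1:ℝ)) := by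
        ext β; simp only [indicator]; split_ifs <;> simp
      rw [this, integral_indicator measurableSet_Ico, abs_of_nonneg (by linarith)]; simp [h]
  rcases le_total x y with h | h
  · exact key x y h
  · obtain ⟨h1, h2, h3⟩ := key y x h
    rw [stp_anti y x]
    refine ⟨h1.neg, ?_, ?_⟩
    · rw [integral_neg, h2]; ring
    · simp_rw [norm_neg]; rw [h3, abs_sub_comm]

lemma cdf_gap {Ω : Type*} [MeasurableSpace Ω] (μ : Measure Ω) [IsProbabilityMeasure μ] {X Y : Ω → ℝ}
    (hX : Measurable X) (hY : Measurable Y) (iX : Integrable X μ) (iY : Integrable Y μ)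
    (c α0 α1 : ℝ) (h01 : α0 ≤ α1)
    (h : ∀ β, μ.real {ω | Y ω ≤ β} ≤ μ.real {ω | X ω ≤ β})
    (hg : ∀ β ∈ Icc α0 α1, c ≤ μ.real {ω | X ω ≤ β} - μ.real {ω | Y ω ≤ β}) :
    c * (α1 - α0) ≤ ∫ ω, Y ω ∂μ - ∫ ω, X ω ∂μ := by
  have hm : Measurable (Function.uncurry fun ω β => stp (X ω) (Y ω) β) := by
    unfold stp Function.uncurry
    refine Measurable.sub ?_ ?_
    · exact Measurable.ite (measurableSet_le (hX.comp measurable_fst) measurable_snd)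
        measurable_const measurable_const
    · exact Measurable.ite (measurableSet_le (hY.comp measurable_fst) measurable_snd)
        measurable_const measurable_const
  have hi : Integrable (Function.uncurry fun ω β => stp (X ω) (Y ω) β) (μ.prod volume) := by
    rw [integrable_prod_iff hm.aestronglyMeasurable]
    refine ⟨Filter.Eventually.of_forall fun ω => (stp_int (X ω) (Y ω)).1, ?_⟩
    have : (fun ω => ∫ β, ‖Function.uncurry (fun ω β => stp (X ω) (Y ω) β) (ω, β)‖) =
        fun ω => |Y ω - X ω| := by
      ext ω; exact (stp_int (X ω) (Y ω)).2.2
    rw [this]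
    exact (iY.sub iX).abs
  have h1 := integral_integral_swap hi
  have h2 : ∀ ω, ∫ β, stp (X ω) (Y ω) β = Y ω - X ω := fun ω => (stp_int (X ω) (Y ω)).2.1
  have h3 : ∀ β, ∫ ω, stp (X ω) (Y ω) β ∂μ = μ.real {ω | X ω ≤ β} - μ.real {ω | Y ω ≤ β} := by
    intro β
    have a1 : ∀ Z : Ω → ℝ, Measurable Z → ∫ ω, (if Z ω ≤ β then (1:ℝ) else 0) ∂μ = μ.real {ω | Z ω ≤ β} ∧
      Integrable (fun ω => (if Z ω ≤ β then (1:ℝ) else 0)) μ := by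
      intro Z hZ
      have hs : MeasurableSet {ω | Z ω ≤ β} := measurableSet_le hZ measurable_const
      have : (fun ω => (if Z ω ≤ β then (1:ℝ) else 0)) = {ω | Z ω ≤ β}.indicator (fun _ => (1:ℝ)) := by
        ext ω; simp [indicator]
      rw [this]
      constructor
      · rw [integral_indicator hs]; simp
      · exact (integrable_const _).indicator hs
    unfold stp
    rw [integral_sub (a1 X hX).2 (a1 Y hY).2, (a1 X hX).1, (a1 Y hY).1]
  have h4 := hi.integral_prod_right
  simp only [Function.uncurry] at h4
  simp_rw [h3] at h4
  simp_rw [h2, h3] at h1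
  rw [← integral_sub iY iX, h1]
  calc c * (α1 - α0) = ∫ β in Icc α0 α1, c := by simp [h01]; ring
    _ ≤ ∫ β in Icc α0 α1, (μ.real {ω | X ω ≤ β} - μ.real {ω | Y ω ≤ β}) :=
      setIntegral_mono_on (integrableOn_const (by simp)) h4.integrableOn measurableSet_Icc hg
    _ ≤ _ := setIntegral_le_integral h4 (Filter.Eventually.of_forall fun β => sub_nonneg.2 (h β))
end Part8

section Part9

section gen
variable {V : Type*} [NormedAddCommGroup V] [InnerProductSpace ℝ V] [FiniteDimensional ℝ V]
  [MeasurableSpace V] [BorelSpace V]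

lemma gam_integrable (f : V → ℝ) : Integrable f (gam V) ↔ Integrable (fun y => gd y * f y) := by
  rw [gam, integrable_withDensity_iff_integrable_smul' (by have := (gd_cont (V := V)).measurable; fun_prop)
    (Filter.Eventually.of_forall fun y => ENNReal.ofReal_lt_top)]
  simp only [ENNReal.toReal_ofReal (gd_pos _).le, smul_eq_mul]

lemma norm_gd_le (y : V) : gd y * ‖y‖ ≤ ((√(2 * Real.pi))⁻¹) ^ (Module.finrank ℝ V) * Real.exp (-(1/4) * ‖y‖ ^ 2) := by
  have h : ‖y‖ ≤ Real.exp (‖y‖ ^ 2 / 4) := by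
    have := Real.add_one_le_exp (‖y‖ ^ 2 / 4)
    nlinarith [sq_nonneg (‖y‖ / 2 - 1)]
  calc gd y * ‖y‖ ≤ gd y * Real.exp (‖y‖ ^ 2 / 4) := by gcongr; exact (gd_pos y).le
    _ = _ := by
      rw [gd, mul_assoc, ← Real.exp_add]; congr 2; ring

lemma gam_norm_integrable : Integrable (fun y : V => ‖y‖) (gam V) := by
  rw [gam_integrable]
  have := (GaussianFourier.integrable_cexp_neg_mul_sq_norm_add (V := V) (b := 1/4) (by norm_num) 0 0).norm
  refine Integrable.mono' (this.const_mul (((√(2 * Real.pi))⁻¹) ^ (Module.finrank ℝ V)))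
    (gd_cont.mul continuous_norm).aestronglyMeasurable (Filter.Eventually.of_forall fun y => ?_)
  rw [Real.norm_of_nonneg (mul_nonneg (gd_pos y).le (norm_nonneg y)), Complex.norm_exp]
  refine (norm_gd_le y).trans (le_of_eq ?_)
  congr 2
  simp [← Complex.ofReal_pow]

lemma gam_norm_le : ∫ y : V, ‖y‖ ∂(gam V) ≤ 2 ^ (Module.finrank ℝ V) := by
  rw [gam_integral]
  have i1 : Integrable (fun y : V => Real.exp (-(1/4) * ‖y‖ ^ 2)) := by
    refine (GaussianFourier.integrable_cexp_neg_mul_sq_norm_add (V := V) (b := 1/4) (by norm_num) 0 0).norm.congr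
      (Filter.Eventually.of_forall fun y => ?_)
    simp [Complex.norm_exp, ← Complex.ofReal_pow]
  refine (integral_mono ((gam_integrable _).1 gam_norm_integrable) (i1.const_mul _) norm_gd_le).trans ?_
  rw [integral_const_mul, GaussianFourier.integral_rexp_neg_mul_sq_norm (by norm_num)]
  set m := Module.finrank ℝ V
  have e : (Real.pi / (1/4)) ^ ((m:ℝ) / 2) = (√(4 * Real.pi)) ^ m := by
    rw [Real.sqrt_eq_rpow, ← Real.rpow_natCast, ← Real.rpow_mul (by positivity)]
    congr 1 <;> ring
  rw [e, ← mul_pow]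
  gcongr
  rw [inv_mul_le_iff₀ (by positivity)]
  have : √(4 * Real.pi) ≤ √(2 * Real.pi) * √4 := by
    rw [← Real.sqrt_mul (by positivity)]; apply Real.sqrt_le_sqrt; nlinarith [Real.pi_pos]
  have h4 : √(4:ℝ) = 2 := by rw [show (4:ℝ) = 2 ^ 2 by norm_num]; simp
  rw [h4] at this; exact this

lemma gam_neg (f : V → ℝ) : ∫ y, f (-y) ∂(gam V) = ∫ y, f y ∂(gam V) := by
  rw [gam_integral, gam_integral, ← integral_neg_eq_self]
  simp [gd]
end gen

section marg
variable {n : ℕ}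

lemma gd_WW (z : WW n) : gd z = gd z.fst * gp z.snd := by
  unfold gd gp
  rw [WW_finrank, WithLp.prod_norm_sq_eq_of_L2, finrank_euclideanSpace, Fintype.card_fin]
  rw [show -(‖z.fst‖ ^ 2 + ‖z.snd‖ ^ 2) / 2 = -‖z.fst‖ ^ 2 / 2 + -z.snd ^ 2 / 2 by
    rw [Real.norm_eq_abs, sq_abs]; ring, Real.exp_add]
  ring

lemma gam_marg (h : EE n → ℝ) : ∫ z, h z.fst ∂(gam (WW n)) = ∫ x, h x ∂(gam (EE n)) := by
  rw [gam_integral, gam_integral]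
  simp_rw [gd_WW]
  have e := (WithLp.volume_preserving_ofLp (EE n) ℝ).integral_comp
    (MeasurableEquiv.toLp 2 (EE n × ℝ)).symm.measurableEmbedding
    (fun p : EE n × ℝ => (gd p.1 * h p.1) * gp p.2)
  rw [show (∫ x, gd x * h x) = (∫ x, gd x * h x) * ∫ t, gp t by rw [gp_integral, mul_one],
    ← integral_prod_mul, ← Measure.volume_eq_prod, ← e]
  congr 1
  ext z
  change gd z.fst * gp z.snd * h z.fst = gd z.fst * h z.fst * gp z.snd
  ring

lemma fst_norm_le (z : WW n) : ‖z.fst‖ ≤ ‖z‖ := by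
  have := WithLp.prod_norm_sq_eq_of_L2 z
  refine le_of_sq_le_sq ?_ (norm_nonneg _)
  nlinarith [sq_nonneg ‖z.snd‖]

lemma snd_norm_le (z : WW n) : ‖z.snd‖ ≤ ‖z‖ := by
  have := WithLp.prod_norm_sq_eq_of_L2 z
  refine le_of_sq_le_sq ?_ (norm_nonneg _)
  nlinarith [sq_nonneg ‖z.fst‖]

lemma fst_cont : Continuous (fun z : WW n => z.fst) := by fun_prop
lemma snd_cont : Continuous (fun z : WW n => z.snd) := by fun_prop

lemma gam_simplex {w : Fin (n + 1) → EE n} (hn : 1 ≤ n) (hw : IsRegVerts w) (b : ℝ) :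
    (gam (WW n)).real {z | ∀ a, ⟪lft (w a), z⟫ ≤ b} = Ph b ^ (n + 1) := by
  set B := regBasis hn hw
  have hr : ∀ z a, B.repr z a = ⟪lft (w a), z⟫ := fun z a => by
    rw [B.repr_apply_apply, regBasis_apply]
  have hms : MeasurableSet {z : WW n | ∀ a, ⟪lft (w a), z⟫ ≤ b} := by
    have : IsClosed {z : WW n | ∀ a, ⟪lft (w a), z⟫ ≤ b} := by
      rw [show {z : WW n | ∀ a, ⟪lft (w a), z⟫ ≤ b} = ⋂ a, {z : WW n | ⟪lft (w a), z⟫ ≤ b} by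
        ext; simp]
      exact isClosed_iInter fun a => isClosed_le (by fun_prop) continuous_const
    exact this.measurableSet
  rw [← integral_indicator_one hms, gam_integral]
  set g : ℝ → ℝ := (Iic b).indicator gp
  have h1 : ∀ z : WW n, gd z * {z : WW n | ∀ a, ⟪lft (w a), z⟫ ≤ b}.indicator 1 z
      = ∏ a, g (WithLp.ofLp (B.repr z) a) := by
    intro z
    have hg : gd z = ∏ a, gp (B.repr z a) := by
      unfold gd gp
      rw [WW_finrank, Finset.prod_mul_distrib, ← Real.exp_sum, ← B.repr.norm_map z, EuclideanSpace.norm_sq_eq]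
      simp [neg_div, Finset.sum_div]
    by_cases hz : ∀ a, ⟪lft (w a), z⟫ ≤ b
    · rw [indicator_of_mem (show z ∈ {z : WW n | ∀ a, ⟪lft (w a), z⟫ ≤ b} from hz), hg, Pi.one_apply, mul_one]
      refine Finset.prod_congr rfl fun a _ => ?_
      simp only [g]
      rw [indicator_of_mem]
      rw [mem_Iic, hr]; exact hz a
    · rw [indicator_of_notMem (show z ∉ {z : WW n | ∀ a, ⟪lft (w a), z⟫ ≤ b} from hz), mul_zero]
      push Not at hz
      obtain ⟨a, ha⟩ := hz
      symm
      refine Finset.prod_eq_zero (Finset.mem_univ a) ?_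
      simp only [g]
      rw [indicator_of_notMem]
      rw [mem_Iic, hr, not_le]; exact ha
  simp_rw [h1]
  have e1 := B.measurePreserving_repr.integral_comp B.repr.toHomeomorph.measurableEmbedding
    (fun y : EuclideanSpace ℝ (Fin (n+1)) => ∏ a, g (WithLp.ofLp y a))
  rw [e1]
  have e2 := (PiLp.volume_preserving_ofLp (Fin (n+1))).integral_comp
    (MeasurableEquiv.toLp 2 (Fin (n+1) → ℝ)).symm.measurableEmbedding
    (fun y : Fin (n+1) → ℝ => ∏ a, g (y a))
  rw [e2, integral_fintype_prod_volume_eq_pow, Fintype.card_fin, integral_indicator measurableSet_Iic]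
  rfl
end marg
end Part9

section Part10

section ell
variable {n : ℕ}

lemma ball_absorbent (hn : 1 ≤ n) {K : Set (EE n)} (hb : closedBall 0 (1 / (n:ℝ)) ⊆ K) : K ∈ nhds (0 : EE n) :=
  have hn0 : (0:ℝ) < n := by exact_mod_cast hn
  Filter.mem_of_superset (closedBall_mem_nhds 0 (by positivity)) hb

lemma gauge_le_norm (hn : 1 ≤ n) {K : Set (EE n)} (hb : closedBall 0 (1 / (n:ℝ)) ⊆ K) (x : EE n) :
    gauge K x ≤ n * ‖x‖ := by
  have hn0 : (0:ℝ) < n := by exact_mod_cast hn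
  have h1 := gauge_mono (absorbent_nhds_zero (closedBall_mem_nhds (0 : EE n) (show (0:ℝ) < 1 / n by positivity))) hb x
  rw [gauge_closedBall (by positivity)] at h1
  refine h1.trans (le_of_eq ?_)
  field_simp

lemma gauge_integrable (hn : 1 ≤ n) {K : Set (EE n)} (hK : Convex ℝ K)
    (hb : closedBall 0 (1 / (n:ℝ)) ⊆ K) : Integrable (gauge K) (gam (EE n)) := by
  refine Integrable.mono' (gam_norm_integrable.const_mul (n:ℝ))
    (continuous_gauge hK (ball_absorbent hn hb)).aestronglyMeasurable (Filter.Eventually.of_forall fun x => ?_)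
  rw [Real.norm_of_nonneg (gauge_nonneg x)]
  exact gauge_le_norm hn hb x

lemma ell_eq (K : Set (EE n)) : ellNorm n K = ∫ x, gauge K x ∂(gam (EE n)) := by
  rw [ellNorm, gaussianM_eq]

lemma ell_le (hn : 1 ≤ n) {K : Set (EE n)} (hK : Convex ℝ K)
    (hb : closedBall 0 (1 / (n:ℝ)) ⊆ K) : ellNorm n K ≤ n * 2 ^ n := by
  rw [ell_eq]
  refine (integral_mono (gauge_integrable hn hK hb) (gam_norm_integrable.const_mul (n:ℝ))
    (gauge_le_norm hn hb)).trans ?_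
  rw [integral_const_mul]
  have := gam_norm_le (V := EE n)
  rw [finrank_euclideanSpace, Fintype.card_fin] at this
  gcongr

/-- lifted gauge functional -/
def XK (K : Set (EE n)) (z : WW n) : ℝ := gauge K (-z.fst) / √(n:ℝ) + z.snd

lemma XK_cont (hn : 1 ≤ n) {K : Set (EE n)} (hK : Convex ℝ K)
    (hb : closedBall 0 (1 / (n:ℝ)) ⊆ K) : Continuous (XK K) := by
  have := continuous_gauge hK (ball_absorbent hn hb)
  unfold XK
  exact ((this.comp fst_cont.neg).div_const _).add snd_cont

lemma XK_int (hn : 1 ≤ n) {K : Set (EE n)} (hK : Convex ℝ K)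
    (hb : closedBall 0 (1 / (n:ℝ)) ⊆ K) : Integrable (XK K) (gam (WW n)) ∧
    ∫ z, XK K z ∂(gam (WW n)) = ellNorm n K / √(n:ℝ) + ∫ z, z.snd ∂(gam (WW n)) := by
  have h1 : Integrable (fun z : WW n => gauge K (-z.fst)) (gam (WW n)) := by
    refine Integrable.mono' (gam_norm_integrable.const_mul (n:ℝ))
      ((continuous_gauge hK (ball_absorbent hn hb)).comp fst_cont.neg).aestronglyMeasurable
      (Filter.Eventually.of_forall fun x => ?_)
    rw [Real.norm_of_nonneg (gauge_nonneg _)]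
    refine (gauge_le_norm hn hb _).trans ?_
    rw [norm_neg]
    gcongr
    exact fst_norm_le x
  have h2 : Integrable (fun z : WW n => z.snd) (gam (WW n)) :=
    Integrable.mono' gam_norm_integrable snd_cont.aestronglyMeasurable
      (Filter.Eventually.of_forall snd_norm_le)
  refine ⟨(h1.div_const _).add h2, ?_⟩
  unfold XK
  rw [integral_add (h1.div_const _) h2, integral_div, gam_marg (fun x => gauge K (-x)), gam_neg, ell_eq]

lemma XK_simplex (hn : 1 ≤ n) {w : Fin (n + 1) → EE n} (hw : IsRegVerts w) (β : ℝ) :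
    {z : WW n | XK (convexHull ℝ (range w)) z ≤ β} = {z | ∀ a, ⟪lft (w a), z⟫ ≤ β / √((n:ℝ) + 1)} := by
  have hn0 : (0:ℝ) < n := by exact_mod_cast hn
  have hs : 0 < √(n:ℝ) := Real.sqrt_pos.2 hn0
  have hs2 : √(n:ℝ) * √(n:ℝ) = n := Real.mul_self_sqrt hn0.le
  ext z
  simp only [mem_ofPred_eq, XK]
  rw [← le_sub_iff_add_le, div_le_iff₀ hs, reg_gauge_le hn hw]
  refine forall_congr' fun a => ?_
  rw [neg_neg, lft_inner' hn, div_le_div_iff_of_pos_right (by positivity), ← le_sub_iff_add_le,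
    show (n:ℝ) * ⟪w a, z.fst⟫ = √(n:ℝ) * (√(n:ℝ) * ⟪w a, z.fst⟫) by rw [← mul_assoc, hs2],
    mul_comm _ (√(n:ℝ)), mul_le_mul_iff_right₀ hs]

/-- the deficit constant -/
def Dc (m : ℕ) : ℝ := 1/640000 * (1 / 6400 * ((1/160) / (m:ℝ)) ^ m)

lemma ell_gap (hn : 1 ≤ n) {K : Set (EE n)} (hK : Convex ℝ K)
    {ι : Type} [Fintype ι] {c : ι → ℝ} {u : ι → EE n} (hc0 : ∀ i, 0 ≤ c i)
    (hc1 : ∑ i, c i = 1) (huK : ∀ i, u i ∈ K) (hu : ∀ i, ‖u i‖ = 1) (hcu : ∑ i, c i • u i = 0)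
    (hF : ∀ x, ∑ i, (c i * ⟪u i, x⟫) • u i = (1 / (n:ℝ)) • x)
    {w : Fin (n + 1) → EE n} (hw : IsRegVerts w) (η : ℝ)
    (hη : η = ∑ i, ∑ j, (((n:ℝ) + 1) * c i) * (((n:ℝ) + 1) * c j) * (⟪lft (u i), lft (u j)⟫ ^ 2 *
      (1 - ⟪lft (u i), lft (u j)⟫))) (hη0 : 0 ≤ η) :
    0.3 ^ (n + 1) * (Dc (n + 1) * η) * (√((n:ℝ) + 1) / 2) ≤
      (ellNorm n (convexHull ℝ (range w)) - ellNorm n K) / √(n:ℝ) := by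
  have hb := john_gauge_le hn hK hc0 hc1 hcu hu huK hF
  have hbw := reg_ball hn hw
  have hKa : Absorbent ℝ K := absorbent_nhds_zero (ball_absorbent hn hb)
  have hD := convex_convexHull ℝ (range w)
  have hs : 0 < √((n:ℝ) + 1) := by positivity
  have hd : ∀ i, 0 ≤ ((n:ℝ) + 1) * c i := fun i => mul_nonneg (by positivity) (hc0 i)
  have hv : ∀ i, ‖lft (u i)‖ = 1 := fun i => lft_norm hn _ (hu i)
  have hFl := lft_frame hn hc1 hcu hF
  have hA : ∀ β, ∀ y, tmap (fun i => ((n:ℝ) + 1) * c i) (fun i => lft (u i)) (β / √((n:ℝ) + 1)) y ∈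
      {z : WW n | XK K z ≤ β} := by
    intro β y
    have := tmap_mem hn hK hKa hc0 hc1 hcu huK hF (β / √((n:ℝ) + 1)) y
    rw [mul_div_cancel₀ _ hs.ne'] at this
    exact this
  have key := cdf_gap (gam (WW n)) (X := XK K) (Y := XK (convexHull ℝ (range w)))
    (XK_cont hn hK hb).measurable (XK_cont hn hD hbw).measurable (XK_int hn hK hb).1
    (XK_int hn hD hbw).1 (0.3 ^ (n + 1) * (Dc (n + 1) * η)) (-(√((n:ℝ) + 1) / 2)) 0
    (by linarith) (fun β => ?_) (fun β hβ => ?_)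
  · rw [(XK_int hn hK hb).2, (XK_int hn hD hbw).2] at key
    have e : ∀ a b s t : ℝ, (a / s + t) - (b / s + t) = (a - b) / s := fun a b s t => by ring
    rw [e] at key
    linarith
  · rw [XK_simplex hn hw, gam_simplex hn hw]
    exact transport_zero (WW_finrank n) hd hFl hv _ _ (hA β)
  · rw [XK_simplex hn hw, gam_simplex hn hw]
    have hb1 : -1/2 ≤ β / √((n:ℝ) + 1) := by rw [le_div_iff₀ hs]; linarith [hβ.1]
    have hb2 : β / √((n:ℝ) + 1) ≤ 0 := div_nonpos_of_nonpos_of_nonneg hβ.2 hs.le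
    have h1 := transport_gain (WW_finrank n) (by omega) hd hFl hv _ hb1 hb2 _ (hA β)
    rw [← hη] at h1
    have h2 := (loc_bounds (s := 0) hb1 hb2 (by norm_num)).1
    have h3 : (0.3:ℝ) ^ (n+1) ≤ Ph (β / √((n:ℝ) + 1)) ^ (n+1) := by gcongr
    have h4 : 0 ≤ Dc (n+1) * η := mul_nonneg (by unfold Dc; positivity) hη0
    have h5 : (1:ℝ)/640000 * (η * (1 / 6400 * (1 / 160 / ((n+1:ℕ):ℝ)) ^ (n+1))) = Dc (n+1) * η := by
      unfold Dc; ring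
    rw [h5] at h1
    nlinarith [mul_le_mul_of_nonneg_right h3 h4]
end ell
end Part10

section Part11

section near
variable {n : ℕ}

/-- the linear map sending the lifted simplex to the lifts of `u` -/
def Lh (w u : Fin (n + 1) → EE n) : WW n →ₗ[ℝ] WW n :=
  ∑ a, (innerₛₗ ℝ (lft (w a))).smulRight (lft (u a))

lemma Lh_apply (w u : Fin (n + 1) → EE n) (z : WW n) :
    Lh w u z = ∑ a, ⟪lft (w a), z⟫ • lft (u a) := by
  simp [Lh]

lemma Lh_basis (hn : 1 ≤ n) {w : Fin (n + 1) → EE n} (hw : IsRegVerts w) (u : Fin (n + 1) → EE n)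
    (a : Fin (n + 1)) : Lh w u (lft (w a)) = lft (u a) := by
  rw [Lh_apply, Finset.sum_eq_single a]
  · rw [real_inner_self_eq_norm_sq, lft_norm hn _ (hw.1 a)]; simp
  · intro b _ hb
    rw [(reg_ortho hn hw).2 hb, zero_smul]
  · simp

lemma Lh_snd (hn : 1 ≤ n) {w : Fin (n + 1) → EE n} (hw : IsRegVerts w) (u : Fin (n + 1) → EE n)
    (z : WW n) : (Lh w u z).snd = z.snd := by
  conv_rhs => rw [← (regBasis hn hw).sum_repr' z]
  rw [Lh_apply, WW_snd_sum, WW_snd_sum]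
  refine Finset.sum_congr rfl fun a _ => ?_
  rw [regBasis_apply, WithLp.smul_snd, WithLp.smul_snd, lft_snd, lft_snd]

lemma Lh_norm (hn : 1 ≤ n) {w : Fin (n + 1) → EE n} (hw : IsRegVerts w) {u : Fin (n + 1) → EE n}
    (hu : ∀ a, ‖u a‖ = 1) {q : ℝ} (hq0 : 0 ≤ q)
    (hQ : ∑ a, ∑ b, (if a = b then 0 else ⟪lft (u a), lft (u b)⟫ ^ 2) ≤ q ^ 2) (z : WW n) :
    |‖Lh w u z‖ ^ 2 - ‖z‖ ^ 2| ≤ q * ‖z‖ ^ 2 := by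
  set ζ : Fin (n+1) → ℝ := fun a => ⟪lft (w a), z⟫ with hζ
  set e : Fin (n+1) → Fin (n+1) → ℝ := fun a b => if a = b then 0 else ⟪lft (u a), lft (u b)⟫ with he
  have h1 : ∑ a, ζ a ^ 2 = ‖z‖ ^ 2 := by
    have := (regBasis hn hw).sum_sq_norm_inner_right z
    rw [← this]
    refine Finset.sum_congr rfl fun a _ => ?_
    rw [regBasis_apply, Real.norm_eq_abs, sq_abs]
  have h2 : ‖Lh w u z‖ ^ 2 - ‖z‖ ^ 2 = ∑ a, ∑ b, (ζ a * ζ b) * e a b := by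
    rw [← real_inner_self_eq_norm_sq, Lh_apply, sum_inner, ← h1, ← Finset.sum_sub_distrib]
    refine Finset.sum_congr rfl fun a _ => ?_
    rw [inner_sum]
    have h3 : ζ a ^ 2 = ∑ b, if a = b then ζ a * ζ b else 0 := by simp [sq]
    rw [h3, ← Finset.sum_sub_distrib]
    refine Finset.sum_congr rfl fun b _ => ?_
    rw [inner_smul_left, inner_smul_right]
    simp only [he, RCLike.conj_to_real]
    split_ifs with hab
    · subst hab
      rw [real_inner_self_eq_norm_sq, lft_norm hn _ (hu a)]
      simp only [hζ]; ring
    · simp only [hζ]; ring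
  have h4 : (∑ a, ∑ b, (ζ a * ζ b) * e a b) ^ 2 ≤ (q * ‖z‖ ^ 2) ^ 2 := by
    have cs := Finset.sum_mul_sq_le_sq_mul_sq (Finset.univ : Finset (Fin (n+1) × Fin (n+1)))
      (fun p => ζ p.1 * ζ p.2) (fun p => e p.1 p.2)
    simp only [Fintype.sum_prod_type] at cs
    refine cs.trans ?_
    have h5 : ∑ a, ∑ b, (ζ a * ζ b) ^ 2 = (‖z‖ ^ 2) ^ 2 := by
      rw [← h1, sq (∑ a, ζ a ^ 2), Finset.sum_mul_sum]
      refine Finset.sum_congr rfl fun a _ => Finset.sum_congr rfl fun b _ => by ring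
    have h6 : ∑ a, ∑ b, e a b ^ 2 ≤ q ^ 2 := by
      refine le_trans (le_of_eq ?_) hQ
      refine Finset.sum_congr rfl fun a _ => Finset.sum_congr rfl fun b _ => ?_
      simp only [he]; split_ifs <;> simp
    rw [h5, mul_pow, mul_comm]
    gcongr
  rw [h2]
  exact abs_le_of_sq_le_sq h4 (by positivity)

lemma near_reg (hn : 1 ≤ n) {w : Fin (n + 1) → EE n} (hw : IsRegVerts w) {u : Fin (n + 1) → EE n}
    (hu : ∀ a, ‖u a‖ = 1) {q : ℝ} (hq0 : 0 ≤ q) (hq1 : q < 1)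
    (hQ : ∑ a, ∑ b, (if a = b then 0 else ⟪lft (u a), lft (u b)⟫ ^ 2) ≤ q ^ 2) :
    ∃ T : EE n ≃ₗᵢ[ℝ] EE n, ∀ a, ‖u a - T (w a)‖ ≤ 3 * q := by
  have hn0 : (0:ℝ) < n := by exact_mod_cast hn
  have hN := Lh_norm hn hw hu hq0 hQ
  obtain ⟨Th, hTh⟩ := polar_near (Lh w u) q hq1 hN
  set e : WW n := WithLp.toLp 2 ((0 : EE n), (1:ℝ)) with he
  have hef : e.fst = 0 := rfl
  have hes : e.snd = 1 := rfl
  have hen : ‖e‖ = 1 := by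
    have := WithLp.prod_norm_sq_eq_of_L2 e
    rw [hef, hes] at this
    simp at this
    have h0 := norm_nonneg e
    rcases this with h | h
    · exact h
    · linarith
  have hei : ∀ z : WW n, ⟪e, z⟫ = z.snd := fun z => by
    rw [WithLp.prod_inner_apply]
    change ⟪(0 : EE n), _⟫ + ⟪(1:ℝ), z.snd⟫ = _
    simp
  have h1 : ‖e - Th.symm e‖ ≤ q := by
    set z := e - Th.symm e with hz
    have a1 : ⟪e, Lh w u z⟫ = ⟪e, z⟫ := by rw [hei, hei, Lh_snd hn hw]
    have a2 : ⟪e, Th z⟫ = ⟪Th.symm e, z⟫ := by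
      rw [← Th.inner_map_map (Th.symm e) z, Th.apply_symm_apply]
    have a3 : ‖z‖ ^ 2 = ⟪e, Lh w u z - Th z⟫ := by
      rw [inner_sub_right, a1, a2, ← inner_sub_left, ← hz, real_inner_self_eq_norm_sq]
    have a4 := (abs_le.1 (abs_real_inner_le_norm e (Lh w u z - Th z))).2
    rw [hen, one_mul] at a4
    have a5 := hTh z
    rcases (norm_nonneg z).eq_or_lt with h | h
    · rw [← h]; exact hq0
    · nlinarith
  have h2 : ‖Th e - e‖ ≤ q := by
    have : Th e - e = Th (e - Th.symm e) := by rw [map_sub, Th.apply_symm_apply]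
    rw [this, Th.norm_map]; exact h1
  have h3 : ‖Lh w u e - e‖ ≤ 2 * q := by
    have a5 := hTh e
    rw [hen] at a5
    calc ‖Lh w u e - e‖ = ‖(Lh w u e - Th e) + (Th e - e)‖ := by congr 1; abel
      _ ≤ _ := norm_add_le _ _
      _ ≤ 2 * q := by linarith
  have h4 : ‖(Lh w u e).fst‖ ≤ 2 * q := by
    refine le_trans ?_ h3
    have := fst_norm_le (Lh w u e - e)
    rwa [WithLp.sub_fst, hef, sub_zero] at this
  -- the restricted map
  set inl : EE n →ₗ[ℝ] WW n := (WithLp.linearEquiv 2 ℝ (EE n × ℝ)).symm.toLinearMap ∘ₗ LinearMap.inl ℝ (EE n) ℝ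
  set prf : WW n →ₗ[ℝ] EE n := LinearMap.fst ℝ (EE n) ℝ ∘ₗ (WithLp.linearEquiv 2 ℝ (EE n × ℝ)).toLinearMap
  have hinl : ∀ x, inl x = WithLp.toLp 2 (x, (0:ℝ)) := fun x => rfl
  have hprf : ∀ z, prf z = z.fst := fun x => rfl
  have hL : ∀ x, |‖(prf ∘ₗ Lh w u ∘ₗ inl) x‖ ^ 2 - ‖x‖ ^ 2| ≤ q * ‖x‖ ^ 2 := by
    intro x
    have b1 : ‖inl x‖ ^ 2 = ‖x‖ ^ 2 := by
      have := WithLp.prod_norm_sq_eq_of_L2 (inl x)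
      rw [this, hinl]
      change ‖x‖ ^ 2 + ‖(0:ℝ)‖ ^ 2 = _
      simp
    have b2 : ‖Lh w u (inl x)‖ ^ 2 = ‖(prf ∘ₗ Lh w u ∘ₗ inl) x‖ ^ 2 := by
      rw [WithLp.prod_norm_sq_eq_of_L2, Lh_snd hn hw]
      change ‖prf (Lh w u (inl x))‖ ^ 2 + ‖(0:ℝ)‖ ^ 2 = _
      simp
    have := hN (inl x)
    rwa [b1, b2] at this
  obtain ⟨T, hT⟩ := polar_near _ q hq1 hL
  refine ⟨T, fun a => ?_⟩
  have c1 := hT (w a)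
  rw [hw.1 a, mul_one] at c1
  have hτ : 0 < √((n:ℝ) / (n + 1)) := Real.sqrt_pos.2 (by positivity)
  have c2 : inl (w a) = (√((n:ℝ) / (n + 1)))⁻¹ • lft (w a) - (√(n:ℝ))⁻¹ • e := by
    rw [lft, smul_smul, inv_mul_cancel₀ hτ.ne', one_smul, hinl, he]
    apply WW_ext
    · change w a = w a - (√(n:ℝ))⁻¹ • (0 : EE n)
      simp
    · change (0:ℝ) = (√(n:ℝ))⁻¹ - (√(n:ℝ))⁻¹ • (1:ℝ)
      simp
  have c3 : (prf ∘ₗ Lh w u ∘ₗ inl) (w a) = u a - (√(n:ℝ))⁻¹ • (Lh w u e).fst := by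
    change prf (Lh w u (inl (w a))) = _
    rw [c2, map_sub, map_smul, map_smul, map_sub, map_smul, map_smul,
      Lh_basis hn hw, hprf, hprf, lft_fst, smul_smul, inv_mul_cancel₀ hτ.ne', one_smul]
  have c4 : ‖(√(n:ℝ))⁻¹ • (Lh w u e).fst‖ ≤ 2 * q := by
    rw [norm_smul, norm_inv, Real.norm_of_nonneg (Real.sqrt_nonneg _)]
    refine le_trans ?_ h4
    refine mul_le_of_le_one_left (norm_nonneg _) (inv_le_one_of_one_le₀ ?_)
    rw [Real.one_le_sqrt]; exact_mod_cast hn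
  rw [c3] at c1
  calc ‖u a - T (w a)‖ = ‖(u a - (√(n:ℝ))⁻¹ • (Lh w u e).fst - T (w a)) + (√(n:ℝ))⁻¹ • (Lh w u e).fst‖ := by
        congr 1; abel
    _ ≤ _ := norm_add_le _ _
    _ ≤ 3 * q := by linarith
end near
end Part11

section Part12

section fin
variable {n : ℕ}

lemma ell_reg_le (hn : 1 ≤ n) {w w' : Fin (n + 1) → EE n} (hw : IsRegVerts w) (hw' : IsRegVerts w') :
    ellNorm n (convexHull ℝ (range w)) ≤ ellNorm n (convexHull ℝ (range w')) := by
  have hn0 : (0:ℝ) < n := by exact_mod_cast hn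
  have hs : 0 < √(n:ℝ) := Real.sqrt_pos.2 hn0
  have hD := convex_convexHull ℝ (range w)
  have hD' := convex_convexHull ℝ (range w')
  have hb := reg_ball hn hw
  have hb' := reg_ball hn hw'
  have key := cdf_gap (gam (WW n)) (XK_cont hn hD hb).measurable (XK_cont hn hD' hb').measurable
    (XK_int hn hD hb).1 (XK_int hn hD' hb').1 0 0 0 le_rfl
    (fun β => by rw [XK_simplex hn hw, XK_simplex hn hw', gam_simplex hn hw, gam_simplex hn hw'])
    (fun β _ => by rw [XK_simplex hn hw, XK_simplex hn hw', gam_simplex hn hw, gam_simplex hn hw', sub_self])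
  rw [(XK_int hn hD hb).2, (XK_int hn hD' hb').2] at key
  have : ellNorm n (convexHull ℝ (range w)) / √(n:ℝ) ≤ ellNorm n (convexHull ℝ (range w')) / √(n:ℝ) := by
    linarith
  exact (div_le_div_iff_of_pos_right hs).1 this

lemma ell_nonneg (K : Set (EE n)) : 0 ≤ ellNorm n K := integral_nonneg fun _ => gauge_nonneg _

lemma reg_sub_ball {w : Fin (n + 1) → EE n} (hw : IsRegVerts w) :
    convexHull ℝ (range w) ⊆ closedBall 0 1 := by
  refine convexHull_min ?_ (convex_closedBall 0 1)
  rintro _ ⟨a, rfl⟩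
  rw [mem_closedBall_zero_iff, hw.1]

lemma gauge_K_le (hn : 1 ≤ n) {K : Set (EE n)} (hK : Convex ℝ K)
    (hb : closedBall 0 (1 / (n:ℝ)) ⊆ K) {w u : Fin (n + 1) → EE n} (hw : IsRegVerts w)
    (huK : ∀ a, u a ∈ K) {p : ℝ} (hp : ∀ a, ‖u a - w a‖ ≤ p) (x : EE n) :
    gauge K x ≤ (1 + n * p) * gauge (convexHull ℝ (range w)) x := by
  have hKn := ball_absorbent hn hb
  have hKa : Absorbent ℝ K := absorbent_nhds_zero hKn
  have hp0 : 0 ≤ p := (norm_nonneg _).trans (hp 0)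
  have h1 : convexHull ℝ (range w) ⊆ {x | gauge K x ≤ 1 + n * p} := by
    refine convexHull_min ?_ (hK.setOfPred_gauge_le (mem_of_mem_nhds hKn) hKa (1 + n * p))
    rintro _ ⟨a, rfl⟩
    have e : w a = u a + (w a - u a) := by abel
    simp only [mem_ofPred_eq]
    rw [e]
    refine (gauge_add_le hK hKa _ _).trans ?_
    have h2 := gauge_le_one_of_mem (huK a)
    have h3 := gauge_le_norm hn hb (w a - u a)
    have h4 : ‖w a - u a‖ ≤ p := by rw [norm_sub_rev]; exact hp a
    have : (n:ℝ) * ‖w a - u a‖ ≤ n * p := by gcongr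
    linarith
  have hab : Absorbent ℝ (convexHull ℝ (range w)) := absorbent_nhds_zero (ball_absorbent hn (reg_ball hn hw))
  have hr : 0 < 1 + n * p := by positivity
  rw [← div_le_iff₀' hr]
  refine le_of_forall_gt fun t ht => ?_
  obtain ⟨s, hs0, hst, y, hy, rfl⟩ := exists_lt_of_gauge_lt hab ht
  simp only []
  rw [gauge_smul_of_nonneg hs0.le, smul_eq_mul]
  refine lt_of_le_of_lt ?_ hst
  rw [div_le_iff₀ hr]
  have := h1 hy
  simp only [mem_ofPred_eq] at this
  gcongr

lemma kappa_bound (hn : 1 ≤ n) {K : Set (EE n)} (hK : Convex ℝ K) (hK1 : K ⊆ closedBall 0 1)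
    (hb : closedBall 0 (1 / (n:ℝ)) ⊆ K) {w u : Fin (n + 1) → EE n} (hw : IsRegVerts w)
    (huK : ∀ a, u a ∈ K) {p ε : ℝ} (hp : ∀ a, ‖u a - w a‖ ≤ p)
    (hε : 0 < ε) (hl : (1 - ε) * ellNorm n (convexHull ℝ (range w)) ≤ ellNorm n K)
    {z : EE n} (hz : z ∈ K) (i : Fin (n + 1)) :
    n * ⟪w i, -z⟫ ≤ 1 + 6 * n * (48 * n) ^ n * (n * p + ε) := by
  have hn0 : (0:ℝ) < n := by exact_mod_cast hn
  have hn1 : (1:ℝ) ≤ n := by exact_mod_cast hn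
  have hp0 : 0 ≤ p := (norm_nonneg _).trans (hp 0)
  by_contra hcon
  push Not at hcon
  set κ := n * ⟪w i, -z⟫ - 1 with hκ
  have hκ1 : 6 * n * (48 * n) ^ n * (n * p + ε) < κ := by linarith
  have hκ0 : 0 < κ := lt_trans (by positivity) hκ1
  set D := convexHull ℝ (range w) with hDdef
  set r := 1 + n * p with hr
  have hD : Convex ℝ D := convex_convexHull ℝ (range w)
  have hbD : closedBall 0 (1 / (n:ℝ)) ⊆ D := reg_ball hn hw
  have hKa : Absorbent ℝ K := absorbent_nhds_zero (ball_absorbent hn hb)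
  have hg := gauge_K_le hn hK hb hw huK hp
  have hlow : ∀ a x, n * ⟪w a, -x⟫ ≤ gauge D x := fun a x => (reg_gauge_le hn hw x _).1 le_rfl a
  set x0 : EE n := (1/3 : ℝ) • (z - w i) with hx0
  have hpt : ∀ x ∈ ball x0 (1/12), κ / 3 ≤ r * gauge D x - gauge K x := by
    intro x hx
    set y : EE n := (3:ℝ) • x - z with hy
    have hxy : x = (1/3 : ℝ) • z + (1/3 : ℝ) • y := by rw [hy, ← smul_add]; simp [smul_smul]
    set v : EE n := y + w i with hv
    have hvn : ‖v‖ < 1/4 := by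
      have : v = (3:ℝ) • (x - x0) := by
        rw [hv, hy, hx0, smul_sub, smul_smul]; norm_num; abel
      rw [this, norm_smul]
      rw [mem_ball_iff_norm] at hx
      norm_num
      linarith
    have hyi : ∀ a, ⟪w a, -y⟫ = ⟪w a, w i⟫ - ⟪w a, v⟫ := fun a => by
      rw [← inner_sub_right]; congr 1; rw [hv]; abel
    have hin : ∀ a, |⟪w a, v⟫| ≤ 1/4 := fun a => by
      refine (abs_real_inner_le_norm _ _).trans ?_
      rw [hw.1, one_mul]; exact hvn.le
    have hyg : gauge D y ≤ n * ⟪w i, -y⟫ := by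
      rw [reg_gauge_le hn hw]
      intro a
      by_cases hai : a = i
      · rw [hai]
      · gcongr
        rw [hyi, hyi, hw.2 a i hai, real_inner_self_eq_norm_sq, hw.1]
        have h1 := abs_le.1 (hin a)
        have h2 := abs_le.1 (hin i)
        have : -1 / (n:ℝ) ≤ 0 := by rw [neg_div]; linarith [show 0 < 1 / (n:ℝ) by positivity]
        linarith [h1.1, h2.2]
    have h1 : gauge K x ≤ 1/3 * gauge K z + 1/3 * gauge K y := by
      rw [hxy]
      refine (gauge_add_le hK hKa _ _).trans ?_
      rw [gauge_smul_of_nonneg (by norm_num), gauge_smul_of_nonneg (by norm_num)]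
      simp
    have h2 := gauge_le_one_of_mem hz
    have h3 := hg y
    have h4 := hlow i x
    have h5 : n * ⟪w i, -x⟫ = 1/3 * (1 + κ) + 1/3 * (n * ⟪w i, -y⟫) := by
      conv_lhs => rw [hxy]
      rw [hκ]
      simp only [inner_neg_right, inner_add_right, inner_smul_right]; ring
    have hr1 : 1 ≤ r := by rw [hr]; nlinarith
    have h6 : r * (1/3 * (1 + κ) + 1/3 * (n * ⟪w i, -y⟫)) ≤ r * gauge D x := by
      rw [← h5]; gcongr
    have h7 : r * gauge D y ≤ r * (n * ⟪w i, -y⟫) := by gcongr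
    nlinarith
  have iD := gauge_integrable hn hD hbD
  have iK := gauge_integrable hn hK hb
  have ig : Integrable (fun x => r * gauge D x - gauge K x) (gam (EE n)) := (iD.const_mul r).sub iK
  have hI : κ / 3 * (gam (EE n)).real (ball x0 (1/12)) ≤ ∫ x, (r * gauge D x - gauge K x) ∂(gam (EE n)) := by
    calc κ / 3 * (gam (EE n)).real (ball x0 (1/12)) = ∫ x in ball x0 (1/12), κ / 3 ∂(gam (EE n)) := by
          simp [mul_comm]
      _ ≤ ∫ x in ball x0 (1/12), (r * gauge D x - gauge K x) ∂(gam (EE n)) :=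
          setIntegral_mono_on (integrableOn_const (measure_ne_top _ _)) ig.integrableOn measurableSet_ball hpt
      _ ≤ _ := setIntegral_le_integral ig (Filter.Eventually.of_forall fun x => sub_nonneg.2 (hg x))
  rw [integral_sub (iD.const_mul r) iK, integral_const_mul, ← ell_eq, ← ell_eq] at hI
  have hx0n : ‖x0‖ + 1/12 ≤ 1 := by
    have : ‖z - w i‖ ≤ 2 := by
      refine (norm_sub_le _ _).trans ?_
      have := hK1 hz
      rw [mem_closedBall_zero_iff] at this
      rw [hw.1]; linarith
    rw [hx0, norm_smul]; norm_num; linarith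
  have hgb := gam_ball (V := EE n) (m := n) (by simp) hn x0 (1/12) (by norm_num) hx0n
  have hle := ell_le hn hD hbD
  have h0 := ell_nonneg D
  have h8 : r * ellNorm n D - ellNorm n K ≤ (n * p + ε) * (n * 2 ^ n) := by
    have : r * ellNorm n D - ellNorm n K ≤ (n * p + ε) * ellNorm n D := by rw [hr]; nlinarith
    refine this.trans ?_
    gcongr
  have h9 : κ / 3 * (1/2 * (1/12/(2*n)) ^ n) ≤ (n * p + ε) * (n * 2 ^ n) := by
    refine le_trans ?_ (hI.trans h8)
    gcongr
  have h10 : ((1:ℝ)/12/(2*n)) ^ n * (24 * n) ^ n = 1 := by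
    rw [← mul_pow]
    have : (1:ℝ)/12/(2*n) * (24 * n) = 1 := by field_simp; norm_num
    rw [this, one_pow]
  have h11 : (48 * (n:ℝ)) ^ n = (24 * n) ^ n * 2 ^ n := by rw [← mul_pow]; ring
  have h12 := mul_le_mul_of_nonneg_right h9 (show (0:ℝ) ≤ 6 * (24 * n) ^ n by positivity)
  have h13 : κ / 3 * (1/2 * (1/12/(2*n)) ^ n) * (6 * (24 * n) ^ n) = κ := by
    linear_combination κ * h10
  rw [h13] at h12
  rw [h11] at hκ1
  nlinarith

lemma vol_ball_le : (volume (closedBall (0 : EE n) 1)).toReal ≤ 2 ^ n := by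
  have h1 : closedBall (0 : EE n) 1 ⊆ (WithLp.ofLp : EE n → (Fin n → ℝ)) ⁻¹' (Icc (fun _ => -1) (fun _ => 1)) := by
    intro x hx
    rw [mem_closedBall_zero_iff] at hx
    have : ∀ i, |x i| ≤ 1 := fun i => by
      have := PiLp.norm_apply_le x i
      rw [Real.norm_eq_abs] at this; linarith
    exact ⟨fun i => (abs_le.1 (this i)).1, fun i => (abs_le.1 (this i)).2⟩
  have h2 := measure_mono (μ := volume) h1
  rw [(PiLp.volume_preserving_ofLp (Fin n)).measure_preimage measurableSet_Icc.nullMeasurableSet,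
    Real.volume_Icc_pi] at h2
  have h3 : (∏ i : Fin n, ENNReal.ofReal ((1:ℝ) - (-1))) = ENNReal.ofReal (2 ^ n) := by
    rw [Finset.prod_const, ENNReal.ofReal_pow (by norm_num)]; norm_num
  rw [h3] at h2
  exact ENNReal.toReal_le_of_le_ofReal (by positivity) h2

lemma pow_conv {κ : ℝ} (h0 : 0 ≤ κ) (h1 : κ ≤ 1) (k : ℕ) : (1 + κ) ^ k - 1 ≤ κ * 2 ^ k := by
  induction k with
  | zero => simp [h0]
  | succ k ih =>
    have : (1 + κ) ^ k ≤ 2 ^ k := by gcongr; linarith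
    rw [pow_succ, pow_succ]; nlinarith

open Pointwise in
lemma vol_diff {A B : Set (EE n)} (hA : A ⊆ closedBall 0 1) (hBc : IsClosed B)
    (hBconv : Convex ℝ B) (hB : B ⊆ closedBall 0 1) (hB0 : B ∈ nhds (0 : EE n)) {κ : ℝ}
    (h0 : 0 ≤ κ) (h1 : κ ≤ 1) (hAB : ∀ x ∈ A, gauge B x ≤ 1 + κ) :
    (volume (A \ B)).toReal ≤ 4 ^ n * κ ∧ ∀ x ∈ A, ∃ y ∈ B, dist x y ≤ κ := by
  have hsc : ∀ x ∈ A, (1 + κ)⁻¹ • x ∈ B := by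
    intro x hx
    have : gauge B ((1 + κ)⁻¹ • x) ≤ 1 := by
      rw [gauge_smul_of_nonneg (by positivity), smul_eq_mul, inv_mul_le_iff₀ (by positivity), mul_one]
      exact hAB x hx
    have hmem := (gauge_le_one_iff_mem_closure hBconv hB0).1 this
    rwa [hBc.closure_eq] at hmem
  constructor
  · have hBvol : volume B ≠ ∞ :=
      ne_top_of_le_ne_top (isCompact_closedBall (0 : EE n) 1).measure_lt_top.ne (measure_mono hB)
    have hBsub : B ⊆ (1 + κ) • B := by
      intro x hx
      rw [mem_smul_set_iff_inv_smul_mem₀ (by positivity)]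
      exact hBconv.smul_mem_of_zero_mem (mem_of_mem_nhds hB0) hx ⟨by positivity, inv_le_one_of_one_le₀ (by linarith)⟩
    have hsub : A \ B ⊆ ((1 + κ) • B) \ B := by
      refine sdiff_subset_sdiff_left fun x hx => ?_
      rw [mem_smul_set_iff_inv_smul_mem₀ (by positivity)]
      exact hsc x hx
    have hv : volume ((1 + κ) • B) = ENNReal.ofReal ((1 + κ) ^ n) * volume B := by
      rw [Measure.addHaar_smul_of_nonneg _ (by positivity)]; simp
    have hvt : volume ((1 + κ) • B) ≠ ∞ := by
      rw [hv]; exact ENNReal.mul_ne_top ENNReal.ofReal_ne_top hBvol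
    calc (volume (A \ B)).toReal ≤ (volume (((1 + κ) • B) \ B)).toReal :=
          ENNReal.toReal_mono (ne_top_of_le_ne_top hvt (measure_mono sdiff_subset)) (measure_mono hsub)
      _ = (volume ((1 + κ) • B)).toReal - (volume B).toReal := by
          rw [measure_sdiff hBsub hBc.measurableSet.nullMeasurableSet hBvol,
            ENNReal.toReal_sub_of_le (measure_mono hBsub) hvt]
      _ = ((1 + κ) ^ n - 1) * (volume B).toReal := by
          rw [hv, ENNReal.toReal_mul, ENNReal.toReal_ofReal (by positivity)]; ring
      _ ≤ (κ * 2 ^ n) * 2 ^ n := by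
          have := pow_conv h0 h1 n
          gcongr
          exact (ENNReal.toReal_mono (isCompact_closedBall (0 : EE n) 1).measure_lt_top.ne
            (measure_mono hB)).trans vol_ball_le
      _ = 4 ^ n * κ := by
          rw [show (4:ℝ) = 2 * 2 by norm_num, mul_pow]; ring
  · intro x hx
    refine ⟨_, hsc x hx, ?_⟩
    have hxn := hA hx
    rw [mem_closedBall_zero_iff] at hxn
    have e : x - (1 + κ)⁻¹ • x = (κ * (1 + κ)⁻¹) • x := by
      rw [show κ * (1 + κ)⁻¹ = 1 - (1 + κ)⁻¹ by field_simp; ring, sub_smul, one_smul]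
    rw [dist_eq_norm, e, norm_smul, Real.norm_of_nonneg (by positivity)]
    have h2 : (1 + κ)⁻¹ ≤ 1 := inv_le_one_of_one_le₀ (by linarith)
    have h3 : κ * (1 + κ)⁻¹ ≤ κ := mul_le_of_le_one_right h0 h2
    have h4 : 0 ≤ κ * (1 + κ)⁻¹ := by positivity
    nlinarith [norm_nonneg x]
end fin
end Part12

section Part13

lemma const1 {n : ℕ} (hn : 2 ≤ n) :
    2 * ((n + 1 : ℕ) : ℝ) ^ (2 * (n + 1) + 2) * (2 * n * 2 ^ n) ≤
      (n:ℝ) ^ (45 * n) * (0.3 ^ (n + 1) * Dc (n + 1)) := by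
  have hx : (2:ℝ) ≤ n := by exact_mod_cast hn
  have h1x : (1:ℝ) ≤ n := by linarith
  have hm : ((n + 1 : ℕ) : ℝ) ≤ (n:ℝ) ^ 2 := by push_cast; nlinarith
  have hm0 : (0:ℝ) < ((n + 1 : ℕ) : ℝ) := by positivity
  have a1 : 2 * ((n + 1 : ℕ) : ℝ) ^ (2 * (n + 1) + 2) * (2 * n * 2 ^ n) ≤ (n:ℝ) ^ (11 * n) := by
    calc 2 * ((n + 1 : ℕ) : ℝ) ^ (2 * (n + 1) + 2) * (2 * n * 2 ^ n)
        ≤ n * ((n:ℝ) ^ 2) ^ (2 * (n + 1) + 2) * (n * n * n ^ n) := by gcongr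
      _ = (n:ℝ) ^ (3 + n + 2 * (2 * (n + 1) + 2)) := by rw [pow_add, pow_add, pow_mul]; ring
      _ ≤ _ := pow_le_pow_right₀ h1x (by omega)
  have a2 : 1 ≤ (n:ℝ) ^ (3 * n) * 0.3 ^ (n + 1) := by
    calc (1:ℝ) ≤ (4 * 0.3) ^ (n + 1) := one_le_pow₀ (by norm_num)
      _ = 4 ^ (n + 1) * 0.3 ^ (n + 1) := mul_pow _ _ _
      _ ≤ ((n:ℝ) ^ 2) ^ (n + 1) * 0.3 ^ (n + 1) := by gcongr; nlinarith
      _ ≤ _ := by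
        gcongr
        rw [← pow_mul]
        exact pow_le_pow_right₀ h1x (by omega)
  have a3 : 1 ≤ (n:ℝ) ^ (16 * n) * (1/640000 * (1/6400)) := by
    have : (2:ℝ) ^ 32 ≤ (n:ℝ) ^ (16 * n) :=
      calc (2:ℝ) ^ 32 ≤ (n:ℝ) ^ 32 := by gcongr
        _ ≤ _ := pow_le_pow_right₀ h1x (by omega)
    norm_num at this ⊢
    linarith
  have a4 : 1 ≤ (n:ℝ) ^ (15 * n) * ((1/160) / ((n + 1 : ℕ) : ℝ)) ^ (n + 1) := by
    have h8 : (2:ℝ) ^ 8 ≤ (n:ℝ) ^ 8 := by gcongr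
    have : 1 ≤ (n:ℝ) ^ 10 * ((1/160) / ((n + 1 : ℕ) : ℝ)) := by
      rw [mul_div_assoc', le_div_iff₀ hm0, show (n:ℝ) ^ 10 = n ^ 8 * n ^ 2 by ring]
      norm_num at h8
      nlinarith [sq_nonneg (n:ℝ)]
    calc (1:ℝ) ≤ ((n:ℝ) ^ 10 * ((1/160) / ((n + 1 : ℕ) : ℝ))) ^ (n + 1) := one_le_pow₀ this
      _ = (n:ℝ) ^ (10 * (n + 1)) * ((1/160) / ((n + 1 : ℕ) : ℝ)) ^ (n + 1) := by rw [mul_pow, ← pow_mul]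
      _ ≤ _ := mul_le_mul_of_nonneg_right (pow_le_pow_right₀ h1x (by omega)) (by positivity)
  refine a1.trans ?_
  have e : (n:ℝ) ^ (45 * n) * (0.3 ^ (n + 1) * Dc (n + 1)) = (n:ℝ) ^ (11 * n) *
      (((n:ℝ) ^ (3 * n) * 0.3 ^ (n + 1)) * ((n:ℝ) ^ (16 * n) * (1/640000 * (1/6400))) *
      ((n:ℝ) ^ (15 * n) * ((1/160) / ((n + 1 : ℕ) : ℝ)) ^ (n + 1))) := by
    rw [show 45 * n = 11 * n + 3 * n + 16 * n + 15 * n by ring, pow_add, pow_add, pow_add, Dc]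
    ring
  rw [e]
  refine le_mul_of_one_le_right (by positivity) ?_
  exact one_le_mul_of_one_le_of_one_le (one_le_mul_of_one_le_of_one_le a2 a3) a4

lemma const2 {n : ℕ} (hn : 2 ≤ n) {t ε : ℝ} (ht : 0 < t) (hε0 : 0 ≤ ε) (hε : ε ≤ t) :
    6 * n * (48 * n) ^ n * (n * (3 * ((n:ℝ) ^ (23 * n) * t)) + ε) * (2 * 4 ^ n) ≤ (n:ℝ) ^ (37 * n) * t := by
  have hx : (2:ℝ) ≤ n := by exact_mod_cast hn
  have h1x : (1:ℝ) ≤ n := by linarith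
  have hN : (1:ℝ) ≤ (n:ℝ) ^ (23 * n) := one_le_pow₀ h1x
  have b1 : n * (3 * ((n:ℝ) ^ (23 * n) * t)) + ε ≤ n ^ 3 * ((n:ℝ) ^ (23 * n) * t) := by
    have h0 : t ≤ (n:ℝ) ^ (23 * n) * t := le_mul_of_one_le_left ht.le hN
    have h3 : 3 * (n:ℝ) + 1 ≤ n ^ 3 := by nlinarith [mul_nonneg (sub_nonneg.2 hx) (sub_nonneg.2 hx)]
    have := mul_le_mul_of_nonneg_right h3 (ht.le.trans h0)
    nlinarith
  have b2 : 6 * (n:ℝ) ≤ n ^ 4 := by nlinarith [mul_nonneg (sub_nonneg.2 hx) (sub_nonneg.2 hx), pow_pos (show (0:ℝ) < n by linarith) 3, show (8:ℝ) ≤ n ^ 3 by nlinarith [mul_nonneg (sub_nonneg.2 hx) (sub_nonneg.2 hx)]]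
  have b3 : 48 * (n:ℝ) ≤ n ^ 7 := by
    have : (2:ℝ) ^ 6 ≤ (n:ℝ) ^ 6 := by gcongr
    rw [show (n:ℝ) ^ 7 = n ^ 6 * n by ring]
    norm_num at this
    nlinarith
  have b4 : (4:ℝ) ≤ n ^ 2 := by nlinarith
  calc 6 * n * (48 * n) ^ n * (n * (3 * ((n:ℝ) ^ (23 * n) * t)) + ε) * (2 * 4 ^ n)
      ≤ n ^ 4 * (n ^ 7) ^ n * (n ^ 3 * ((n:ℝ) ^ (23 * n) * t)) * (n * (n ^ 2) ^ n) := by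
        gcongr
    _ = (n:ℝ) ^ (8 + 32 * n) * t := by
        rw [← pow_mul, ← pow_mul, show 8 + 32 * n = 4 + 7 * n + 3 + 23 * n + 1 + 2 * n by ring]
        simp only [pow_add]; ring
    _ ≤ _ := mul_le_mul_of_nonneg_right (pow_le_pow_right₀ h1x (by omega)) ht.le

lemma stab_aux (n : ℕ) (hn : 2 ≤ n) (K : Set (EE n))
    (hKcomp : IsCompact K) (hK : Convex ℝ K)
    (hLoewner : IsLoewnerEllipsoid (closedBall (0 : EE n) 1) K)
    (w : Fin (n + 1) → EE n) (hw : IsRegVerts w)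
    (s : ℝ) (hs0 : 0 < s) (hs1 : s < 1)
    (hℓ : (1 - s ^ 4) * ellNorm n (convexHull ℝ (Set.range w)) ≤ ellNorm n K)
    (hsm : (n:ℝ) ^ (24 * n) * s ≤ 1) :
    ∃ T : EE n ≃ₗᵢ[ℝ] EE n,
      volDist K (T '' convexHull ℝ (Set.range w)) ≤ (n : ℝ) ^ (26 * n) * s ∧
      hausdorffDist K (T '' convexHull ℝ (Set.range w)) ≤ (n : ℝ) ^ (26 * n) * s := by
  have hn1 : 1 ≤ n := by omega
  have hx : (2:ℝ) ≤ n := by exact_mod_cast hn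
  have h1x : (1:ℝ) ≤ n := by linarith
  have hK1 : K ⊆ closedBall 0 1 := hLoewner.2.1
  obtain ⟨ι, _, c, u, hc0, hc1, huK, hu, hcu, hF⟩ := john_loewner hn1 K hKcomp hLoewner
  have hb := john_gauge_le hn1 hK hc0 hc1 hcu hu huK hF
  set η := ∑ i, ∑ j, (((n:ℝ) + 1) * c i) * (((n:ℝ) + 1) * c j) * (⟪lft (u i), lft (u j)⟫ ^ 2 *
      (1 - ⟪lft (u i), lft (u j)⟫)) with hη
  have hv : ∀ i, ‖lft (u i)‖ = 1 := fun i => lft_norm hn1 _ (hu i)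
  have hd : ∀ i, 0 ≤ ((n:ℝ) + 1) * c i := fun i => mul_nonneg (by positivity) (hc0 i)
  have hη0 : 0 ≤ η := by
    refine Finset.sum_nonneg fun i _ => Finset.sum_nonneg fun j _ => mul_nonneg (mul_nonneg (hd i) (hd j))
      (mul_nonneg (sq_nonneg _) ?_)
    have := (abs_le.1 (abs_real_inner_le_norm (lft (u i)) (lft (u j)))).2
    rw [hv, hv] at this; linarith
  have hgap := ell_gap hn1 hK hc0 hc1 huK hu hcu hF hw η hη hη0
  have hε0 : 0 < s ^ 4 := by positivity
  have hDc : 0 < Dc (n + 1) := by unfold Dc; positivity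
  -- bound on eta
  have hE : 0.3 ^ (n + 1) * Dc (n + 1) * η ≤ s ^ 4 * (2 * n * 2 ^ n) := by
    have hle := ell_le hn1 (convex_convexHull ℝ (range w)) (reg_ball hn1 hw)
    have h1 : (ellNorm n (convexHull ℝ (range w)) - ellNorm n K) / √(n:ℝ) ≤ s ^ 4 * (n * 2 ^ n) := by
      rw [div_le_iff₀ (Real.sqrt_pos.2 (by linarith))]
      have h2 : (1:ℝ) ≤ √(n:ℝ) := by rw [Real.one_le_sqrt]; exact h1x
      have h3 : s ^ 4 * ellNorm n (convexHull ℝ (range w)) ≤ s ^ 4 * (n * 2 ^ n) := by gcongr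
      have h4 : s ^ 4 * (n * 2 ^ n) ≤ s ^ 4 * (n * 2 ^ n) * √(n:ℝ) :=
        le_mul_of_one_le_right (by positivity) h2
      linarith
    have h5 : (1:ℝ) ≤ √((n:ℝ) + 1) := by rw [Real.one_le_sqrt]; linarith
    have h6 : 0 ≤ (0.3:ℝ) ^ (n + 1) * (Dc (n + 1) * η) := by positivity
    nlinarith
  haveI : Fact (Module.finrank ℝ (WW n) = n + 1) := ⟨WW_finrank n⟩
  obtain ⟨f, hf⟩ := select (m := n + 1) (by omega) hd (lft_frame hn1 hc1 hcu hF) hv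
  rw [← hη] at hf
  set q := (n:ℝ) ^ (23 * n) * s ^ 2 with hq
  have hq0 : 0 ≤ q := by positivity
  have hq1 : q < 1 := by
    have : (n:ℝ) ^ (23 * n) ≤ n ^ (24 * n) := pow_le_pow_right₀ h1x (by omega)
    calc q = (n:ℝ) ^ (23 * n) * s * s := by rw [hq]; ring
      _ ≤ n ^ (24 * n) * s * s := by gcongr
      _ ≤ 1 * s := by gcongr
      _ < 1 := by linarith
  have hQ : ∑ a, ∑ b, (if a = b then 0 else ⟪lft (u (f a)), lft (u (f b))⟫ ^ 2) ≤ q ^ 2 := by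
    refine hf.trans ?_
    have hc := const1 hn
    have hM : 0 < (0.3:ℝ) ^ (n + 1) * Dc (n + 1) := by positivity
    have h1 : (0.3:ℝ) ^ (n + 1) * Dc (n + 1) * (2 * ((n + 1 : ℕ) : ℝ) ^ (2 * (n + 1) + 2) * η) ≤
        (0.3:ℝ) ^ (n + 1) * Dc (n + 1) * ((n:ℝ) ^ (45 * n) * s ^ 4) := by
      calc (0.3:ℝ) ^ (n + 1) * Dc (n + 1) * (2 * ((n + 1 : ℕ) : ℝ) ^ (2 * (n + 1) + 2) * η)
          = (2 * ((n + 1 : ℕ) : ℝ) ^ (2 * (n + 1) + 2)) * (0.3 ^ (n + 1) * Dc (n + 1) * η) := by ring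
        _ ≤ (2 * ((n + 1 : ℕ) : ℝ) ^ (2 * (n + 1) + 2)) * (s ^ 4 * (2 * n * 2 ^ n)) := by gcongr
        _ = (2 * ((n + 1 : ℕ) : ℝ) ^ (2 * (n + 1) + 2) * (2 * n * 2 ^ n)) * s ^ 4 := by ring
        _ ≤ ((n:ℝ) ^ (45 * n) * (0.3 ^ (n + 1) * Dc (n + 1))) * s ^ 4 := by gcongr
        _ = _ := by ring
    refine (le_of_mul_le_mul_left h1 hM).trans ?_
    rw [hq, mul_pow, ← pow_mul, ← pow_mul]
    exact mul_le_mul_of_nonneg_right (pow_le_pow_right₀ h1x (by omega)) (by positivity)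
  obtain ⟨T, hT⟩ := near_reg hn1 hw (fun a => hu (f a)) hq0 hq1 hQ
  have hw' : IsRegVerts (fun a => T (w a)) :=
    ⟨fun a => by rw [T.norm_map, hw.1], fun a b hab => by rw [T.inner_map_map, hw.2 a b hab]⟩
  have himg : T '' convexHull ℝ (range w) = convexHull ℝ (range fun a => T (w a)) := by
    have := T.toLinearEquiv.toLinearMap.image_convexHull (range w)
    rw [← range_comp] at this
    exact this
  refine ⟨T, ?_⟩
  rw [himg]
  set D := convexHull ℝ (range fun a => T (w a)) with hD
  have hl' : (1 - s ^ 4) * ellNorm n D ≤ ellNorm n K := by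
    refine le_trans ?_ hℓ
    have : s ^ 4 ≤ 1 := pow_le_one₀ hs0.le hs1.le
    exact mul_le_mul_of_nonneg_left (ell_reg_le hn1 hw' hw) (by linarith)
  set κ := 6 * n * (48 * n) ^ n * (n * (3 * q) + s ^ 4) with hκ
  have hκ0 : 0 ≤ κ := by positivity
  have hk1 : ∀ z ∈ K, gauge D z ≤ 1 + κ := fun z hz => by
    rw [hD, reg_gauge_le hn1 hw']
    exact kappa_bound hn1 hK hK1 hb hw' (fun a => huK (f a)) hT hε0 hl' hz
  have hk2 : ∀ z ∈ D, gauge K z ≤ 1 + κ := fun z hz => by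
    have h1 := gauge_K_le hn1 hK hb hw' (fun a => huK (f a)) hT z
    have h2 : gauge D z ≤ 1 := gauge_le_one_of_mem hz
    have h3 : (1 + n * (3 * q)) * gauge D z ≤ (1 + n * (3 * q)) * 1 := by gcongr
    have h4 : n * (3 * q) + s ^ 4 ≤ κ := by
      rw [hκ]
      refine le_mul_of_one_le_left (by positivity) ?_
      have : (1:ℝ) ≤ (48 * n) ^ n := one_le_pow₀ (by linarith)
      nlinarith
    linarith
  have hfin : κ * (2 * 4 ^ n) ≤ (n:ℝ) ^ (26 * n) * s ∧ κ * (2 * 4 ^ n) ≤ 1 := by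
    have h1 := const2 hn (t := s ^ 2) (ε := s ^ 4) (by positivity) hε0.le
      (pow_le_pow_of_le_one hs0.le hs1.le (by norm_num))
    constructor
    · refine h1.trans ?_
      have h2 : (n:ℝ) ^ (11 * n) * s ≤ 1 := (mul_le_mul_of_nonneg_right (pow_le_pow_right₀ h1x (by omega)) hs0.le).trans hsm
      calc (n:ℝ) ^ (37 * n) * s ^ 2 = n ^ (26 * n) * s * (n ^ (11 * n) * s) := by
            rw [show 37 * n = 26 * n + 11 * n by ring, pow_add]; ring
        _ ≤ _ := mul_le_of_le_one_right (by positivity) h2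
    · refine h1.trans ?_
      calc (n:ℝ) ^ (37 * n) * s ^ 2 ≤ n ^ (48 * n) * s ^ 2 := mul_le_mul_of_nonneg_right (pow_le_pow_right₀ h1x (by omega)) (by positivity)
        _ = (n ^ (24 * n) * s) ^ 2 := by rw [mul_pow, ← pow_mul]; congr 2; ring
        _ ≤ 1 := pow_le_one₀ (by positivity) hsm
  have h4n : (1:ℝ) ≤ 4 ^ n := one_le_pow₀ (by norm_num)
  have hκle : κ ≤ κ * (2 * 4 ^ n) := le_mul_of_one_le_right hκ0 (by linarith)
  have hDb : D ⊆ closedBall 0 1 := reg_sub_ball hw'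
  have hDc' : IsClosed D := ((finite_range _).isCompact_convexHull (𝕜 := ℝ)).isClosed
  have hDn : D ∈ nhds (0 : EE n) := ball_absorbent hn1 (reg_ball hn1 hw')
  obtain ⟨v1, d1⟩ := vol_diff hK1 hDc' (convex_convexHull ℝ _) hDb hDn hκ0 (hκle.trans hfin.2) hk1
  obtain ⟨v2, d2⟩ := vol_diff hDb hKcomp.isClosed hK hK1 (ball_absorbent hn1 hb) hκ0 (hκle.trans hfin.2) hk2
  constructor
  · rw [volDist]
    refine le_trans ?_ hfin.1
    linarith
  · refine le_trans ?_ (hκle.trans hfin.1)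
    exact hausdorffDist_le_of_mem_dist hκ0 d1 d2
end Part13


theorem loewner_ell_stability
    (n : ℕ) (hn : 1 ≤ n) (K : Set (EuclideanSpace ℝ (Fin n)))
    (hKcomp : IsCompact K) (hKconv : Convex ℝ K) (hKint : (interior K).Nonempty)
    (hLoewner : IsLoewnerEllipsoid (closedBall (0 : EuclideanSpace ℝ (Fin n)) 1) K)
    (w : Fin (n + 1) → EuclideanSpace ℝ (Fin n)) (hw : IsRegVerts w)
    (ε : ℝ) (hε0 : 0 < ε) (hε1 : ε < 1)
    (hℓ : (1 - ε) * ellNorm n (convexHull ℝ (Set.range w)) ≤ ellNorm n K) :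
    ∃ T : EuclideanSpace ℝ (Fin n) ≃ₗᵢ[ℝ] EuclideanSpace ℝ (Fin n),
      volDist K (T '' convexHull ℝ (Set.range w)) ≤ (n : ℝ) ^ (26 * n) * ε ^ ((1 : ℝ) / 4) ∧
      hausdorffDist K (T '' convexHull ℝ (Set.range w)) ≤
        (n : ℝ) ^ (26 * n) * ε ^ ((1 : ℝ) / 4) := by
  have hs4 : (ε ^ ((1 : ℝ) / 4)) ^ 4 = ε := by
    rw [← Real.rpow_natCast, ← Real.rpow_mul hε0.le]; norm_num
  have hs0 : 0 < ε ^ ((1 : ℝ) / 4) := Real.rpow_pos_of_pos hε0 _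
  have hs1 : ε ^ ((1 : ℝ) / 4) < 1 := Real.rpow_lt_one hε0.le hε1 (by norm_num)
  generalize ε ^ ((1 : ℝ) / 4) = s at *
  have hK1 : K ⊆ closedBall 0 1 := hLoewner.2.1
  have hb : closedBall 0 (1 / (n:ℝ)) ⊆ K := by
    obtain ⟨ι, _, c, u, hc0, hc1, huK, hu, hcu, hF⟩ := john_loewner hn K hKcomp hLoewner
    exact john_gauge_le hn hKconv hc0 hc1 hcu hu huK hF
  have hbD := reg_ball hn hw
  have hD1 := reg_sub_ball hw
  have hrefl : ∀ S : Set (EuclideanSpace ℝ (Fin n)),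
      (LinearIsometryEquiv.refl ℝ (EuclideanSpace ℝ (Fin n))) '' S = S := fun S => by simp
  rcases Nat.lt_or_ge n 2 with h2 | h2
  · obtain rfl : n = 1 := by omega
    norm_num at hb hbD
    have e1 : K = closedBall 0 1 := hK1.antisymm hb
    have e2 : convexHull ℝ (Set.range w) = closedBall 0 1 := hD1.antisymm hbD
    refine ⟨LinearIsometryEquiv.refl ℝ _, ?_⟩
    rw [hrefl, e1, e2, hausdorffDist_self_zero, volDist]
    simp [hs0.le]
  have hx : (2:ℝ) ≤ n := by exact_mod_cast h2
  have h1x : (1:ℝ) ≤ n := by linarith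
  rcases le_or_gt ((2:ℝ) ^ (n + 1)) ((n:ℝ) ^ (26 * n) * s) with hc | hc
  · refine ⟨LinearIsometryEquiv.refl ℝ _, ?_⟩
    rw [hrefl]
    have hz : (0 : EuclideanSpace ℝ (Fin n)) ∈ closedBall 0 (1 / (n:ℝ)) :=
      mem_closedBall_self (by positivity)
    constructor
    · refine le_trans ?_ hc
      have hfin : volume (closedBall (0 : EuclideanSpace ℝ (Fin n)) 1) ≠ ⊤ :=
        (isCompact_closedBall _ _).measure_lt_top.ne
      have hv := vol_ball_le (n := n)
      have a1 : (volume (K \ convexHull ℝ (Set.range w))).toReal ≤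
          (volume (closedBall (0 : EuclideanSpace ℝ (Fin n)) 1)).toReal :=
        ENNReal.toReal_mono hfin (measure_mono (diff_subset.trans hK1))
      have a2 : (volume (convexHull ℝ (Set.range w) \ K)).toReal ≤
          (volume (closedBall (0 : EuclideanSpace ℝ (Fin n)) 1)).toReal :=
        ENNReal.toReal_mono hfin (measure_mono (diff_subset.trans hD1))
      rw [volDist, pow_succ]
      linarith
    · refine le_trans ?_ ((one_le_pow₀ (by norm_num)).trans hc)
      exact hausdorffDist_le_of_mem_dist zero_le_one
        (fun x hx => ⟨0, hbD hz, hK1 hx⟩) (fun x hx => ⟨0, hb hz, hD1 hx⟩)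
  · refine stab_aux n h2 K hKcomp hKconv hLoewner w hw s hs0 hs1 (by rw [hs4]; exact hℓ) ?_
    have hp : (0:ℝ) < (n:ℝ) ^ (2 * n) := by positivity
    have h3 : (2:ℝ) ^ (n + 1) ≤ (n:ℝ) ^ (2 * n) :=
      (pow_le_pow_left₀ (by norm_num) hx _).trans (pow_le_pow_right₀ h1x (by omega))
    have h4 : (n:ℝ) ^ (2 * n) * ((n:ℝ) ^ (24 * n) * s) ≤ (n:ℝ) ^ (2 * n) * 1 := by
      rw [← mul_assoc, ← pow_add, show 2 * n + 24 * n = 26 * n by ring]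
      linarith
    exact le_of_mul_le_mul_left h4 hp

end
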